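/- Let n ∈ ℕ, E a complex Banach space, s ∈ ℝ, 0 < p < ∞, 0 < q ≤ ∞, d > 0, and let S ∈ ℤ with S ≥ −1 and S ≥ ⌊s⌋. Let ε > 0 and Ψ, ψ ∈ S(ℝ^n) satisfy |Ψ(x)| > 0 for |x| < 2ε, |ψ(x)| > 0 for ε/2 < |x| < 2ε, and D^α ψ(0) = 0 for all multi-indices |α| ≤ S. Then both ‖f‖^I := ‖(Ψ f̂)ˇ|L_p(E)‖ + ‖ (∫₀¹ t^{−sq} ‖(ψ(t·) f̂)ˇ(·)‖_E^q dt/t)^{1/q} |L_p‖ and ‖f‖^{sup} := ‖ sup_{|x−y|≤d} ‖(Ψ f̂)ˇ(y)‖_E |L_p(dx)‖ + ‖ (∫₀¹ t^{−sq} sup_{|x−y|≤dt, t≤τ≤2t} ‖(ψ(τ·) f̂)ˇ(y)‖_E^q dt/t)^{1/q} |L_p(dx)‖ are equivalent quasi-norms on F^s_{p,q}(E), i.e. each is bounded above and below by constant multiples of ‖f|F^s_{p,q}(E)‖ for f ∈ F^s_{p,q}(E). Moreover, an f ∈ S'(ℝ^n,E) belongs to F^s_{p,q}(E) if and only if ‖f‖^I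 < ∞, and if and only if ‖f‖^{sup} < ∞. -/

import Mathlib

noncomputable section

open MeasureTheory Filter Metric Real Set SchwartzMap
open scoped ENNReal NNReal Topology FourierTransform

/-- Euclidean space ℝⁿ. -/
abbrev Rn (n : ℕ) : Type := EuclideanSpace ℝ (Fin n)

/-- The Schwartz space 𝓢(ℝⁿ, ℂ). -/
abbrev Sch (n : ℕ) : Type := SchwartzMap (Rn n) ℂ

/-- Partial derivative in the `i`-th coordinate direction. -/
def pd {F : Type*} [NormedAddCommGroup F] [NormedSpace ℝ F] {n : ℕ} (i : Fin n)
    (g : Rn n → F) : Rn n → F :=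
  fun x => lineDeriv ℝ g x (EuclideanSpace.single i (1 : ℝ))

/-- Multi-index derivative `D^α = ∂₁^{α₁} ⋯ ∂ₙ^{αₙ}`. -/
def mderiv {F : Type*} [NormedAddCommGroup F] [NormedSpace ℝ F] {n : ℕ} (α : Fin n → ℕ)
    (g : Rn n → F) : Rn n → F :=
  (List.finRange n).foldr (fun i h => (pd i)^[α i] h) g

/-- The order `|α|` of a multi-index. -/
def mdeg {n : ℕ} (α : Fin n → ℕ) : ℕ := ∑ i, α i

/-- The Schwartz seminorm `‖φ‖_{K,L} = sup_x (1+|x|²)^{K/2} ∑_{|α| ≤ L} |D^α φ(x)|`. -/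
def schSemi {n : ℕ} (K L : ℕ) (φ : Sch n) : ℝ :=
  ⨆ x : Rn n, (1 + ‖x‖ ^ 2) ^ ((K : ℝ) / 2) *
    ∑ α : Fin n → Fin (L + 1), if mdeg (fun i => (α i : ℕ)) ≤ L
      then ‖mderiv (fun i => (α i : ℕ)) (fun y => φ y) x‖ else 0

/-- `E`-valued tempered distributions: linear maps `𝓢(ℝⁿ) → E` bounded by some
Schwartz seminorm. -/
structure TDist (n : ℕ) (E : Type*) [NormedAddCommGroup E] [NormedSpace ℂ E] where
  toFun : Sch n →ₗ[ℂ] E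
  bound : ∃ (c : ℝ) (K L : ℕ), ∀ φ : Sch n, ‖toFun φ‖ ≤ c * schSemi K L φ

namespace Aux

lemma hasTemperateGrowth_sub_left {n : ℕ} (x : Rn n) :
    Function.HasTemperateGrowth (fun y : Rn n => x - y) := by
  apply Function.HasTemperateGrowth.of_fderiv (k := 1) (C := ‖x‖ + 1)
  · have h : (fderiv ℝ (fun y : Rn n => x - y)) =
        fun _ : Rn n => -(ContinuousLinearMap.id ℝ (Rn n)) := by
      ext1 y
      rw [fderiv_const_sub]
      simp
    rw [h]
    exact .const _
  · exact (differentiable_const x).sub differentiable_id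
  · intro y
    have h1 : ‖x - y‖ ≤ ‖x‖ + ‖y‖ := norm_sub_le x y
    have h2 : (0:ℝ) ≤ ‖y‖ := norm_nonneg y
    have h3 : (0:ℝ) ≤ ‖x‖ := norm_nonneg x
    calc ‖x - y‖ ≤ ‖x‖ + ‖y‖ := h1
      _ ≤ (‖x‖ + 1) * (1 + ‖y‖) ^ 1 := by nlinarith

lemma antilipschitz_sub_left {n : ℕ} (x : Rn n) :
    AntilipschitzWith 1 (fun y : Rn n => x - y) := by
  refine (Isometry.antilipschitz ?_)
  intro y z
  simp only [edist_dist, dist_eq_norm, sub_sub_sub_cancel_left, norm_sub_rev]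

end Aux

/-- The Schwartz function `y ↦ ψ(x - y)`. -/
def shiftReflect {n : ℕ} (ψ : Sch n) (x : Rn n) : Sch n :=
  SchwartzMap.compCLMOfAntilipschitz (𝕜 := ℝ)
    (Aux.hasTemperateGrowth_sub_left x) (Aux.antilipschitz_sub_left x) ψ

/-- The dilated Schwartz function `ψ(t ·)` (junk value `0` when `t = 0`). -/
def dilate {n : ℕ} (ψ : Sch n) (t : ℝ) : Sch n :=
  if h : t = 0 then 0 else
    SchwartzMap.compCLM (𝕜 := ℝ) (g := fun y : Rn n => t • y)
      (by
        have := (t • ContinuousLinearMap.id ℝ (Rn n)).hasTemperateGrowth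
        exact this)
      (⟨1, |t|⁻¹, fun y => by
        have ht : 0 < |t| := abs_pos.mpr h
        have : ‖t • y‖ = |t| * ‖y‖ := by rw [norm_smul]; simp [Real.norm_eq_abs]
        rw [pow_one, this]
        rw [mul_add, mul_one]
        have : |t|⁻¹ * (|t| * ‖y‖) = ‖y‖ := by field_simp
        nlinarith [norm_nonneg y, inv_pos.mpr ht]⟩) ψ

/-- Fourier transform on Schwartz space. -/
def fourierS {n : ℕ} (φ : Sch n) : Sch n := FourierTransform.fourierCLE ℂ (Sch n) φ

/-- Inverse Fourier transform on Schwartz space. -/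
def invFourierS {n : ℕ} (φ : Sch n) : Sch n := (FourierTransform.fourierCLE ℂ (Sch n)).symm φ

variable {n : ℕ} {E : Type*} [NormedAddCommGroup E] [NormedSpace ℂ E]

/-- Convolution `(ψ * f)(x) := (2π)^{-n/2} f(ψ(x - ·))` of a Schwartz function with an
`E`-valued tempered distribution. -/
def tdConv (ψ : Sch n) (f : TDist n E) : Rn n → E :=
  fun x => ((2 * π) ^ (-(n : ℝ) / 2) : ℝ) • f.toFun (shiftReflect ψ x)

/-- The operator `f ↦ (φ f̂)ˇ = φ̌ * f`. -/
def mOp (φ : Sch n) (f : TDist n E) : Rn n → E := tdConv (invFourierS φ) f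

/-- `L_p`-norm (in `[0,∞]`) of an `ℝ≥0∞`-valued function. -/
def lpNormENN {n : ℕ} (p : ℝ≥0∞) (g : Rn n → ℝ≥0∞) : ℝ≥0∞ :=
  if p = ∞ then essSup g volume else (∫⁻ x, (g x) ^ p.toReal) ^ (1 / p.toReal)

/-- `ℓ_q`-norm (in `[0,∞]`) of a sequence, with the usual modification for `q = ∞`. -/
def lqSum (q : ℝ≥0∞) (a : ℕ → ℝ≥0∞) : ℝ≥0∞ :=
  if q = ∞ then ⨆ j, a j else (∑' j, (a j) ^ q.toReal) ^ (1 / q.toReal)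

/-- A smooth dyadic resolution of unity. -/
structure SmoothResolution (n : ℕ) (φ : ℕ → Sch n) : Prop where
  supp0 : Function.support (φ 0) ⊆ {ξ : Rn n | ‖ξ‖ ≤ 2}
  suppj : ∀ j : ℕ, 0 < j →
    Function.support (φ j) ⊆ {ξ : Rn n | 2 ^ ((j : ℝ) - 1) ≤ ‖ξ‖ ∧ ‖ξ‖ ≤ 2 ^ ((j : ℝ) + 1)}
  sum_eq : ∀ ξ : Rn n, ∑' j : ℕ, φ j ξ = 1
  deriv_bound : ∀ α : Fin n → ℕ, ∃ c : ℝ, ∀ (j : ℕ) (ξ : Rn n),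
    ‖mderiv α (fun y => φ j y) ξ‖ ≤ c * 2 ^ (-(j : ℝ) * (mdeg α : ℝ))

/-- The Besov quasi-norm `‖f | B^s_{p,q}(E)‖` w.r.t. the resolution of unity `φ`. -/
def besovNorm (s : ℝ) (p q : ℝ≥0∞) (φ : ℕ → Sch n) (f : TDist n E) : ℝ≥0∞ :=
  lqSum q fun j => (2 : ℝ≥0∞) ^ ((j : ℝ) * s) * eLpNorm (mOp (φ j) f) p volume

/-- The Triebel–Lizorkin quasi-norm `‖f | F^s_{p,q}(E)‖` w.r.t. the resolution of unity `φ`. -/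
def triebelNorm (s : ℝ) (p q : ℝ≥0∞) (φ : ℕ → Sch n) (f : TDist n E) : ℝ≥0∞ :=
  lpNormENN p fun x =>
    lqSum q fun j => (2 : ℝ≥0∞) ^ ((j : ℝ) * s) * (‖mOp (φ j) f x‖₊ : ℝ≥0∞)

variable {n : ℕ} {E : Type*} [NormedAddCommGroup E] [NormedSpace ℂ E]

/-- `‖(Ψf̂)ˇ|L_p(E)‖ + (∫₀¹ t^{-sq}‖(ψ(t·)f̂)ˇ|L_p(E)‖^q dt/t)^{1/q}`. -/
def besovContNormI (s : ℝ) (p q : ℝ≥0∞) (Ψ ψ : Sch n) (f : TDist n E) : ℝ≥0∞ :=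
  eLpNorm (mOp Ψ f) p volume +
    (if q = ∞ then
      essSup (fun t : ℝ => ENNReal.ofReal (t ^ (-s)) * eLpNorm (mOp (dilate ψ t) f) p volume)
        (volume.restrict (Ioc (0 : ℝ) 1))
    else
      (∫⁻ t in Ioc (0 : ℝ) 1,
        (ENNReal.ofReal (t ^ (-s)) * eLpNorm (mOp (dilate ψ t) f) p volume) ^ q.toReal *
          ENNReal.ofReal t⁻¹) ^ (1 / q.toReal))

/-- `x ↦ sup_{|x-y| ≤ d} ‖g(y)‖`. -/
def supBall (d : ℝ) (g : Rn n → E) : Rn n → ℝ≥0∞ :=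
  fun x => ⨆ (y : Rn n) (_ : dist x y ≤ d), (‖g y‖₊ : ℝ≥0∞)

/-- `x ↦ sup_{|x-y| ≤ dt, t ≤ τ ≤ 2t} ‖(ψ(τ·)f̂)ˇ(y)‖`. -/
def supLocal (d : ℝ) (ψ : Sch n) (f : TDist n E) (t : ℝ) : Rn n → ℝ≥0∞ :=
  fun x => ⨆ (y : Rn n) (_ : dist x y ≤ d * t) (τ : ℝ) (_ : τ ∈ Icc t (2 * t)),
    (‖mOp (dilate ψ τ) f y‖₊ : ℝ≥0∞)

/-- `‖sup_{|·-y|≤d}‖(Ψf̂)ˇ(y)‖|L_p‖ + (∫₀¹ t^{-sq}‖sup‖(ψ(τ·)f̂)ˇ‖|L_p‖^q dt/t)^{1/q}`. -/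
def besovContNormSup (s : ℝ) (p q : ℝ≥0∞) (d : ℝ) (Ψ ψ : Sch n) (f : TDist n E) : ℝ≥0∞ :=
  lpNormENN p (supBall d (mOp Ψ f)) +
    (if q = ∞ then
      essSup (fun t : ℝ => ENNReal.ofReal (t ^ (-s)) * lpNormENN p (supLocal d ψ f t))
        (volume.restrict (Ioc (0 : ℝ) 1))
    else
      (∫⁻ t in Ioc (0 : ℝ) 1,
        (ENNReal.ofReal (t ^ (-s)) * lpNormENN p (supLocal d ψ f t)) ^ q.toReal *
          ENNReal.ofReal t⁻¹) ^ (1 / q.toReal))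

/-- `‖(Ψf̂)ˇ|L_p(E)‖ + ‖(∫₀¹ t^{-sq}‖(ψ(t·)f̂)ˇ(·)‖^q dt/t)^{1/q}|L_p‖`. -/
def triebelContNormI (s : ℝ) (p q : ℝ≥0∞) (Ψ ψ : Sch n) (f : TDist n E) : ℝ≥0∞ :=
  eLpNorm (mOp Ψ f) p volume +
    lpNormENN p fun x =>
      if q = ∞ then
        essSup (fun t : ℝ =>
            ENNReal.ofReal (t ^ (-s)) * (‖mOp (dilate ψ t) f x‖₊ : ℝ≥0∞))
          (volume.restrict (Ioc (0 : ℝ) 1))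
      else
        (∫⁻ t in Ioc (0 : ℝ) 1,
          (ENNReal.ofReal (t ^ (-s)) * (‖mOp (dilate ψ t) f x‖₊ : ℝ≥0∞)) ^ q.toReal *
            ENNReal.ofReal t⁻¹) ^ (1 / q.toReal)

/-- `‖sup_{|·-y|≤d}‖(Ψf̂)ˇ(y)‖|L_p‖ + ‖(∫₀¹ t^{-sq} sup‖(ψ(τ·)f̂)ˇ(y)‖^q dt/t)^{1/q}|L_p‖`. -/
def triebelContNormSup (s : ℝ) (p q : ℝ≥0∞) (d : ℝ) (Ψ ψ : Sch n) (f : TDist n E) : ℝ≥0∞ :=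
  lpNormENN p (supBall d (mOp Ψ f)) +
    lpNormENN p fun x =>
      if q = ∞ then
        essSup (fun t : ℝ => ENNReal.ofReal (t ^ (-s)) * supLocal d ψ f t x)
          (volume.restrict (Ioc (0 : ℝ) 1))
      else
        (∫⁻ t in Ioc (0 : ℝ) 1,
          (ENNReal.ofReal (t ^ (-s)) * supLocal d ψ f t x) ^ q.toReal *
            ENNReal.ofReal t⁻¹) ^ (1 / q.toReal)

end

noncomputable section

open MeasureTheory Filter Metric Real Set SchwartzMap
open scoped ENNReal NNReal Topology FourierTransform

namespace TL

/-- ball averages -/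
def avg {n : ℕ} (h : Rn n → ℝ≥0∞) (i : ℤ) (x : Rn n) : ℝ≥0∞ :=
  (volume (closedBall x ((2:ℝ) ^ i)))⁻¹ * ∫⁻ y in closedBall x ((2:ℝ) ^ i), h y

/-- maximal function over dyadic radii -/
def MM {n : ℕ} (h : Rn n → ℝ≥0∞) (x : Rn n) : ℝ≥0∞ := ⨆ i : ℤ, avg h i x

lemma vol_ball {n : ℕ} (x : Rn n) {r : ℝ} (hr : 0 ≤ r) :
    volume (closedBall x r) = ENNReal.ofReal (r ^ n) * volume (closedBall (0 : Rn n) 1) := by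
  have := Measure.addHaar_closedBall_mul (volume : Measure (Rn n)) x hr (s := 1) zero_le_one
  simpa using this

lemma vol_ball_ne_zero {n : ℕ} (x : Rn n) {r : ℝ} (hr : 0 < r) :
    volume (closedBall x r) ≠ 0 := (measure_closedBall_pos volume x hr).ne'

lemma vol_ball_ne_top {n : ℕ} (x : Rn n) (r : ℝ) :
    volume (closedBall x r) ≠ ∞ := measure_closedBall_lt_top.ne

lemma measurable_avg {n : ℕ} {h : Rn n → ℝ≥0∞} (hh : Measurable h) (i : ℤ) :
    Measurable (avg h i) := by
  have e : avg h i = fun x => (volume (closedBall (0 : Rn n) ((2:ℝ) ^ i)))⁻¹ *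
      ∫⁻ y, ({z : Rn n × Rn n | dist z.2 z.1 ≤ (2:ℝ) ^ i}.indicator (fun z => h z.2)) (x, y) := by
    ext x
    unfold avg
    congr 1
    · congr 1
      rw [vol_ball x (by positivity), vol_ball 0 (r := (2:ℝ) ^ i) (by positivity)]
    · rw [← lintegral_indicator measurableSet_closedBall]
      rfl
  rw [e]
  refine Measurable.const_mul ?_ _
  refine Measurable.lintegral_prod_right' (f := ({z : Rn n × Rn n | dist z.2 z.1 ≤ (2:ℝ) ^ i}.indicator (fun z => h z.2))) ?_
  refine (hh.comp measurable_snd).indicator ?_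
  exact measurableSet_le (measurable_snd.dist measurable_fst) measurable_const

lemma measurable_MM {n : ℕ} {h : Rn n → ℝ≥0∞} (hh : Measurable h) : Measurable (MM h) :=
  Measurable.iSup fun i => measurable_avg hh i

lemma weak_aux {n : ℕ} (h : Rn n → ℝ≥0∞) {c : ℝ≥0∞} (hc : c ≠ 0) (hc' : c ≠ ∞) (I : ℤ) :
    volume {x | ∃ i ≤ I, c < avg h i x} ≤ ENNReal.ofReal (5 ^ n) * c⁻¹ * ∫⁻ y, h y := by
  set t : Set (Rn n × ℤ) := {a | a.2 ≤ I ∧ c < avg h a.2 a.1} with ht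
  obtain ⟨u, hut, hdisj, hcov⟩ := Vitali.exists_disjoint_subfamily_covering_enlargement_closedBall
    t (fun a => a.1) (fun a => (2:ℝ) ^ a.2) ((2:ℝ) ^ I)
    (fun a ha => zpow_le_zpow_right₀ one_le_two ha.1) 5 (by norm_num)
  have hcount : u.Countable := by
    refine hdisj.countable_of_nonempty_interior fun a _ => ?_
    refine ⟨a.1, ?_⟩
    exact ball_subset_interior_closedBall (mem_ball_self (by positivity))
  calc volume {x | ∃ i ≤ I, c < avg h i x}
      ≤ volume (⋃ b ∈ u, closedBall b.1 (5 * (2:ℝ) ^ b.2)) := by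
        refine measure_mono fun x hx => ?_
        obtain ⟨i, hi, hx⟩ := hx
        obtain ⟨b, hb, hsub⟩ := hcov (x, i) ⟨hi, hx⟩
        simp only [mem_iUnion]
        exact ⟨b, hb, hsub (mem_closedBall_self (by positivity))⟩
    _ ≤ ∑' b : u, volume (closedBall b.1.1 (5 * (2:ℝ) ^ b.1.2)) :=
        measure_biUnion_le _ hcount _
    _ ≤ ∑' b : u, ENNReal.ofReal (5 ^ n) * c⁻¹ * ∫⁻ y in closedBall b.1.1 ((2:ℝ) ^ b.1.2), h y := by
        refine ENNReal.tsum_le_tsum fun b => ?_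
        have hb := (hut b.2).2
        have h0 := vol_ball_ne_zero b.1.1 (r := (2:ℝ) ^ b.1.2) (by positivity)
        have h1 := vol_ball_ne_top b.1.1 ((2:ℝ) ^ b.1.2)
        have hv : volume (closedBall b.1.1 (5 * (2:ℝ) ^ b.1.2))
            = ENNReal.ofReal (5 ^ n) * volume (closedBall b.1.1 ((2:ℝ) ^ b.1.2)) := by
          rw [vol_ball _ (by positivity), vol_ball b.1.1 (r := (2:ℝ) ^ b.1.2) (by positivity), mul_pow,
            ENNReal.ofReal_mul (by positivity), mul_assoc]
        rw [hv, mul_assoc]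
        gcongr
        unfold avg at hb
        rw [mul_comm, ← div_eq_mul_inv, ENNReal.lt_div_iff_mul_lt (Or.inl h0) (Or.inl h1)] at hb
        rw [← ENNReal.div_eq_inv_mul, ENNReal.le_div_iff_mul_le (Or.inl hc) (Or.inl hc'), mul_comm]
        exact hb.le
    _ = ENNReal.ofReal (5 ^ n) * c⁻¹ * ∫⁻ y in ⋃ b ∈ u, closedBall b.1 ((2:ℝ) ^ b.2), h y := by
        rw [ENNReal.tsum_mul_left, lintegral_biUnion hcount (fun _ _ => measurableSet_closedBall) hdisj]
    _ ≤ _ := by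
        gcongr
        exact Measure.restrict_le_self

lemma weak_type {n : ℕ} (h : Rn n → ℝ≥0∞) {c : ℝ≥0∞} (hc : c ≠ 0) (hc' : c ≠ ∞) :
    volume {x | c < MM h x} ≤ ENNReal.ofReal (5 ^ n) * c⁻¹ * ∫⁻ y, h y := by
  have e : {x | c < MM h x} = ⋃ I : ℕ, {x | ∃ i ≤ (I:ℤ), c < avg h i x} := by
    ext x
    simp only [MM, mem_setOf_eq, lt_iSup_iff, mem_iUnion]
    constructor
    · rintro ⟨i, hi⟩; exact ⟨i.toNat, i, Int.self_le_toNat i, hi⟩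
    · rintro ⟨I, i, -, hi⟩; exact ⟨i, hi⟩
  rw [e, Monotone.measure_iUnion]
  · exact iSup_le fun I => weak_aux h hc hc' I
  · intro I J hIJ x ⟨i, hi, hx⟩
    exact ⟨i, hi.trans (by exact_mod_cast hIJ), hx⟩

lemma weak_type' {n : ℕ} {h : Rn n → ℝ≥0∞} (hh : Measurable h) {c : ℝ≥0∞} (hc : c ≠ 0) (hc' : c ≠ ∞) :
    volume {x | 2 * c < MM h x} ≤ ENNReal.ofReal (5 ^ n) * c⁻¹ * ∫⁻ y, {y | c < h y}.indicator h y := by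
  refine (measure_mono ?_).trans (weak_type _ hc hc')
  intro x hx
  simp only [MM, mem_setOf_eq, lt_iSup_iff] at hx ⊢
  obtain ⟨i, hi⟩ := hx
  refine ⟨i, ?_⟩
  have h0 := vol_ball_ne_zero x (r := (2:ℝ) ^ i) (by positivity)
  have h1 := vol_ball_ne_top x ((2:ℝ) ^ i)
  have key : avg h i x ≤ avg ({y | c < h y}.indicator h) i x + c := by
    unfold avg
    calc _ ≤ (volume (closedBall x ((2:ℝ) ^ i)))⁻¹ *
          ∫⁻ y in closedBall x ((2:ℝ) ^ i), ({y | c < h y}.indicator h y + c) := by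
          gcongr with y
          by_cases hy : c < h y
          · simp [indicator, hy]
          · simp [indicator, hy]; exact not_lt.mp hy
      _ = _ := by
          rw [lintegral_add_right _ measurable_const, mul_add]
          simp only [lintegral_const, Measure.restrict_apply_univ]
          rw [mul_left_comm, ENNReal.inv_mul_cancel h0 h1, mul_one]
  rw [two_mul] at hi
  exact lt_of_add_lt_add_right (hi.trans_le key)

lemma sum_geom_aux {R : ℝ} (hR : 1 < R) : ∃ C : ℝ≥0∞, C ≠ ∞ ∧ ∀ x : ℝ≥0∞,
    ∑' i : ℤ, (if (2:ℝ≥0∞) ^ i < x then (2:ℝ≥0∞) ^ ((i:ℝ) * (R - 1)) else 0) ≤ C * x ^ (R - 1) := by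
  have hR' : 0 < R - 1 := by linarith
  refine ⟨2 ^ (R-1) * ∑' m : ℕ, ((2:ℝ≥0∞) ^ (-(R - 1))) ^ m, ?_, fun x => ?_⟩
  · refine ENNReal.mul_ne_top (by simp [hR'.le]) ?_
    rw [ENNReal.tsum_geometric, Ne, ENNReal.inv_eq_top, tsub_eq_zero_iff_le, not_le]
    rw [ENNReal.rpow_neg, ENNReal.inv_lt_one]
    exact ENNReal.one_lt_rpow (by norm_num) hR'
  · rcases eq_or_ne x 0 with rfl | hx0
    · simp
    rcases eq_or_ne x ∞ with rfl | hxt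
    · rw [ENNReal.top_rpow_of_pos hR', ENNReal.mul_top]
      · exact le_top
      · simp
    obtain ⟨i0, h1, h2⟩ := ENNReal.exists_mem_Ioc_zpow hx0 hxt (y := 2) (by norm_num) (by norm_num)
    calc _ ≤ ∑' i : ℤ, (if i ≤ i0 then (2:ℝ≥0∞) ^ ((i:ℝ) * (R - 1)) else 0) := by
          refine ENNReal.tsum_le_tsum fun i => ?_
          split_ifs with h3 h4
          · exact le_rfl
          · exfalso
            have : (2:ℝ≥0∞) ^ (i0+1) ≤ 2 ^ i := ENNReal.zpow_le_of_le (by norm_num) (by omega)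
            exact absurd (h3.trans_le (h2.trans this)) (lt_irrefl _)
          · simp
          · simp
      _ = ∑' m : ℕ, (2:ℝ≥0∞) ^ ((((i0:ℤ) - (m:ℤ) : ℤ):ℝ) * (R - 1)) := by
          rw [← (Equiv.subLeft i0).tsum_eq]
          rw [← Function.Injective.tsum_eq (g := fun m : ℕ => (m:ℤ)) Nat.cast_injective]
          · simp
          · intro m hm
            simp at hm
            exact ⟨m.toNat, by simpa using hm⟩
      _ = 2 ^ ((i0:ℝ) * (R - 1)) * ∑' m : ℕ, ((2:ℝ≥0∞) ^ (-(R - 1))) ^ m := by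
          rw [← ENNReal.tsum_mul_left]
          congr 1; ext m
          rw [← ENNReal.rpow_natCast, ← ENNReal.rpow_mul, ← ENNReal.rpow_add _ _ (by norm_num) (by norm_num)]
          congr 1; push_cast; ring
      _ ≤ x ^ (R-1) * ∑' m : ℕ, ((2:ℝ≥0∞) ^ (-(R - 1))) ^ m := by
          gcongr
          rw [ENNReal.rpow_mul, ENNReal.rpow_intCast]
          exact ENNReal.rpow_le_rpow h1.le hR'.le
      _ ≤ _ := by
          rw [mul_comm (_ * _), ← mul_assoc]
          gcongr
          exact le_mul_of_one_le_right' (ENNReal.one_le_rpow (by norm_num) hR')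

lemma maximal_strong (n : ℕ) {R : ℝ} (hR : 1 < R) : ∃ C : ℝ≥0∞, C ≠ ∞ ∧
    ∀ h : Rn n → ℝ≥0∞, Measurable h → ∫⁻ x, MM h x ^ R ≤ C * ∫⁻ x, h x ^ R := by
  obtain ⟨C, hC, hgeo⟩ := sum_geom_aux hR
  refine ⟨(2:ℝ≥0∞) ^ (2 * R) * ENNReal.ofReal (5 ^ n) * C, ?_, fun h hh => ?_⟩
  · exact ENNReal.mul_ne_top (ENNReal.mul_ne_top (ENNReal.rpow_ne_top_of_nonneg (by linarith) (by norm_num)) (by simp)) hC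
  have hpt : ∀ x, MM h x ^ R ≤ ∑' i : ℤ, ({x | 2 * (2:ℝ≥0∞) ^ i < MM h x}.indicator
      (fun _ => (2:ℝ≥0∞) ^ (((i:ℝ) + 2) * R)) x) := by
    intro x
    rcases eq_or_ne (MM h x) 0 with h0 | hx0
    · rw [h0, ENNReal.zero_rpow_of_pos (by linarith)]; exact zero_le'
    rcases eq_or_ne (MM h x) ∞ with h0 | hxt
    · have : ∀ i : ℕ, (2:ℝ≥0∞) ^ i ≤ ∑' i : ℤ, ({x | 2 * (2:ℝ≥0∞) ^ i < MM h x}.indicator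
          (fun _ => (2:ℝ≥0∞) ^ (((i:ℝ) + 2) * R)) x) := by
        intro i
        refine le_trans ?_ (ENNReal.le_tsum (i:ℤ))
        have hm : x ∈ {x | 2 * (2:ℝ≥0∞) ^ (i:ℤ) < MM h x} := by
          simp [h0]; exact ENNReal.mul_lt_top (by norm_num) (by simp)
        rw [indicator_of_mem hm, ← ENNReal.rpow_natCast]
        apply ENNReal.rpow_le_rpow_of_exponent_le (by norm_num)
        push_cast; nlinarith [(Nat.cast_nonneg i : (0:ℝ) ≤ i)]
      have h2 : Tendsto (fun i : ℕ => (2:ℝ≥0∞) ^ i) atTop (𝓝 ∞) :=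
        ENNReal.tendsto_pow_atTop_nhds_top_iff.mpr (by norm_num)
      exact le_top.trans (le_of_tendsto' h2 this)
    obtain ⟨i0, h1, h2⟩ := ENNReal.exists_mem_Ioc_zpow hx0 hxt (y := 2) (by norm_num) (by norm_num)
    refine le_trans ?_ (ENNReal.le_tsum (i0 - 1))
    have hm : x ∈ {x | 2 * (2:ℝ≥0∞) ^ (i0 - 1) < MM h x} := by
      have : 2 * (2:ℝ≥0∞) ^ (i0 - 1) = 2 ^ i0 := by
        have := ENNReal.zpow_add (x := 2) (by norm_num) (by norm_num) 1 (i0 - 1)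
        simpa using this.symm
      simp only [mem_setOf_eq, this]; exact h1
    rw [indicator_of_mem hm, ENNReal.rpow_mul]
    refine ENNReal.rpow_le_rpow ?_ (by linarith)
    rw [← ENNReal.rpow_intCast] at h2
    refine h2.trans (le_of_eq ?_)
    congr 1; push_cast; ring
  have hM := measurable_MM hh
  calc ∫⁻ x, MM h x ^ R ≤ ∫⁻ x, ∑' i : ℤ, ({x | 2 * (2:ℝ≥0∞) ^ i < MM h x}.indicator
      (fun _ => (2:ℝ≥0∞) ^ (((i:ℝ) + 2) * R)) x) := lintegral_mono hpt
    _ = ∑' i : ℤ, (2:ℝ≥0∞) ^ (((i:ℝ) + 2) * R) * volume {x | 2 * (2:ℝ≥0∞) ^ i < MM h x} := by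
        rw [lintegral_tsum]
        · congr 1; ext i
          rw [lintegral_indicator_const (measurableSet_lt measurable_const hM)]
        · intro i
          exact (measurable_const.indicator (measurableSet_lt measurable_const hM)).aemeasurable
    _ ≤ ∑' i : ℤ, (2:ℝ≥0∞) ^ (((i:ℝ) + 2) * R) * (ENNReal.ofReal (5 ^ n) * ((2:ℝ≥0∞) ^ i)⁻¹ *
          ∫⁻ y, {y | (2:ℝ≥0∞) ^ i < h y}.indicator h y) := by
        refine ENNReal.tsum_le_tsum fun i => ?_
        gcongr
        exact weak_type' hh (ENNReal.zpow_pos (by norm_num) (by norm_num) i).ne' (by simp [ENNReal.zpow_ne_top])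
    _ = ∑' i : ℤ, ((2:ℝ≥0∞) ^ (2 * R) * ENNReal.ofReal (5 ^ n)) *
          ∫⁻ y, (if (2:ℝ≥0∞) ^ i < h y then (2:ℝ≥0∞) ^ ((i:ℝ) * (R - 1)) else 0) * h y := by
        congr 1; ext i
        have e : ∀ y, (if (2:ℝ≥0∞) ^ i < h y then (2:ℝ≥0∞) ^ ((i:ℝ) * (R - 1)) else 0) * h y
            = (2:ℝ≥0∞) ^ ((i:ℝ) * (R - 1)) * {y | (2:ℝ≥0∞) ^ i < h y}.indicator h y := by
          intro y; simp only [indicator, mem_setOf_eq]; split_ifs <;> simp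
        simp_rw [e]
        rw [lintegral_const_mul _ (hh.indicator (measurableSet_lt measurable_const hh))]
        rw [← ENNReal.rpow_intCast, ← ENNReal.rpow_neg]
        have e2 : (2:ℝ≥0∞) ^ (((i:ℝ) + 2) * R) = 2 ^ (2 * R) * (2 ^ ((i:ℝ) * (R - 1)) * 2 ^ (i:ℝ)) := by
          rw [← ENNReal.rpow_add _ _ (by norm_num) (by norm_num), ← ENNReal.rpow_add _ _ (by norm_num) (by norm_num)]
          congr 1; ring
        have e3 : (2:ℝ≥0∞) ^ (i:ℝ) * 2 ^ (-(i:ℝ)) = 1 := by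
          rw [← ENNReal.rpow_add _ _ (by norm_num) (by norm_num)]; simp
        rw [e2]
        calc _ = 2 ^ (2 * R) * ENNReal.ofReal (5 ^ n) * ((2 ^ ((i:ℝ) * (R - 1)) * ∫⁻ y, {y | (2:ℝ≥0∞) ^ (i:ℝ) < h y}.indicator h y)) * ((2:ℝ≥0∞) ^ (i:ℝ) * 2 ^ (-(i:ℝ))) := by ring
          _ = _ := by rw [e3, mul_one]
    _ = ((2:ℝ≥0∞) ^ (2 * R) * ENNReal.ofReal (5 ^ n)) *
          ∫⁻ y, (∑' i : ℤ, (if (2:ℝ≥0∞) ^ i < h y then (2:ℝ≥0∞) ^ ((i:ℝ) * (R - 1)) else 0)) * h y := by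
        rw [ENNReal.tsum_mul_left, ← lintegral_tsum]
        · simp_rw [ENNReal.tsum_mul_right]
        · intro i
          refine (Measurable.mul (Measurable.ite (measurableSet_lt measurable_const hh) measurable_const measurable_const) hh).aemeasurable
    _ ≤ ((2:ℝ≥0∞) ^ (2 * R) * ENNReal.ofReal (5 ^ n)) * ∫⁻ y, C * h y ^ R := by
        refine mul_le_mul' le_rfl (lintegral_mono fun y => ?_)
        calc _ ≤ C * h y ^ (R - 1) * h y := mul_le_mul' (hgeo _) le_rfl
          _ = C * h y ^ R := by
            rw [mul_assoc]; congr 1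
            nth_rewrite 2 [← ENNReal.rpow_one (h y)]
            rw [← ENNReal.rpow_add_of_nonneg _ _ (by linarith) (by norm_num)]
            congr 1; ring
    _ = _ := by rw [lintegral_const_mul' _ _ hC]; ring

end TL

namespace TL

/-- basic kernel -/
def ker {n : ℕ} (j N : ℕ) (z : Rn n) : ℝ≥0∞ :=
  ENNReal.ofReal (2 ^ (j * n) * ((1 + 2 ^ j * ‖z‖) ^ N)⁻¹)

/-- kernel operator -/
def KC {n : ℕ} (j : ℕ) (h : Rn n → ℝ≥0∞) (x : Rn n) : ℝ≥0∞ := ∫⁻ y, ker j (n+1) (x - y) * h y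

lemma measurable_ker {n : ℕ} (j N : ℕ) : Measurable (ker (n := n) j N) := by
  unfold ker; fun_prop

lemma ker_neg {n : ℕ} (j N : ℕ) (z : Rn n) : ker j N (-z) = ker j N z := by simp [ker]

lemma ker_ne_top {n : ℕ} (j N : ℕ) (z : Rn n) : ker j N z ≠ ∞ := ENNReal.ofReal_ne_top

lemma ker_mono {n : ℕ} (j : ℕ) {N M : ℕ} (h : M ≤ N) (z : Rn n) : ker j N z ≤ ker j M z := by
  unfold ker
  gcongr
  have : 0 ≤ 2 ^ j * ‖z‖ := by positivity
  linarith

lemma measurable_KC {n : ℕ} (j : ℕ) {h : Rn n → ℝ≥0∞} (hh : Measurable h) : Measurable (KC j h) := by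
  refine Measurable.lintegral_prod_right' (f := fun z : Rn n × Rn n => ker j (n+1) (z.1 - z.2) * h z.2) ?_
  exact ((measurable_ker j _).comp (measurable_fst.sub measurable_snd)).mul (hh.comp measurable_snd)

lemma KC_mono {n : ℕ} (j : ℕ) {h g : Rn n → ℝ≥0∞} (hh : ∀ x, h x ≤ g x) (x) : KC j h x ≤ KC j g x := by
  unfold KC
  exact lintegral_mono fun y => mul_le_mul' le_rfl (hh y)

lemma KC_symm {n : ℕ} (j : ℕ) {h g : Rn n → ℝ≥0∞} (hh : Measurable h) (hg : Measurable g) :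
    ∫⁻ x, KC j h x * g x = ∫⁻ x, h x * KC j g x := by
  unfold KC
  have m1 : Measurable (fun z : Rn n × Rn n => ker j (n+1) (z.1 - z.2)) :=
    ((measurable_ker j _).comp (measurable_fst.sub measurable_snd))
  calc _ = ∫⁻ x, ∫⁻ y, ker j (n+1) (x - y) * h y * g x := by
        refine lintegral_congr fun x => ?_
        rw [lintegral_mul_const]
        exact (m1.comp measurable_prodMk_left).mul hh
    _ = ∫⁻ y, ∫⁻ x, ker j (n+1) (x - y) * h y * g x := by
        rw [lintegral_lintegral_swap]
        exact ((m1.mul (hh.comp measurable_snd)).mul (hg.comp measurable_fst)).aemeasurable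
    _ = _ := by
        refine lintegral_congr fun y => ?_
        rw [← lintegral_const_mul]
        · refine lintegral_congr fun x => ?_
          rw [← ker_neg, neg_sub]; ring
        · exact (m1.comp measurable_prodMk_left).mul hg

lemma ker_le_tsum {n : ℕ} (j : ℕ) (z : Rn n) :
    ker j (n+1) z ≤ ∑' m : ℕ, {z : Rn n | ‖z‖ ≤ (2:ℝ) ^ ((m:ℤ) - (j:ℤ))}.indicator
      (fun _ => ENNReal.ofReal (2 ^ (j*n) * (2 ^ (n+1) * ((2 ^ (n+1)) ^ m)⁻¹))) z := by
  obtain ⟨m0, hm0⟩ := pow_unbounded_of_one_lt (2 ^ j * ‖z‖) (one_lt_two : (1:ℝ) < 2)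
  have hex : ∃ m : ℕ, 2 ^ j * ‖z‖ ≤ (2:ℝ) ^ m := ⟨m0, hm0.le⟩
  classical
  have hm := Nat.find_spec hex
  set m := Nat.find hex with hmdef
  refine le_trans ?_ (ENNReal.le_tsum m)
  have hmem : z ∈ {z : Rn n | ‖z‖ ≤ (2:ℝ) ^ ((m:ℤ) - (j:ℤ))} := by
    show ‖z‖ ≤ (2:ℝ) ^ ((m:ℤ) - (j:ℤ))
    rw [zpow_sub₀ (by norm_num), le_div_iff₀ (by positivity), mul_comm]
    exact_mod_cast hm
  rw [indicator_of_mem hmem]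
  unfold ker
  gcongr
  have hz : 0 ≤ 2 ^ j * ‖z‖ := by positivity
  rcases Nat.eq_zero_or_pos m with h0 | hpos
  · rw [h0]; simp only [pow_zero, inv_one, mul_one]
    have h1 : ((1 + 2 ^ j * ‖z‖) ^ (n+1))⁻¹ ≤ 1 := inv_le_one_of_one_le₀ (one_le_pow₀ (by linarith))
    exact h1.trans (one_le_pow₀ (by norm_num))
  · have hlt : (2:ℝ) ^ (m-1) < 2 ^ j * ‖z‖ := by
      have := Nat.find_min hex (m := m - 1) (by omega)
      exact not_le.mp this
    have : ((2:ℝ) ^ (m-1)) ^ (n+1) ≤ (1 + 2 ^ j * ‖z‖) ^ (n+1) := by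
      apply pow_le_pow_left₀ (by positivity); linarith
    calc ((1 + 2 ^ j * ‖z‖) ^ (n+1))⁻¹ ≤ (((2:ℝ) ^ (m-1)) ^ (n+1))⁻¹ := by gcongr
      _ = 2 ^ (n+1) * ((2 ^ (n+1)) ^ m)⁻¹ := by
        obtain ⟨k, hk⟩ : ∃ k, m = k + 1 := ⟨m-1, by omega⟩
        rw [hk, Nat.add_sub_cancel, ← pow_mul, ← pow_mul, mul_add, mul_one, pow_add, mul_comm k]
        field_simp
        ring

lemma KC_le_MM (n : ℕ) : ∃ C : ℝ≥0∞, C ≠ ∞ ∧ ∀ (j : ℕ) (h : Rn n → ℝ≥0∞), Measurable h → ∀ x,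
    KC j h x ≤ C * MM h x := by
  refine ⟨∑' m : ℕ, ENNReal.ofReal (2 ^ (n+1)) * volume (closedBall (0 : Rn n) 1) * (2:ℝ≥0∞)⁻¹ ^ m, ?_, ?_⟩
  · rw [ENNReal.tsum_mul_left]
    refine ENNReal.mul_ne_top (ENNReal.mul_ne_top (by simp) (vol_ball_ne_top _ _)) ?_
    rw [ENNReal.tsum_geometric]; simp
  intro j h hh x
  have mset : ∀ m : ℕ, MeasurableSet {y : Rn n | ‖x - y‖ ≤ (2:ℝ) ^ ((m:ℤ) - (j:ℤ))} := fun m =>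
    measurableSet_le (by fun_prop) measurable_const
  calc KC j h x ≤ ∫⁻ y, ∑' m : ℕ, ENNReal.ofReal (2 ^ (j*n) * (2 ^ (n+1) * ((2 ^ (n+1)) ^ m)⁻¹)) *
        {y : Rn n | ‖x - y‖ ≤ (2:ℝ) ^ ((m:ℤ) - (j:ℤ))}.indicator h y := by
        refine lintegral_mono fun y => ?_
        refine (mul_le_mul' (ker_le_tsum j (x - y)) le_rfl).trans (le_of_eq ?_)
        rw [← ENNReal.tsum_mul_right]
        refine tsum_congr fun m => ?_
        by_cases hy : ‖x - y‖ ≤ (2:ℝ) ^ ((m:ℤ) - (j:ℤ))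
        · simp [indicator, hy]
        · simp [indicator, hy]
    _ = ∑' m : ℕ, ENNReal.ofReal (2 ^ (j*n) * (2 ^ (n+1) * ((2 ^ (n+1)) ^ m)⁻¹)) *
        ∫⁻ y in closedBall x ((2:ℝ) ^ ((m:ℤ) - (j:ℤ))), h y := by
        rw [lintegral_tsum]
        · refine tsum_congr fun m => ?_
          rw [lintegral_const_mul _ (hh.indicator (mset m)), lintegral_indicator (mset m)]
          congr 3
          ext y
          simp [dist_eq_norm, norm_sub_rev]
        · intro m
          exact ((hh.indicator (mset m)).const_mul _).aemeasurable
    _ ≤ ∑' m : ℕ, (ENNReal.ofReal (2 ^ (n+1)) * volume (closedBall (0 : Rn n) 1) * (2:ℝ≥0∞)⁻¹ ^ m) * MM h x := by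
        refine ENNReal.tsum_le_tsum fun m => ?_
        have hB : ∫⁻ y in closedBall x ((2:ℝ) ^ ((m:ℤ) - (j:ℤ))), h y ≤
            volume (closedBall x ((2:ℝ) ^ ((m:ℤ) - (j:ℤ)))) * MM h x := by
          have h0 := vol_ball_ne_zero x (r := (2:ℝ) ^ ((m:ℤ) - (j:ℤ))) (by positivity)
          have h1 := vol_ball_ne_top x ((2:ℝ) ^ ((m:ℤ) - (j:ℤ)))
          calc _ = volume (closedBall x ((2:ℝ) ^ ((m:ℤ) - (j:ℤ)))) * avg h ((m:ℤ) - (j:ℤ)) x := by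
                unfold avg
                rw [← mul_assoc, ENNReal.mul_inv_cancel h0 h1, one_mul]
            _ ≤ _ := mul_le_mul' le_rfl (le_iSup (fun i => avg h i x) _)
        refine (mul_le_mul' le_rfl hB).trans (le_of_eq ?_)
        rw [vol_ball x (by positivity), ← mul_assoc, ← mul_assoc, ← ENNReal.ofReal_mul (by positivity)]
        have e2 : (2:ℝ≥0∞)⁻¹ ^ m = ENNReal.ofReal ((2⁻¹:ℝ) ^ m) := by
          rw [ENNReal.ofReal_pow (by norm_num), ENNReal.ofReal_inv_of_pos (by norm_num)]; simp
        rw [e2, mul_right_comm (ENNReal.ofReal (2 ^ (n+1))), ← ENNReal.ofReal_mul (by positivity)]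
        congr 3
        rw [zpow_sub₀ (by norm_num), zpow_natCast, zpow_natCast, div_pow, ← pow_mul, ← pow_mul, ← pow_mul, inv_pow,
          add_mul, one_mul, pow_add _ (n*m), mul_comm m n]
        field_simp
    _ = _ := by rw [ENNReal.tsum_mul_right]

lemma MM_const_le {n : ℕ} (c : ℝ≥0∞) (x : Rn n) : MM (fun _ : Rn n => c) x ≤ c := by
  refine iSup_le fun i => ?_
  have h0 := vol_ball_ne_zero x (r := (2:ℝ) ^ i) (by positivity)
  have h1 := vol_ball_ne_top x ((2:ℝ) ^ i)
  simp only [avg, lintegral_const, Measure.restrict_apply_univ]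
  rw [mul_left_comm, ENNReal.inv_mul_cancel h0 h1, mul_one]

lemma jensen_pow {α : Type*} [MeasurableSpace α] (μ : Measure α) {h : α → ℝ≥0∞} (hh : AEMeasurable h μ)
    {Q : ℝ} (hQ : 1 ≤ Q) : (∫⁻ a, h a ∂μ) ^ Q ≤ μ univ ^ (Q - 1) * ∫⁻ a, h a ^ Q ∂μ := by
  rcases hQ.eq_or_lt with rfl | hQ
  · simp
  have hc : Q.HolderConjugate (Q.conjExponent) := Real.HolderConjugate.conjExponent hQ
  have := ENNReal.lintegral_mul_le_Lp_mul_Lq μ hc hh (g := fun _ => 1) aemeasurable_const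
  simp only [Pi.mul_apply, mul_one, ENNReal.one_rpow, lintegral_const, one_mul] at this
  calc _ ≤ ((∫⁻ a, h a ^ Q ∂μ) ^ (1 / Q) * μ univ ^ (1 / Q.conjExponent)) ^ Q :=
        ENNReal.rpow_le_rpow this (by linarith)
    _ = _ := by
        rw [ENNReal.mul_rpow_of_nonneg _ _ (by linarith), ← ENNReal.rpow_mul, ← ENNReal.rpow_mul, mul_comm]
        have e1 : 1 / Q * Q = 1 := by field_simp
        have e2 : 1 / Q.conjExponent * Q = Q - 1 := by
          have : Q - 1 ≠ 0 := by linarith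
          unfold Real.conjExponent; field_simp
        rw [e1, e2, ENNReal.rpow_one]

lemma KC_pow (n : ℕ) {Q : ℝ} (hQ : 1 ≤ Q) : ∃ C : ℝ≥0∞, C ≠ ∞ ∧ ∀ (j : ℕ) (h : Rn n → ℝ≥0∞), Measurable h → ∀ x,
    KC j h x ^ Q ≤ C * KC j (fun y => h y ^ Q) x := by
  obtain ⟨C, hC, hK⟩ := KC_le_MM n
  refine ⟨C ^ (Q - 1), ENNReal.rpow_ne_top_of_nonneg (by linarith) hC, fun j h hh x => ?_⟩
  have mk : Measurable (fun y => ker (n := n) j (n+1) (x - y)) :=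
    (measurable_ker j _).comp (by fun_prop)
  have e : ∀ g : Rn n → ℝ≥0∞, Measurable g → ∫⁻ y, g y ∂(volume.withDensity (fun y => ker (n := n) j (n+1) (x - y))) = KC j g x := by
    intro g hg
    rw [lintegral_withDensity_eq_lintegral_mul _ mk hg]; rfl
  have := jensen_pow (volume.withDensity (fun y => ker (n := n) j (n+1) (x - y))) hh.aemeasurable hQ
  rw [e h hh, e _ (hh.pow_const _)] at this
  refine this.trans (mul_le_mul' (ENNReal.rpow_le_rpow ?_ (by linarith)) le_rfl)
  have h1 := hK j (fun _ => 1) measurable_const x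
  rw [← e _ measurable_const] at h1
  simp only [lintegral_const, one_mul] at h1
  exact h1.trans ((mul_le_mul' le_rfl (MM_const_le 1 x)).trans (by simp))

end TL

namespace TL

lemma self_bound {R R' : ℝ} (hc : R.HolderConjugate R') {X D A : ℝ≥0∞} (hX : X ≠ ∞)
    (h : X ≤ D * A ^ (1/R) * X ^ (1/R')) : X ≤ D ^ R * A := by
  have hR := hc.pos
  have hR' := hc.symm.pos
  rcases eq_or_ne X 0 with rfl | hX0
  · simp
  have e : X = X ^ (1/R) * X ^ (1/R') := by
    rw [← ENNReal.rpow_add _ _ hX0 hX]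
    have := hc.inv_add_inv_eq_one
    rw [one_div, one_div, this, ENNReal.rpow_one]
  have h2 : X ^ (1/R) ≤ D * A ^ (1/R) := by
    have hne : X ^ (1/R') ≠ 0 := by simp [ENNReal.rpow_eq_zero_iff, hX0, hX]
    have hnt : X ^ (1/R') ≠ ∞ := ENNReal.rpow_ne_top_of_nonneg (by positivity) hX
    rw [e] at h
    rw [← e] at h
    have h' : X ^ (1/R) * X ^ (1/R') ≤ D * A ^ (1/R) * X ^ (1/R') := by rw [← e]; exact h
    exact (ENNReal.mul_le_mul_iff_left hne hnt).mp h'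
  calc X = (X ^ (1/R)) ^ R := by rw [← ENNReal.rpow_mul, one_div, inv_mul_cancel₀ hR.ne', ENNReal.rpow_one]
    _ ≤ (D * A ^ (1/R)) ^ R := ENNReal.rpow_le_rpow h2 hR.le
    _ = _ := by
      rw [ENNReal.mul_rpow_of_nonneg _ _ hR.le, ← ENNReal.rpow_mul, one_div, inv_mul_cancel₀ hR.ne', ENNReal.rpow_one]

/-- limit of truncated estimates -/
lemma lintegral_trunc_le {α : Type*} [MeasurableSpace α] {μ : Measure α} {a : ℕ → α → ℝ≥0∞}
    (ha : ∀ j, Measurable (a j)) {R : ℝ} (hR : 0 < R) {B : ℝ≥0∞}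
    (h : ∀ J : ℕ, ∫⁻ x, (∑ j ∈ Finset.range J, a j x) ^ R ∂μ ≤ B) :
    ∫⁻ x, (∑' j, a j x) ^ R ∂μ ≤ B := by
  have e : ∀ x, (∑' j, a j x) ^ R = ⨆ J : ℕ, (∑ j ∈ Finset.range J, a j x) ^ R := by
    intro x
    rw [ENNReal.tsum_eq_iSup_nat]
    exact (ENNReal.orderIsoRpow R hR).map_iSup _
  simp_rw [e]
  rw [lintegral_iSup]
  · exact iSup_le h
  · intro J
    exact (Finset.measurable_sum _ fun j _ => ha j).pow_const _
  · intro J K hJK x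
    exact ENNReal.rpow_le_rpow (Finset.sum_le_sum_of_subset (Finset.range_mono hJK)) hR.le

lemma L1_ineq (n : ℕ) {R : ℝ} (hR : 1 ≤ R) : ∃ C : ℝ≥0∞, C ≠ ∞ ∧ ∀ a : ℕ → Rn n → ℝ≥0∞,
    (∀ j, Measurable (a j)) → ∫⁻ x, (∑' j, KC j (a j) x) ^ R ≤ C * ∫⁻ x, (∑' j, a j x) ^ R := by
  obtain ⟨C, hC, hK⟩ := KC_le_MM n
  rcases hR.eq_or_lt with rfl | hR
  · refine ⟨C, hC, fun a ha => ?_⟩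
    simp only [ENNReal.rpow_one]
    rw [lintegral_tsum fun j => (measurable_KC j (ha j)).aemeasurable, lintegral_tsum fun j => (ha j).aemeasurable,
      ← ENNReal.tsum_mul_left]
    refine ENNReal.tsum_le_tsum fun j => ?_
    have := KC_symm j (ha j) (g := fun _ => 1) measurable_const
    simp only [mul_one] at this
    rw [this, ← lintegral_const_mul _ (ha j)]
    refine lintegral_mono fun x => ?_
    rw [mul_comm C]
    refine mul_le_mul' le_rfl ((hK j _ measurable_const x).trans ?_)
    exact (mul_le_mul' le_rfl (MM_const_le 1 x)).trans (by simp)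
  have hc : R.HolderConjugate (R.conjExponent) := Real.HolderConjugate.conjExponent hR
  set R' := R.conjExponent with hR'def
  obtain ⟨C1, hC1, hM1⟩ := maximal_strong n hR
  obtain ⟨C2, hC2, hM2⟩ := maximal_strong n hc.symm.lt
  have hR0 : 0 < R := by linarith
  have hR'0 : 0 < R' := hc.symm.pos
  refine ⟨(C * C2 ^ (1/R')) ^ R + 1, ENNReal.add_ne_top.mpr ⟨ENNReal.rpow_ne_top_of_nonneg hR0.le
    (ENNReal.mul_ne_top hC (ENNReal.rpow_ne_top_of_nonneg (by positivity) hC2)), by simp⟩, fun a ha => ?_⟩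
  have hA : Measurable (fun x => ∑' j, a j x) := Measurable.tsum ha
  rcases eq_or_ne (∫⁻ x, (∑' j, a j x) ^ R) ∞ with hinf | hfin
  · rw [hinf]
    rw [ENNReal.mul_top (by simp)]; exact le_top
  refine lintegral_trunc_le (fun j => measurable_KC j (ha j)) hR0 fun J => ?_
  set H : Rn n → ℝ≥0∞ := fun x => ∑ j ∈ Finset.range J, KC j (a j) x with hH
  have mH : Measurable H := Finset.measurable_sum _ fun j _ => measurable_KC j (ha j)
  have mHp : Measurable (fun x => H x ^ (R-1)) := mH.pow_const _
  have hHfin : ∫⁻ x, H x ^ R ≠ ∞ := by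
    have hb : ∀ x, H x ≤ (J * C) * MM (fun x => ∑' j, a j x) x := by
      intro x
      calc H x ≤ ∑ j ∈ Finset.range J, C * MM (fun x => ∑' j, a j x) x := by
            refine Finset.sum_le_sum fun j _ => ?_
            exact (KC_mono j (fun x => ENNReal.le_tsum j) x).trans (hK j _ hA x)
        _ = _ := by simp [mul_assoc]
    have : ∫⁻ x, H x ^ R ≤ (J * C) ^ R * (C1 * ∫⁻ x, (∑' j, a j x) ^ R) := by
      calc _ ≤ ∫⁻ x, (J * C) ^ R * MM (fun x => ∑' j, a j x) x ^ R := by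
            refine lintegral_mono fun x => ?_
            rw [← ENNReal.mul_rpow_of_nonneg _ _ hR0.le]
            exact ENNReal.rpow_le_rpow (hb x) hR0.le
        _ = (J * C) ^ R * ∫⁻ x, MM (fun x => ∑' j, a j x) x ^ R := by
            rw [lintegral_const_mul _ ((measurable_MM hA).pow_const _)]
        _ ≤ _ := mul_le_mul' le_rfl (hM1 _ hA)
    refine ne_top_of_le_ne_top ?_ this
    exact ENNReal.mul_ne_top (ENNReal.rpow_ne_top_of_nonneg hR0.le (ENNReal.mul_ne_top (by simp) hC))
      (ENNReal.mul_ne_top hC1 hfin)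
  refine (self_bound hc hHfin ?_).trans (mul_le_mul' le_self_add le_rfl)
  have hpow : ∀ x, H x ^ R = H x * H x ^ (R - 1) := by
    intro x
    nth_rewrite 2 [← ENNReal.rpow_one (H x)]
    rw [← ENNReal.rpow_add_of_nonneg _ _ (by norm_num) (by linarith)]
    congr 1; ring
  calc ∫⁻ x, H x ^ R = ∫⁻ x, ∑ j ∈ Finset.range J, KC j (a j) x * H x ^ (R-1) := by
        refine lintegral_congr fun x => ?_
        rw [hpow, ← Finset.sum_mul]
    _ = ∑ j ∈ Finset.range J, ∫⁻ x, a j x * KC j (fun x => H x ^ (R-1)) x := by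
        rw [lintegral_finsetSum]
        · refine Finset.sum_congr rfl fun j _ => ?_
          exact KC_symm j (ha j) mHp
        · exact fun j _ => (measurable_KC j (ha j)).mul mHp
    _ = ∫⁻ x, ∑ j ∈ Finset.range J, a j x * KC j (fun x => H x ^ (R-1)) x := by
        rw [lintegral_finsetSum]
        exact fun j _ => (ha j).mul (measurable_KC j mHp)
    _ ≤ ∫⁻ x, (∑' j, a j x) * (C * MM (fun x => H x ^ (R-1)) x) := by
        refine lintegral_mono fun x => ?_
        calc _ ≤ ∑ j ∈ Finset.range J, a j x * (C * MM (fun x => H x ^ (R-1)) x) :=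
              Finset.sum_le_sum fun j _ => mul_le_mul' le_rfl (hK j _ mHp x)
          _ = (∑ j ∈ Finset.range J, a j x) * (C * MM (fun x => H x ^ (R-1)) x) := by rw [Finset.sum_mul]
          _ ≤ _ := mul_le_mul' (ENNReal.sum_le_tsum _) le_rfl
    _ = C * ∫⁻ x, (∑' j, a j x) * MM (fun x => H x ^ (R-1)) x := by
        rw [← lintegral_const_mul' _ _ hC]
        refine lintegral_congr fun x => by ring
    _ ≤ C * ((∫⁻ x, (∑' j, a j x) ^ R) ^ (1/R) * (∫⁻ x, MM (fun x => H x ^ (R-1)) x ^ R') ^ (1/R')) :=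
        mul_le_mul' le_rfl (ENNReal.lintegral_mul_le_Lp_mul_Lq _ hc hA.aemeasurable (measurable_MM mHp).aemeasurable)
    _ ≤ C * ((∫⁻ x, (∑' j, a j x) ^ R) ^ (1/R) * (C2 * ∫⁻ x, H x ^ R) ^ (1/R')) := by
        refine mul_le_mul' le_rfl (mul_le_mul' le_rfl (ENNReal.rpow_le_rpow ?_ (by positivity)))
        refine (hM2 _ mHp).trans (le_of_eq ?_)
        congr 1
        refine lintegral_congr fun x => ?_
        rw [← ENNReal.rpow_mul, hc.sub_one_mul_conj]
    _ = _ := by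
        rw [ENNReal.mul_rpow_of_nonneg _ _ (by positivity)]; ring


lemma fs_le (n : ℕ) {P Q : ℝ} (hQ : 1 ≤ Q) (hQP : Q ≤ P) : ∃ C : ℝ≥0∞, C ≠ ∞ ∧ ∀ g : ℕ → Rn n → ℝ≥0∞,
    (∀ j, Measurable (g j)) →
    ∫⁻ x, (∑' j, KC j (g j) x ^ Q) ^ (P/Q) ≤ C * ∫⁻ x, (∑' j, g j x ^ Q) ^ (P/Q) := by
  have hQ0 : 0 < Q := by linarith
  have hPQ : 1 ≤ P / Q := by rwa [le_div_iff₀ hQ0, one_mul]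
  obtain ⟨C1, hC1, h1⟩ := KC_pow n hQ
  obtain ⟨C2, hC2, h2⟩ := L1_ineq n hPQ
  refine ⟨C1 ^ (P/Q) * C2, ENNReal.mul_ne_top (ENNReal.rpow_ne_top_of_nonneg (by linarith) hC1) hC2, fun g hg => ?_⟩
  have hm : ∀ j, Measurable (fun y => g j y ^ Q) := fun j => (hg j).pow_const _
  calc _ ≤ ∫⁻ x, C1 ^ (P/Q) * (∑' j, KC j (fun y => g j y ^ Q) x) ^ (P/Q) := by
        refine lintegral_mono fun x => ?_
        rw [← ENNReal.mul_rpow_of_nonneg _ _ (by linarith), ← ENNReal.tsum_mul_left]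
        exact ENNReal.rpow_le_rpow (ENNReal.tsum_le_tsum fun j => h1 j _ (hg j) x) (by linarith)
    _ = C1 ^ (P/Q) * ∫⁻ x, (∑' j, KC j (fun y => g j y ^ Q) x) ^ (P/Q) := by
        rw [lintegral_const_mul' _ _ (ENNReal.rpow_ne_top_of_nonneg (by linarith) hC1)]
    _ ≤ _ := by
        rw [mul_assoc]
        exact mul_le_mul' le_rfl (h2 _ hm)

lemma fs_gt (n : ℕ) {P Q : ℝ} (hP : 1 < P) (hPQ : P < Q) : ∃ C : ℝ≥0∞, C ≠ ∞ ∧ ∀ g : ℕ → Rn n → ℝ≥0∞,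
    (∀ j, Measurable (g j)) →
    ∫⁻ x, (∑' j, KC j (g j) x ^ Q) ^ (P/Q) ≤ C * ∫⁻ x, (∑' j, g j x ^ Q) ^ (P/Q) := by
  have hP0 : 0 < P := by linarith
  have hQ1 : 1 < Q := by linarith
  have hQ0 : 0 < Q := by linarith
  have hcP : P.HolderConjugate (P.conjExponent) := Real.HolderConjugate.conjExponent hP
  have hcQ : Q.HolderConjugate (Q.conjExponent) := Real.HolderConjugate.conjExponent hQ1
  set P' := P.conjExponent with hP'def
  set Q' := Q.conjExponent with hQ'def
  have hP'0 : 0 < P' := hcP.symm.pos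
  have hQ'0 : 0 < Q' := hcQ.symm.pos
  have hQP' : Q' ≤ P' := by
    have h1 := hcP.inv_add_inv_eq_one
    have h2 := hcQ.inv_add_inv_eq_one
    have h3 : Q⁻¹ < P⁻¹ := by gcongr
    have h4 : P'⁻¹ ≤ Q'⁻¹ := by linarith
    exact (inv_le_inv₀ hP'0 hQ'0).mp h4
  obtain ⟨C, hC, hK⟩ := KC_le_MM n
  obtain ⟨C1, hC1, hM1⟩ := maximal_strong n hP
  obtain ⟨C2, hC2, hM2⟩ := fs_le n hcQ.symm.lt.le hQP'
  have hd0 : 0 < P / Q := by positivity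
  refine ⟨(C2 ^ (1/P')) ^ P + 1, ENNReal.add_ne_top.mpr ⟨ENNReal.rpow_ne_top_of_nonneg hP0.le
    (ENNReal.rpow_ne_top_of_nonneg (by positivity) hC2), by simp⟩, fun g hg => ?_⟩
  set G : Rn n → ℝ≥0∞ := fun x => (∑' j, g j x ^ Q) ^ (1/Q) with hG
  have mG : Measurable G := (Measurable.tsum fun j => (hg j).pow_const _).pow_const _
  have hGP : ∀ x, G x ^ P = (∑' j, g j x ^ Q) ^ (P/Q) := by
    intro x; rw [hG]; dsimp only; rw [← ENNReal.rpow_mul]; congr 1; ring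
  simp_rw [← hGP]
  rcases eq_or_ne (∫⁻ x, G x ^ P) ∞ with hinf | hfin
  · rw [hinf, ENNReal.mul_top (by simp)]; exact le_top
  refine lintegral_trunc_le (a := fun j x => KC j (g j) x ^ Q) (fun j => (measurable_KC j (hg j)).pow_const _) hd0 fun J => ?_
  set F : ℕ → Rn n → ℝ≥0∞ := fun j => KC j (g j) with hF
  have mF : ∀ j, Measurable (F j) := fun j => measurable_KC j (hg j)
  set Φ : Rn n → ℝ≥0∞ := fun x => ∑ j ∈ Finset.range J, F j x ^ Q with hΦ
  have mΦ : Measurable Φ := Finset.measurable_sum _ fun j _ => (mF j).pow_const _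
  have hgG : ∀ j x, g j x ≤ G x := by
    intro j x
    calc g j x = (g j x ^ Q) ^ (1/Q) := by rw [← ENNReal.rpow_mul, mul_one_div_cancel hQ0.ne', ENNReal.rpow_one]
      _ ≤ _ := ENNReal.rpow_le_rpow (ENNReal.le_tsum j) (by positivity)
  have hΦfin : ∫⁻ x, Φ x ^ (P/Q) ≠ ∞ := by
    have hb : ∀ x, Φ x ^ (P/Q) ≤ (J * C ^ Q) ^ (P/Q) * MM G x ^ P := by
      intro x
      have : Φ x ≤ (J * C ^ Q) * MM G x ^ Q := by
        calc Φ x ≤ ∑ j ∈ Finset.range J, C ^ Q * MM G x ^ Q := by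
              refine Finset.sum_le_sum fun j _ => ?_
              rw [← ENNReal.mul_rpow_of_nonneg _ _ hQ0.le]
              exact ENNReal.rpow_le_rpow ((KC_mono j (hgG j) x).trans (hK j _ mG x)) hQ0.le
          _ = _ := by simp [mul_assoc]
      refine (ENNReal.rpow_le_rpow this hd0.le).trans (le_of_eq ?_)
      rw [ENNReal.mul_rpow_of_nonneg _ _ hd0.le, ← ENNReal.rpow_mul (MM G x), mul_div_cancel₀ _ hQ0.ne']
    have hJ : ((J:ℝ≥0∞) * C ^ Q) ^ (P/Q) ≠ ∞ := ENNReal.rpow_ne_top_of_nonneg hd0.le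
      (ENNReal.mul_ne_top (by simp) (ENNReal.rpow_ne_top_of_nonneg hQ0.le hC))
    refine ne_top_of_le_ne_top ?_ (lintegral_mono hb)
    rw [lintegral_const_mul' _ _ hJ]
    exact ENNReal.mul_ne_top hJ (ne_top_of_le_ne_top (ENNReal.mul_ne_top hC1 hfin) (hM1 _ mG))
  have hae : ∀ᵐ x, Φ x ≠ ∞ := by
    have := ae_lt_top (mΦ.pow_const _) hΦfin
    filter_upwards [this] with x hx hx2
    rw [hx2, ENNReal.top_rpow_of_pos hd0] at hx
    exact lt_irrefl _ hx
  set h : ℕ → Rn n → ℝ≥0∞ := fun j x => if j < J then F j x ^ (Q - 1) * Φ x ^ (P/Q - 1) else 0 with hh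
  have mh : ∀ j, Measurable (h j) := by
    intro j; rw [hh]; dsimp only; split_ifs
    · exact ((mF j).pow_const _).mul (mΦ.pow_const _)
    · exact measurable_const
  have key1 : ∀ᵐ x, Φ x ^ (P/Q) = ∑ j ∈ Finset.range J, F j x * h j x := by
    filter_upwards [hae] with x hx
    have e1 : ∑ j ∈ Finset.range J, F j x * h j x = Φ x * Φ x ^ (P/Q - 1) := by
      rw [hΦ]; dsimp only; rw [Finset.sum_mul]
      refine Finset.sum_congr rfl fun j hj => ?_
      rw [hh]; dsimp only; rw [if_pos (Finset.mem_range.mp hj), ← mul_assoc]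
      congr 1
      nth_rewrite 1 [← ENNReal.rpow_one (F j x)]
      rw [← ENNReal.rpow_add_of_nonneg _ _ (by norm_num) (by linarith)]
      congr 1; ring
    rw [e1]
    rcases eq_or_ne (Φ x) 0 with h0 | h0
    · rw [h0, zero_mul, ENNReal.zero_rpow_of_pos hd0]
    · nth_rewrite 2 [← ENNReal.rpow_one (Φ x)]
      rw [← ENNReal.rpow_add _ _ h0 hx]; congr 1; ring
  have key2 : ∀ᵐ x, (∑' j, h j x ^ Q') ^ (P'/Q') ≤ Φ x ^ (P/Q) := by
    filter_upwards [hae] with x hx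
    have e1 : ∑' j, h j x ^ Q' = Φ x * Φ x ^ ((P/Q - 1) * Q') := by
      rw [tsum_eq_sum (s := Finset.range J)]
      · rw [hΦ]; dsimp only; rw [Finset.sum_mul]
        refine Finset.sum_congr rfl fun j hj => ?_
        rw [hh]; dsimp only; rw [if_pos (Finset.mem_range.mp hj), ENNReal.mul_rpow_of_nonneg _ _ hQ'0.le,
          ← ENNReal.rpow_mul, ← ENNReal.rpow_mul, hcQ.sub_one_mul_conj]
      · intro j hj
        rw [hh]; dsimp only; rw [if_neg (by simpa using hj), ENNReal.zero_rpow_of_pos hQ'0]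
    rw [e1]
    rcases eq_or_ne (Φ x) 0 with h0 | h0
    · rw [h0, zero_mul, ENNReal.zero_rpow_of_pos (by positivity)]; exact bot_le
    · nth_rewrite 1 [← ENNReal.rpow_one (Φ x)]
      rw [← ENNReal.rpow_add _ _ h0 hx, ← ENNReal.rpow_mul]
      refine le_of_eq ?_
      congr 1
      have a1 : P' = P / (P - 1) := rfl
      have a2 : Q' = Q / (Q - 1) := rfl
      have b1 : P - 1 ≠ 0 := by linarith
      have b2 : Q - 1 ≠ 0 := by linarith
      rw [a1, a2]; field_simp; ring
  refine (self_bound hcP hΦfin ?_).trans (mul_le_mul' le_self_add le_rfl)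
  calc ∫⁻ x, Φ x ^ (P/Q) = ∫⁻ x, ∑ j ∈ Finset.range J, F j x * h j x := lintegral_congr_ae key1
    _ = ∑ j ∈ Finset.range J, ∫⁻ x, g j x * KC j (h j) x := by
        rw [lintegral_finsetSum]
        · refine Finset.sum_congr rfl fun j _ => ?_
          exact KC_symm j (hg j) (mh j)
        · exact fun j _ => (mF j).mul (mh j)
    _ = ∫⁻ x, ∑ j ∈ Finset.range J, g j x * KC j (h j) x := by
        rw [lintegral_finsetSum]
        exact fun j _ => (hg j).mul (measurable_KC j (mh j))
    _ ≤ ∫⁻ x, G x * (∑' j, KC j (h j) x ^ Q') ^ (1/Q') := by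
        refine lintegral_mono fun x => ?_
        refine (ENNReal.inner_le_Lp_mul_Lq _ _ _ hcQ).trans ?_
        exact mul_le_mul' (ENNReal.rpow_le_rpow (ENNReal.sum_le_tsum _) (by positivity))
          (ENNReal.rpow_le_rpow (ENNReal.sum_le_tsum _) (by positivity))
    _ ≤ (∫⁻ x, G x ^ P) ^ (1/P) * (∫⁻ x, ((∑' j, KC j (h j) x ^ Q') ^ (1/Q')) ^ P') ^ (1/P') :=
        ENNReal.lintegral_mul_le_Lp_mul_Lq _ hcP mG.aemeasurable
          ((Measurable.tsum fun j => (measurable_KC j (mh j)).pow_const _).pow_const _).aemeasurable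
    _ ≤ (∫⁻ x, G x ^ P) ^ (1/P) * (C2 * ∫⁻ x, Φ x ^ (P/Q)) ^ (1/P') := by
        refine mul_le_mul' le_rfl (ENNReal.rpow_le_rpow ?_ (by positivity))
        calc _ = ∫⁻ x, (∑' j, KC j (h j) x ^ Q') ^ (P'/Q') := by
              refine lintegral_congr fun x => ?_
              rw [← ENNReal.rpow_mul]; congr 1; ring
          _ ≤ C2 * ∫⁻ x, (∑' j, h j x ^ Q') ^ (P'/Q') := hM2 _ mh
          _ ≤ _ := mul_le_mul' le_rfl (lintegral_mono_ae key2)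
    _ = _ := by
        rw [ENNReal.mul_rpow_of_nonneg _ _ (by positivity)]; ring

lemma fs_ineq (n : ℕ) {P : ℝ} (hP : 1 < P) {Q : ℝ≥0∞} (hQ : 1 ≤ Q) : ∃ C : ℝ≥0∞, C ≠ ∞ ∧ ∀ g : ℕ → Rn n → ℝ≥0∞,
    (∀ j, Measurable (g j)) →
    ∫⁻ x, (lqSum Q fun j => KC j (g j) x) ^ P ≤ C * ∫⁻ x, (lqSum Q fun j => g j x) ^ P := by
  have hP0 : 0 < P := by linarith
  rcases eq_or_ne Q ∞ with rfl | hQt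
  · obtain ⟨C, hC, hK⟩ := KC_le_MM n
    obtain ⟨C1, hC1, hM1⟩ := maximal_strong n hP
    refine ⟨C ^ P * C1, ENNReal.mul_ne_top (ENNReal.rpow_ne_top_of_nonneg hP0.le hC) hC1, fun g hg => ?_⟩
    simp only [lqSum, if_true]
    have mG : Measurable (fun x => ⨆ j, g j x) := Measurable.iSup hg
    calc _ ≤ ∫⁻ x, C ^ P * MM (fun x => ⨆ j, g j x) x ^ P := by
          refine lintegral_mono fun x => ?_
          rw [← ENNReal.mul_rpow_of_nonneg _ _ hP0.le]
          refine ENNReal.rpow_le_rpow (iSup_le fun j => ?_) hP0.le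
          exact (KC_mono j (fun x => le_iSup (fun j => g j x) j) x).trans (hK j _ mG x)
      _ ≤ _ := by
          rw [lintegral_const_mul' _ _ (ENNReal.rpow_ne_top_of_nonneg hP0.le hC), mul_assoc]
          exact mul_le_mul' le_rfl (hM1 _ mG)
  · have hQ1 : 1 ≤ Q.toReal := by
      have := ENNReal.toReal_mono hQt hQ; simpa using this
    have e : ∀ a : ℕ → ℝ≥0∞, (lqSum Q a) ^ P = (∑' j, a j ^ Q.toReal) ^ (P / Q.toReal) := by
      intro a
      rw [lqSum, if_neg hQt, ← ENNReal.rpow_mul]; congr 1; ring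
    simp_rw [e]
    rcases le_or_gt Q.toReal P with h | h
    · exact fs_le n hQ1 h
    · exact fs_gt n hP h

end TL

namespace TL

/-- two-parameter weight -/
def bb {n : ℕ} (j m : ℕ) (x z : Rn n) : ℝ≥0∞ := ENNReal.ofReal (2 ^ m * (1 + 2 ^ j * ‖x - z‖))

lemma one_le_bb {n : ℕ} (j m : ℕ) (x z : Rn n) : 1 ≤ bb j m x z := by
  unfold bb
  rw [ENNReal.one_le_ofReal]
  have h1 : (1:ℝ) ≤ 2 ^ m := one_le_pow₀ (by norm_num)
  have h2 : 0 ≤ 2 ^ j * ‖x - z‖ := by positivity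
  nlinarith

lemma bb_ne_zero {n : ℕ} (j m : ℕ) (x z : Rn n) : bb j m x z ≠ 0 :=
  (lt_of_lt_of_le one_pos (one_le_bb j m x z)).ne'

lemma bb_ne_top {n : ℕ} (j m : ℕ) (x z : Rn n) : bb j m x z ≠ ∞ := ENNReal.ofReal_ne_top

lemma bb_self {n : ℕ} (j : ℕ) (x : Rn n) : bb j 0 x x = 1 := by simp [bb]

lemma bb_tri {n : ℕ} (j i l : ℕ) (x y z : Rn n) :
    bb j (i + l) x z ≤ bb j i x y * bb (j + i) l y z := by
  unfold bb
  rw [← ENNReal.ofReal_mul (by positivity)]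
  apply ENNReal.ofReal_le_ofReal
  have h : ‖x - z‖ ≤ ‖x - y‖ + ‖y - z‖ := norm_sub_le_norm_sub_add_norm_sub x y z
  have h2 : (1:ℝ) ≤ 2 ^ i := one_le_pow₀ (by norm_num)
  have h3 : (0:ℝ) < 2 ^ j := by positivity
  have key : 1 + 2 ^ j * ‖x - z‖ ≤ (1 + 2 ^ j * ‖x - y‖) * (1 + 2 ^ (j+i) * ‖y - z‖) := by
    have : (2:ℝ) ^ j * ‖y - z‖ ≤ 2 ^ (j+i) * ‖y - z‖ := by
      gcongr; norm_num; omega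
    have h4 : 0 ≤ (2 ^ j * ‖x - y‖) * (2 ^ (j+i) * ‖y - z‖) := by positivity
    nlinarith
  calc (2:ℝ) ^ (i+l) * (1 + 2 ^ j * ‖x - z‖) ≤ 2 ^ (i+l) * ((1 + 2 ^ j * ‖x - y‖) * (1 + 2 ^ (j+i) * ‖y - z‖)) := by
        gcongr
    _ = _ := by rw [pow_add]; ring

lemma measurable_bb {n : ℕ} (j m : ℕ) (x : Rn n) : Measurable (bb j m x) := by
  unfold bb; fun_prop

/-- the Peetre-type sum -/
def GG {n : ℕ} (u : ℕ → Rn n → ℝ≥0∞) (N : ℝ) (j : ℕ) (x : Rn n) : ℝ≥0∞ :=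
  ∑' l : ℕ, ∫⁻ z, 2 ^ ((j + l) * n) * bb j l x z ^ (-N) * u (j + l) z

lemma rpow_neg_tri {n : ℕ} {N : ℝ} (hN : 0 ≤ N) (j i l : ℕ) (x y z : Rn n) :
    bb (j + i) l y z ^ (-N) ≤ bb j i x y ^ N * bb j (i + l) x z ^ (-N) := by
  have h1 := bb_tri j i l x y z
  have h2 : bb j (i+l) x z ^ N ≤ bb j i x y ^ N * bb (j + i) l y z ^ N := by
    rw [← ENNReal.mul_rpow_of_nonneg _ _ hN]; exact ENNReal.rpow_le_rpow h1 hN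
  rw [ENNReal.rpow_neg, ENNReal.rpow_neg]
  have hz : bb j (i+l) x z ^ N ≠ 0 := by simp [ENNReal.rpow_eq_zero_iff, bb_ne_zero, bb_ne_top]
  have ht : bb j (i+l) x z ^ N ≠ ∞ := ENNReal.rpow_ne_top_of_nonneg hN (bb_ne_top _ _ _ _)
  have hz' : bb (j+i) l y z ^ N ≠ 0 := by simp [ENNReal.rpow_eq_zero_iff, bb_ne_zero, bb_ne_top]
  have ht' : bb (j+i) l y z ^ N ≠ ∞ := ENNReal.rpow_ne_top_of_nonneg hN (bb_ne_top _ _ _ _)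
  rw [← div_eq_mul_inv, ENNReal.le_div_iff_mul_le (Or.inl hz) (Or.inl ht), mul_comm, ← div_eq_mul_inv]
  exact ENNReal.div_le_of_le_mul h2

lemma GG_tri {n : ℕ} (u : ℕ → Rn n → ℝ≥0∞) {N : ℝ} (hN : 0 ≤ N) (j i : ℕ) (x y : Rn n) :
    GG u N (j + i) y ≤ bb j i x y ^ N * GG u N j x := by
  unfold GG
  have hb : bb j i x y ^ N ≠ ∞ := ENNReal.rpow_ne_top_of_nonneg hN (bb_ne_top _ _ _ _)
  calc _ ≤ ∑' l : ℕ, bb j i x y ^ N * ∫⁻ z, 2 ^ ((j + (i + l)) * n) * bb j (i + l) x z ^ (-N) * u (j + (i + l)) z := by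
        refine ENNReal.tsum_le_tsum fun l => ?_
        rw [← lintegral_const_mul' _ _ hb]
        refine lintegral_mono fun z => ?_
        rw [add_assoc]
        calc _ ≤ 2 ^ ((j + (i + l)) * n) * (bb j i x y ^ N * bb j (i + l) x z ^ (-N)) * u (j + (i + l)) z :=
              mul_le_mul' (mul_le_mul' le_rfl (rpow_neg_tri hN j i l x y z)) le_rfl
          _ = _ := by ring
    _ ≤ _ := by
        rw [ENNReal.tsum_mul_left]
        refine mul_le_mul' le_rfl ?_
        exact ENNReal.tsum_comp_le_tsum_of_injective (add_right_injective i)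
          (fun l => ∫⁻ z, 2 ^ ((j + l) * n) * bb j l x z ^ (-N) * u (j + l) z)

lemma GG_anti {n : ℕ} (u : ℕ → Rn n → ℝ≥0∞) {N M : ℝ} (h : N ≤ M) (j : ℕ) (x : Rn n) :
    GG u M j x ≤ GG u N j x := by
  unfold GG
  refine ENNReal.tsum_le_tsum fun l => lintegral_mono fun z => ?_
  refine mul_le_mul' (mul_le_mul' le_rfl ?_) le_rfl
  exact ENNReal.rpow_le_rpow_of_exponent_le (one_le_bb _ _ _ _) (by linarith)

/-- the maximal quantity -/
def AA {n : ℕ} (u : ℕ → Rn n → ℝ≥0∞) (N : ℝ) (j : ℕ) (x : Rn n) : ℝ≥0∞ :=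
  ⨆ (i : ℕ) (y : Rn n), u (j + i) y * bb j i x y ^ (-N)

lemma le_AA {n : ℕ} (u : ℕ → Rn n → ℝ≥0∞) (N : ℝ) (j i : ℕ) (x y : Rn n) :
    u (j + i) y ≤ AA u N j x * bb j i x y ^ N := by
  have h : u (j + i) y * bb j i x y ^ (-N) ≤ AA u N j x :=
    le_iSup₂ (f := fun i y => u (j + i) y * bb j i x y ^ (-N)) i y
  calc u (j + i) y = u (j+i) y * bb j i x y ^ (-N) * bb j i x y ^ N := by
        rw [mul_assoc, ← ENNReal.rpow_add _ _ (bb_ne_zero _ _ _ _) (bb_ne_top _ _ _ _)]; simp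
    _ ≤ _ := mul_le_mul' h le_rfl

lemma GG_le_AA {n : ℕ} (u : ℕ → Rn n → ℝ≥0∞) {N r : ℝ} (hr : 0 < r) (hr1 : r ≤ 1) (j : ℕ) (x : Rn n)
    (hA : AA u N j x ≠ ∞) :
    GG u N j x ≤ AA u N j x ^ (1 - r) * GG (fun j x => u j x ^ r) (N * r) j x := by
  unfold GG
  have hAt : AA u N j x ^ (1 - r) ≠ ∞ := ENNReal.rpow_ne_top_of_nonneg (by linarith) hA
  rw [← ENNReal.tsum_mul_left]
  refine ENNReal.tsum_le_tsum fun l => ?_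
  rw [← lintegral_const_mul' _ _ hAt]
  refine lintegral_mono fun z => ?_
  have h1 : u (j + l) z ≤ u (j + l) z ^ r * (AA u N j x * bb j l x z ^ N) ^ (1 - r) := by
    calc u (j + l) z = u (j+l) z ^ r * u (j + l) z ^ (1 - r) := by
          rw [← ENNReal.rpow_add_of_nonneg _ _ hr.le (by linarith)]; simp
      _ ≤ _ := mul_le_mul' le_rfl (ENNReal.rpow_le_rpow (le_AA u N j l x z) (by linarith))
  have h2 : bb j l x z ^ (-N) * (bb j l x z ^ N) ^ (1 - r) = bb j l x z ^ (-(N * r)) := by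
    rw [← ENNReal.rpow_mul, ← ENNReal.rpow_add _ _ (bb_ne_zero _ _ _ _) (bb_ne_top _ _ _ _)]
    congr 1; ring
  calc _ ≤ 2 ^ ((j + l) * n) * bb j l x z ^ (-N) * (u (j + l) z ^ r * (AA u N j x * bb j l x z ^ N) ^ (1 - r)) :=
        mul_le_mul' le_rfl h1
    _ = AA u N j x ^ (1 - r) * (2 ^ ((j + l) * n) * (bb j l x z ^ (-N) * (bb j l x z ^ N) ^ (1 - r)) * u (j + l) z ^ r) := by
        rw [ENNReal.mul_rpow_of_nonneg _ _ (by linarith : (0:ℝ) ≤ 1 - r)]; ring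
    _ = _ := by rw [h2]

lemma AA_pow_le {n : ℕ} (u : ℕ → Rn n → ℝ≥0∞) {N r : ℝ} (hN : 0 ≤ N) (hr : 0 < r) (hr1 : r ≤ 1) {C : ℝ≥0∞}
    (h : ∀ j x, u j x ≤ C * GG u N j x) (j : ℕ) (x : Rn n)
    (hA : AA u N j x ≠ ∞) : AA u N j x ^ r ≤ C * GG (fun j x => u j x ^ r) (N * r) j x := by
  have h1 : AA u N j x ≤ C * GG u N j x := by
    refine iSup₂_le fun i y => ?_
    calc _ ≤ C * (bb j i x y ^ N * GG u N j x) * bb j i x y ^ (-N) :=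
          mul_le_mul' ((h _ _).trans (mul_le_mul' le_rfl (GG_tri u hN j i x y))) le_rfl
      _ = C * GG u N j x * (bb j i x y ^ N * bb j i x y ^ (-N)) := by ring
      _ = _ := by
        rw [← ENNReal.rpow_add _ _ (bb_ne_zero _ _ _ _) (bb_ne_top _ _ _ _)]; simp
  rcases eq_or_ne (AA u N j x) 0 with h0 | h0
  · rw [h0, ENNReal.zero_rpow_of_pos hr]; exact bot_le
  have h2 := h1.trans (mul_le_mul' (le_refl C) (GG_le_AA u hr hr1 j x hA))
  have hz : AA u N j x ^ (1 - r) ≠ 0 := by simp [ENNReal.rpow_eq_zero_iff, h0, hA]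
  have ht : AA u N j x ^ (1 - r) ≠ ∞ := ENNReal.rpow_ne_top_of_nonneg (by linarith) hA
  refine (ENNReal.mul_le_mul_iff_left hz ht).mp ?_
  rw [← ENNReal.rpow_add_of_nonneg _ _ hr.le (by linarith)]
  calc _ = AA u N j x := by simp
    _ ≤ _ := h2
    _ = _ := by ring

lemma ST_lemma {n : ℕ} (u : ℕ → Rn n → ℝ≥0∞) {r : ℝ} (hr : 0 < r) (hr1 : r ≤ 1) {C : ℕ → ℝ≥0∞}
    (hC : ∀ N, C N ≠ ∞)
    (h : ∀ N : ℕ, ∀ j x, u j x ≤ C N * GG u N j x)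
    (hgr : ∃ (D : ℝ≥0∞) (M : ℕ), D ≠ ∞ ∧ ∀ k y, u k y ≤ D * bb 0 k 0 y ^ (M:ℝ)) (N : ℕ) (j : ℕ) (x : Rn n) :
    u j x ^ r ≤ C N * GG (fun j x => u j x ^ r) (N * r) j x := by
  obtain ⟨D, M0, hD, hgr⟩ := hgr
  have hle : ∀ N : ℝ, ∀ j x, u j x ^ r ≤ AA u N j x ^ r := by
    intro N j x
    refine ENNReal.rpow_le_rpow ?_ hr.le
    have := le_AA u N j 0 x x
    rwa [bb_self, ENNReal.one_rpow, mul_one, add_zero] at this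
  -- finiteness for large exponents
  set M := max N M0 with hM
  have hfinM : ∀ j x, AA u (M:ℝ) j x ≠ ∞ := by
    intro j x
    have : AA u (M:ℝ) j x ≤ D * bb 0 j 0 x ^ (M:ℝ) := by
      refine iSup₂_le fun i y => ?_
      have h1 : u (j + i) y ≤ D * (bb 0 j 0 x ^ (M:ℝ) * bb j i x y ^ (M:ℝ)) := by
        refine (hgr _ _).trans (mul_le_mul' le_rfl ?_)
        calc bb 0 (j+i) 0 y ^ (M0:ℝ) ≤ bb 0 (j+i) 0 y ^ (M:ℝ) :=
              ENNReal.rpow_le_rpow_of_exponent_le (one_le_bb _ _ _ _) (by rw [hM]; push_cast; exact le_max_right _ _)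
          _ ≤ _ := by
              rw [← ENNReal.mul_rpow_of_nonneg _ _ (by positivity)]
              refine ENNReal.rpow_le_rpow ?_ (by positivity)
              simpa using bb_tri 0 j i 0 x y
      calc _ ≤ D * (bb 0 j 0 x ^ (M:ℝ) * bb j i x y ^ (M:ℝ)) * bb j i x y ^ (-(M:ℝ)) := mul_le_mul' h1 le_rfl
        _ = D * bb 0 j 0 x ^ (M:ℝ) * (bb j i x y ^ (M:ℝ) * bb j i x y ^ (-(M:ℝ))) := by ring
        _ = _ := by
          rw [← ENNReal.rpow_add _ _ (bb_ne_zero _ _ _ _) (bb_ne_top _ _ _ _)]; simp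
    exact ne_top_of_le_ne_top (ENNReal.mul_ne_top hD (ENNReal.rpow_ne_top_of_nonneg (by positivity) (bb_ne_top _ _ _ _))) this
  have hb : ∀ j x, u j x ^ r ≤ C M * GG (fun j x => u j x ^ r) (N * r) j x := by
    intro j x
    refine (hle M j x).trans ((AA_pow_le u (by positivity) hr hr1 (h M) j x (hfinM j x)).trans ?_)
    refine mul_le_mul' le_rfl (GG_anti _ ?_ _ _)
    gcongr
    exact le_max_left _ _
  rcases eq_or_ne (GG (fun j x => u j x ^ r) (N * r) j x) ∞ with hinf | hfin
  · rcases eq_or_ne (C N) 0 with h0 | h0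
    · have := h N j x
      rw [h0, zero_mul] at this
      rw [le_antisymm this bot_le, ENNReal.zero_rpow_of_pos hr]; exact bot_le
    · rw [hinf, ENNReal.mul_top h0]; exact le_top
  refine (hle N j x).trans (AA_pow_le u (by positivity) hr hr1 (h N) j x ?_)
  have : AA u (N:ℝ) j x ≤ (C M * GG (fun j x => u j x ^ r) (N * r) j x) ^ (1/r) := by
    refine iSup₂_le fun i y => ?_
    have h1 := (hb (j+i) y).trans (mul_le_mul' le_rfl (GG_tri (fun j x => u j x ^ r) (by positivity : (0:ℝ) ≤ N * r) j i x y))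
    have h2 : u (j+i) y * bb j i x y ^ (-(N:ℝ)) = ((u (j+i) y ^ r) * bb j i x y ^ (-(N*r:ℝ))) ^ (1/r) := by
      rw [ENNReal.mul_rpow_of_nonneg _ _ (by positivity), ← ENNReal.rpow_mul, ← ENNReal.rpow_mul]
      congr 1
      · rw [mul_one_div_cancel hr.ne', ENNReal.rpow_one]
      · congr 1; field_simp
    rw [h2]
    refine ENNReal.rpow_le_rpow ?_ (by positivity)
    calc _ ≤ _ := mul_le_mul' h1 le_rfl
      _ = C M * GG (fun j x => u j x ^ r) (N * r) j x * (bb j i x y ^ (N * r:ℝ) * bb j i x y ^ (-(N * r:ℝ))) := by ring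
      _ = _ := by
          rw [← ENNReal.rpow_add _ _ (bb_ne_zero _ _ _ _) (bb_ne_top _ _ _ _)]; simp
  exact ne_top_of_le_ne_top (ENNReal.rpow_ne_top_of_nonneg (by positivity) (ENNReal.mul_ne_top (hC M) hfin)) this

end TL

namespace TL

lemma sum_rpow_le {ι : Type*} (s : Finset ι) (a : ι → ℝ≥0∞) {r : ℝ} (hr : 0 < r) (hr1 : r ≤ 1) :
    (∑ i ∈ s, a i) ^ r ≤ ∑ i ∈ s, a i ^ r := by
  classical
  induction s using Finset.induction_on with
  | empty => simp [hr]
  | insert i s hi ih =>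
    rw [Finset.sum_insert hi, Finset.sum_insert hi]
    exact (ENNReal.rpow_add_le_add_rpow _ _ hr.le hr1).trans (add_le_add le_rfl ih)

lemma tsum_rpow_le (a : ℕ → ℝ≥0∞) {r : ℝ} (hr : 0 < r) (hr1 : r ≤ 1) :
    (∑' i, a i) ^ r ≤ ∑' i, a i ^ r := by
  rw [ENNReal.tsum_eq_iSup_nat]
  have : (⨆ J : ℕ, ∑ i ∈ Finset.range J, a i) ^ r = ⨆ J : ℕ, (∑ i ∈ Finset.range J, a i) ^ r :=
    (ENNReal.orderIsoRpow r hr).map_iSup _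
  rw [this]
  exact iSup_le fun J => (sum_rpow_le _ _ hr hr1).trans (ENNReal.sum_le_tsum _)

/-- Schur test in `ℓ_Q` -/
lemma schur {Q : ℝ≥0∞} (hQ : 1 ≤ Q) {c : ℕ → ℕ → ℝ≥0∞} {A : ℝ≥0∞} (h1 : ∀ k, ∑' j, c k j ≤ A)
    (h2 : ∀ j, ∑' k, c k j ≤ A) (W : ℕ → ℝ≥0∞) :
    lqSum Q (fun k => ∑' j, c k j * W j) ≤ A * lqSum Q W := by
  rcases eq_or_ne Q ∞ with rfl | hQt
  · simp only [lqSum, if_true]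
    refine iSup_le fun k => ?_
    calc _ ≤ ∑' j, c k j * ⨆ j, W j := ENNReal.tsum_le_tsum fun j => mul_le_mul' le_rfl (le_iSup W j)
      _ = (∑' j, c k j) * ⨆ j, W j := by rw [ENNReal.tsum_mul_right]
      _ ≤ _ := mul_le_mul' (h1 k) le_rfl
  have hQ1 : 1 ≤ Q.toReal := by
    have := ENNReal.toReal_mono hQt hQ; simpa using this
  simp only [lqSum, if_neg hQt]
  set R := Q.toReal with hR
  have hR0 : 0 < R := by linarith
  have hj : ∀ k, (∑' j, c k j * W j) ^ R ≤ A ^ (R - 1) * ∑' j, c k j * W j ^ R := by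
    intro k
    have e : ∀ g : ℕ → ℝ≥0∞, ∫⁻ j, g j ∂(Measure.count.withDensity (c k)) = ∑' j, c k j * g j := by
      intro g
      rw [lintegral_withDensity_eq_lintegral_mul _ (measurable_of_countable _) (measurable_of_countable _), lintegral_count]; rfl
    have := jensen_pow (Measure.count.withDensity (c k)) (h := W) (measurable_of_countable _).aemeasurable hQ1
    rw [e, e] at this
    refine this.trans (mul_le_mul' (ENNReal.rpow_le_rpow ?_ (by linarith)) le_rfl)
    have h3 := e (fun _ => 1)
    simp only [lintegral_const, one_mul, mul_one] at h3
    rw [h3]; exact h1 k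
  calc _ ≤ (A ^ R * ∑' j, W j ^ R) ^ (1/R) := by
        refine ENNReal.rpow_le_rpow ?_ (by positivity)
        calc _ ≤ ∑' k, A ^ (R - 1) * ∑' j, c k j * W j ^ R := ENNReal.tsum_le_tsum hj
          _ = A ^ (R - 1) * ∑' j, (∑' k, c k j) * W j ^ R := by
              rw [ENNReal.tsum_mul_left, ENNReal.tsum_comm]
              simp_rw [ENNReal.tsum_mul_right]
          _ ≤ A ^ (R - 1) * ∑' j, A * W j ^ R :=
              mul_le_mul' le_rfl (ENNReal.tsum_le_tsum fun j => mul_le_mul' (h2 j) le_rfl)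
          _ = A ^ (R - 1) * A ^ (1:ℝ) * ∑' j, W j ^ R := by rw [ENNReal.tsum_mul_left, ENNReal.rpow_one, mul_assoc]
          _ = _ := by
              rw [← ENNReal.rpow_add_of_nonneg _ _ (by linarith) (by norm_num)]; simp
    _ = _ := by
        rw [ENNReal.mul_rpow_of_nonneg _ _ (by positivity), ← ENNReal.rpow_mul, mul_one_div_cancel hR0.ne', ENNReal.rpow_one]

/-- off-diagonal decay -/
def c1 (δ : ℝ) (k j : ℕ) : ℝ≥0∞ := (2:ℝ≥0∞) ^ (-(δ * |(k:ℝ) - j|))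

lemma geom_ne_top {δ : ℝ} (hδ : 0 < δ) : ∑' m : ℕ, ((2:ℝ≥0∞) ^ (-δ)) ^ m ≠ ∞ := by
  rw [ENNReal.tsum_geometric, Ne, ENNReal.inv_eq_top, tsub_eq_zero_iff_le, not_le]
  rw [ENNReal.rpow_neg, ENNReal.inv_lt_one]
  exact ENNReal.one_lt_rpow (by norm_num) hδ

lemma c1_comm (δ : ℝ) (k j : ℕ) : c1 δ k j = c1 δ j k := by unfold c1; rw [abs_sub_comm]

lemma c1_sum {δ : ℝ} (_hδ : 0 < δ) (k : ℕ) : ∑' j, c1 δ k j ≤ 2 * ∑' m : ℕ, ((2:ℝ≥0∞) ^ (-δ)) ^ m := by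
  have e : ∀ m : ℕ, ((2:ℝ≥0∞) ^ (-δ)) ^ m = (2:ℝ≥0∞) ^ (-(δ * m)) := by
    intro m; rw [← ENNReal.rpow_natCast, ← ENNReal.rpow_mul]; congr 1; ring
  calc ∑' j, c1 δ k j ≤ ∑' j, ((if k ≤ j then (2:ℝ≥0∞) ^ (-(δ * ((j - k : ℕ):ℝ))) else 0) + (if j ≤ k then (2:ℝ≥0∞) ^ (-(δ * ((k - j : ℕ):ℝ))) else 0)) := by
        refine ENNReal.tsum_le_tsum fun j => ?_
        unfold c1
        rcases le_total k j with h | h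
        · rw [if_pos h, Nat.cast_sub h, abs_sub_comm, abs_of_nonneg (by simpa using h)]; exact le_self_add
        · rw [if_pos h, Nat.cast_sub h, abs_of_nonneg (by simpa using h)]; exact le_add_self
    _ = (∑' j, if k ≤ j then (2:ℝ≥0∞) ^ (-(δ * ((j - k : ℕ):ℝ))) else 0) + ∑' j, (if j ≤ k then (2:ℝ≥0∞) ^ (-(δ * ((k - j : ℕ):ℝ))) else 0) := ENNReal.tsum_add
    _ ≤ _ := by
        rw [two_mul]
        refine add_le_add ?_ ?_
        · rw [← Function.Injective.tsum_eq (g := fun m : ℕ => k + m) (add_right_injective k)]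
          · simp [e]
          · intro j hj
            simp at hj
            exact ⟨j - k, by simp; omega⟩
        · rw [tsum_eq_sum (s := Finset.range (k+1)) (fun j hj => by simp at hj; rw [if_neg (by omega)])]
          rw [← Finset.sum_range_reflect]
          refine le_trans (Finset.sum_le_sum fun j hj => ?_) (ENNReal.sum_le_tsum (Finset.range (k+1)))
          simp at hj
          rw [if_pos (by omega), e]
          refine le_of_eq ?_
          congr 4; omega

/-- one-sided decay -/
def c2 (j m : ℕ) : ℝ≥0∞ := if j ≤ m then c1 1 j m else 0

lemma c2_le (j m : ℕ) : c2 j m ≤ c1 1 j m := by unfold c2; split_ifs <;> simp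

lemma lqSum_mono (q : ℝ≥0∞) {a b : ℕ → ℝ≥0∞} (h : ∀ j, a j ≤ b j) : lqSum q a ≤ lqSum q b := by
  unfold lqSum
  split_ifs
  · exact iSup_mono h
  · exact ENNReal.rpow_le_rpow (ENNReal.tsum_le_tsum fun j => ENNReal.rpow_le_rpow (h j) ENNReal.toReal_nonneg) (by positivity)

lemma lqSum_mul {q : ℝ≥0∞} (hq : 0 < q) (c : ℝ≥0∞) (a : ℕ → ℝ≥0∞) : lqSum q (fun j => c * a j) = c * lqSum q a := by
  unfold lqSum
  split_ifs with h
  · rw [ENNReal.mul_iSup]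
  · have : 0 < q.toReal := ENNReal.toReal_pos hq.ne' h
    simp_rw [ENNReal.mul_rpow_of_nonneg _ _ this.le]
    rw [ENNReal.tsum_mul_left, ENNReal.mul_rpow_of_nonneg _ _ (by positivity), ← ENNReal.rpow_mul, mul_one_div_cancel this.ne', ENNReal.rpow_one]

lemma lqSum_rpow {q : ℝ≥0∞} (hq : 0 < q) {r : ℝ} (hr : 0 < r) (a : ℕ → ℝ≥0∞) :
    lqSum (q / ENNReal.ofReal r) (fun j => a j ^ r) = lqSum q a ^ r := by
  have hr' : ENNReal.ofReal r ≠ 0 := by simpa using hr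
  unfold lqSum
  rcases eq_or_ne q ∞ with rfl | h
  · rw [ENNReal.top_div_of_ne_top ENNReal.ofReal_ne_top]
    simp only [if_true]
    exact ((ENNReal.orderIsoRpow r hr).map_iSup a).symm
  · have h2 : q / ENNReal.ofReal r ≠ ∞ := ENNReal.div_ne_top h hr'
    have : 0 < q.toReal := ENNReal.toReal_pos hq.ne' h
    rw [if_neg h, if_neg h2, ENNReal.toReal_div, ENNReal.toReal_ofReal hr.le, ← ENNReal.rpow_mul]
    congr 1
    · refine tsum_congr fun j => ?_
      rw [← ENNReal.rpow_mul]; congr 1; field_simp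
    · field_simp

lemma main_ineq (n : ℕ) {p r δ : ℝ} {q : ℝ≥0∞} (hr : 0 < r) (hrp : r < p) (hrq : ENNReal.ofReal r ≤ q) (hδ : 0 < δ)
    {B : ℝ≥0∞} (hB : B ≠ ∞) :
    ∃ C : ℝ≥0∞, C ≠ ∞ ∧ ∀ (V W : ℕ → Rn n → ℝ≥0∞), (∀ j, Measurable (W j)) →
      (∀ k x, V k x ^ r ≤ B * ∑' j, c1 δ k j * ∑' m, c2 j m * KC m (fun y => W m y ^ r) x) →
      ∫⁻ x, (lqSum q fun k => V k x) ^ p ≤ C * ∫⁻ x, (lqSum q fun k => W k x) ^ p := by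
  have hr' : ENNReal.ofReal r ≠ 0 := by simpa using hr
  have hq : 0 < q := lt_of_lt_of_le (by simpa using hr) hrq
  have hP : 1 < p / r := by rwa [lt_div_iff₀ hr, one_mul]
  have hQ : 1 ≤ q / ENNReal.ofReal r := by
    rw [ENNReal.le_div_iff_mul_le (Or.inl hr') (Or.inl ENNReal.ofReal_ne_top), one_mul]; exact hrq
  obtain ⟨C0, hC0, hfs⟩ := fs_ineq n hP hQ
  set A1 : ℝ≥0∞ := 2 * ∑' m : ℕ, ((2:ℝ≥0∞) ^ (-δ)) ^ m with hA1
  set A2 : ℝ≥0∞ := 2 * ∑' m : ℕ, ((2:ℝ≥0∞) ^ (-(1:ℝ))) ^ m with hA2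
  have hA1t : A1 ≠ ∞ := ENNReal.mul_ne_top (by simp) (geom_ne_top hδ)
  have hA2t : A2 ≠ ∞ := ENNReal.mul_ne_top (by simp) (geom_ne_top one_pos)
  have hBA : B * (A1 * A2) ≠ ∞ := ENNReal.mul_ne_top hB (ENNReal.mul_ne_top hA1t hA2t)
  have hpr : 0 ≤ p / r := by linarith
  refine ⟨(B * (A1 * A2)) ^ (p/r) * C0, ENNReal.mul_ne_top (ENNReal.rpow_ne_top_of_nonneg hpr hBA) hC0, fun V W mW hV => ?_⟩
  have e : ∀ a : ℕ → ℝ≥0∞, lqSum q a ^ p = (lqSum (q / ENNReal.ofReal r) fun j => a j ^ r) ^ (p/r) := by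
    intro a
    rw [lqSum_rpow hq hr, ← ENNReal.rpow_mul]; congr 1; field_simp
  simp_rw [e]
  calc _ ≤ ∫⁻ x, (B * (A1 * A2)) ^ (p/r) * (lqSum (q / ENNReal.ofReal r) fun m => KC m (fun y => W m y ^ r) x) ^ (p/r) := by
        refine lintegral_mono fun x => ?_
        rw [← ENNReal.mul_rpow_of_nonneg _ _ hpr]
        refine ENNReal.rpow_le_rpow ?_ hpr
        refine (lqSum_mono _ fun k => hV k x).trans ?_
        rw [lqSum_mul (lt_of_lt_of_le one_pos hQ), mul_assoc, mul_assoc]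
        refine mul_le_mul' le_rfl ?_
        refine (schur hQ (A := A1) (c1_sum hδ) (fun j => by simp_rw [c1_comm δ _ j]; exact c1_sum hδ j) _).trans ?_
        refine mul_le_mul' le_rfl ?_
        refine schur hQ (A := A2) (fun j => ?_) (fun m => ?_) _
        · exact (ENNReal.tsum_le_tsum fun m => c2_le j m).trans (c1_sum one_pos j)
        · refine (ENNReal.tsum_le_tsum fun j => c2_le j m).trans ?_
          simp_rw [c1_comm 1 _ m]; exact c1_sum one_pos m
    _ ≤ _ := by
        rw [lintegral_const_mul' _ _ (ENNReal.rpow_ne_top_of_nonneg hpr hBA), mul_assoc ((B * (A1 * A2)) ^ (p/r)) C0]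
        exact mul_le_mul' le_rfl (hfs (fun m y => W m y ^ r) fun j => (mW j).pow_const _)

end TL

namespace TL

/-- sub-mean-value hypothesis in kernel form -/
def H1 {n : ℕ} (C : ℕ → ℝ≥0∞) (u : ℕ → Rn n → ℝ≥0∞) : Prop :=
  ∀ (N j : ℕ) (x : Rn n), u j x ≤
    C N * ∑' l : ℕ, ENNReal.ofReal ((2 ^ (l * N))⁻¹) * ∫⁻ z, ker (j + l) N (x - z) * u (j + l) z

/-- polynomial growth -/
def Gr {n : ℕ} (u : ℕ → Rn n → ℝ≥0∞) : Prop :=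
  ∃ (D : ℝ≥0∞) (M : ℕ), D ≠ ∞ ∧ ∀ k y, u k y ≤ D * ENNReal.ofReal ((2 ^ k * (1 + ‖y‖)) ^ M)

lemma H1_GG {n : ℕ} {C : ℕ → ℝ≥0∞} {u : ℕ → Rn n → ℝ≥0∞} (h : H1 C u) (N j : ℕ) (x : Rn n) :
    u j x ≤ C N * GG u N j x := by
  refine (h N j x).trans (mul_le_mul' le_rfl (ENNReal.tsum_le_tsum fun l => ?_))
  rw [← lintegral_const_mul' _ _ ENNReal.ofReal_ne_top]
  refine lintegral_mono fun z => ?_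
  rw [← mul_assoc]
  refine mul_le_mul' ?_ le_rfl
  unfold ker bb
  rw [ENNReal.rpow_neg, ENNReal.rpow_natCast, ← ENNReal.ofReal_pow (by positivity), ← ENNReal.ofReal_inv_of_pos (by positivity)]
  have e2 : (2:ℝ≥0∞) ^ ((j+l)*n) = ENNReal.ofReal (2 ^ ((j+l)*n)) := by
    rw [ENNReal.ofReal_pow (by norm_num)]; simp
  rw [e2, ← ENNReal.ofReal_mul (by positivity), ← ENNReal.ofReal_mul (by positivity)]
  apply ENNReal.ofReal_le_ofReal
  rw [mul_left_comm, ← mul_inv, pow_mul (2:ℝ) l N, ← mul_pow]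
  gcongr
  · norm_num
  · omega

lemma Gr_bb {n : ℕ} {u : ℕ → Rn n → ℝ≥0∞} (h : Gr u) :
    ∃ (D : ℝ≥0∞) (M : ℕ), D ≠ ∞ ∧ ∀ k y, u k y ≤ D * bb 0 k 0 y ^ (M:ℝ) := by
  obtain ⟨D, M, hD, h⟩ := h
  refine ⟨D, M, hD, fun k y => (h k y).trans (le_of_eq ?_)⟩
  unfold bb
  rw [ENNReal.rpow_natCast, ← ENNReal.ofReal_pow (by positivity)]
  simp

/-- coefficient of the pre-inequality -/
def ac (s δ : ℝ) (k j : ℕ) : ℝ≥0∞ := (2:ℝ≥0∞) ^ (((j:ℝ) - k) * s) * c1 δ k j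

lemma two_rpow_add (a b : ℝ) : (2:ℝ≥0∞) ^ (a + b) = 2 ^ a * 2 ^ b :=
  ENNReal.rpow_add _ _ (by norm_num) (by norm_num)

lemma GG_le_KC {n : ℕ} {s r : ℝ} (hr : 0 < r) (hr1 : r ≤ 1) {N : ℕ} (hN : (n:ℝ) + 2 + |s| ≤ N * r)
    {u : ℕ → Rn n → ℝ≥0∞} (j : ℕ) (x : Rn n) :
    (2:ℝ≥0∞) ^ ((j:ℝ) * s * r) * GG (fun j x => u j x ^ r) (N * r) j x ≤
      ∑' m, c2 j m * KC m (fun y => ((2:ℝ≥0∞) ^ ((m:ℝ) * s) * u m y) ^ r) x := by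
  have hinj : ∑' l : ℕ, c2 j (j + l) * KC (j+l) (fun y => ((2:ℝ≥0∞) ^ (((j + l : ℕ):ℝ) * s) * u (j+l) y) ^ r) x ≤
      ∑' m, c2 j m * KC m (fun y => ((2:ℝ≥0∞) ^ ((m:ℝ) * s) * u m y) ^ r) x :=
    ENNReal.tsum_comp_le_tsum_of_injective (add_right_injective j)
      (fun m => c2 j m * KC m (fun y => ((2:ℝ≥0∞) ^ ((m:ℝ) * s) * u m y) ^ r) x)
  refine le_trans ?_ hinj
  unfold GG
  rw [← ENNReal.tsum_mul_left]
  refine ENNReal.tsum_le_tsum fun l => ?_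
  have t1 : ∀ a : ℝ, (2:ℝ≥0∞) ^ a ≠ ∞ := fun a => by simp [ENNReal.rpow_eq_top_iff]
  have hc2 : c2 j (j+l) = (2:ℝ≥0∞) ^ (-(l:ℝ)) := by
    unfold c2 c1; rw [if_pos (by omega)]; congr 1; push_cast
    have : (j:ℝ) - (j + l) = -l := by ring
    rw [this, abs_neg, abs_of_nonneg (by positivity)]; ring
  rw [hc2]; unfold KC
  rw [← lintegral_const_mul' _ _ (t1 _), ← lintegral_const_mul' _ _ (t1 _)]
  refine lintegral_mono fun z => ?_
  set b := bb j l x z with hb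
  have b1 : 1 ≤ b := one_le_bb _ _ _ _
  have bt : b ≠ ∞ := bb_ne_top _ _ _ _
  have b0 : b ≠ 0 := bb_ne_zero _ _ _ _
  have hk : 2 ^ ((j+l)*n) * b ^ (-((n:ℝ)+1)) ≤ ker (j+l) (n+1) (x - z) := by
    unfold ker
    have e2 : (2:ℝ≥0∞) ^ ((j+l)*n) = ENNReal.ofReal (2 ^ ((j+l)*n)) := by
      rw [ENNReal.ofReal_pow (by norm_num)]; simp
    have e3 : -((n:ℝ)+1) = -((n+1 : ℕ):ℝ) := by push_cast; ring
    rw [e2, e3, ENNReal.rpow_neg, ENNReal.rpow_natCast, hb]; unfold bb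
    rw [← ENNReal.ofReal_pow (by positivity), ← ENNReal.ofReal_inv_of_pos (by positivity), ← ENNReal.ofReal_mul (by positivity)]
    apply ENNReal.ofReal_le_ofReal
    gcongr
    rw [mul_add, mul_one, ← mul_assoc, ← pow_add, add_comm l j]
    gcongr
    exact one_le_pow₀ (by norm_num)
  have hb2 : (2:ℝ≥0∞) ^ (l:ℝ) ≤ b := by
    rw [hb]; unfold bb
    rw [ENNReal.rpow_natCast]
    have e2 : (2:ℝ≥0∞) ^ l = ENNReal.ofReal (2 ^ l) := by
      rw [ENNReal.ofReal_pow (by norm_num)]; simp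
    rw [e2]
    apply ENNReal.ofReal_le_ofReal
    have : 0 ≤ (2:ℝ) ^ l * (2 ^ j * ‖x - z‖) := by positivity
    linarith
  have hsr : s * r ≤ |s| := by
    have h1 := le_abs_self s
    have h2 := abs_nonneg s
    nlinarith [mul_le_mul_of_nonneg_right h1 hr.le]
  have hsr' : -(s * r) ≤ |s| := by
    have h1 := neg_abs_le s
    have h2 := abs_nonneg s
    nlinarith [mul_le_mul_of_nonneg_right h1 hr.le]
  have hmain : (2:ℝ≥0∞) ^ ((j:ℝ) * s * r) * b ^ (-(N * r : ℝ)) ≤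
      2 ^ (-(l:ℝ)) * b ^ (-((n:ℝ)+1)) * 2 ^ (((j + l : ℕ):ℝ) * s * r) := by
    have e : -(N * r : ℝ) = -((n:ℝ)+1) + -(N * r - (n + 1)) := by ring
    rw [e, ENNReal.rpow_add _ _ b0 bt]
    have h3 : b ^ (-(N * r - (n + 1)) : ℝ) ≤ 2 ^ (-((l:ℝ) * (N * r - (n+1)))) := by
      rw [ENNReal.rpow_neg, ENNReal.rpow_neg, ENNReal.inv_le_inv, ENNReal.rpow_mul]
      exact ENNReal.rpow_le_rpow hb2 (by linarith [abs_nonneg s])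
    have h4 : (2:ℝ≥0∞) ^ (-((l:ℝ) * (N * r - (n+1)))) ≤ 2 ^ (-(l:ℝ) + l * s * r) := by
      refine ENNReal.rpow_le_rpow_of_exponent_le (by norm_num) ?_
      have : (0:ℝ) ≤ l := by positivity
      nlinarith
    calc _ ≤ 2 ^ ((j:ℝ) * s * r) * (b ^ (-((n:ℝ)+1)) * 2 ^ (-(l:ℝ) + l * s * r)) :=
          mul_le_mul' le_rfl (mul_le_mul' le_rfl (h3.trans h4))
      _ = b ^ (-((n:ℝ)+1)) * (2 ^ ((j:ℝ) * s * r) * 2 ^ (-(l:ℝ) + l * s * r)) := by ring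
      _ = b ^ (-((n:ℝ)+1)) * (2 ^ (-(l:ℝ)) * 2 ^ (((j + l : ℕ):ℝ) * s * r)) := by
          rw [← two_rpow_add, ← two_rpow_add]; congr 2; push_cast; ring
      _ = _ := by ring
  calc _ = (2:ℝ≥0∞) ^ ((j:ℝ) * s * r) * b ^ (-(N * r : ℝ)) * (2 ^ ((j+l)*n) * u (j+l) z ^ r) := by ring
    _ ≤ 2 ^ (-(l:ℝ)) * b ^ (-((n:ℝ)+1)) * 2 ^ (((j + l : ℕ):ℝ) * s * r) * (2 ^ ((j+l)*n) * u (j+l) z ^ r) :=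
        mul_le_mul' hmain le_rfl
    _ = 2 ^ (-(l:ℝ)) * ((2 ^ ((j+l)*n) * b ^ (-((n:ℝ)+1))) * (2 ^ (((j + l : ℕ):ℝ) * s * r) * u (j+l) z ^ r)) := by ring
    _ ≤ _ := by
        refine mul_le_mul' le_rfl (mul_le_mul' hk (le_of_eq ?_))
        beta_reduce
        rw [ENNReal.mul_rpow_of_nonneg _ _ hr.le, ← ENNReal.rpow_mul]

lemma pre_ineq (n : ℕ) (s : ℝ) {r : ℝ} (δ : ℝ) (hr : 0 < r) (hr1 : r ≤ 1) : ∃ N1 : ℕ,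
    ∀ (CN : ℕ → ℝ≥0∞), (∀ N, CN N ≠ ∞) → ∀ Ca : ℝ≥0∞, Ca ≠ ∞ → ∃ B : ℝ≥0∞, B ≠ ∞ ∧
    ∀ u : ℕ → Rn n → ℝ≥0∞, Gr u → H1 CN u →
    ∀ (v : ℝ≥0∞) (k : ℕ) (x : Rn n), v ≤ Ca * ∑' j, ac s δ k j * ∫⁻ z, ker j N1 (x - z) * u j z →
    ((2:ℝ≥0∞) ^ ((k:ℝ) * s) * v) ^ r ≤
      B * ∑' j, c1 (δ * r) k j * ∑' m, c2 j m * KC m (fun y => ((2:ℝ≥0∞) ^ ((m:ℝ) * s) * u m y) ^ r) x := by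
  obtain ⟨N, hN⟩ : ∃ N : ℕ, (n:ℝ) + 2 + |s| ≤ N * r := by
    obtain ⟨N, hN⟩ := exists_nat_ge (((n:ℝ) + 2 + |s|) / r)
    exact ⟨N, by rwa [div_le_iff₀ hr] at hN⟩
  obtain ⟨C0, hC0, hK⟩ := KC_le_MM n
  refine ⟨N + (n + 1), fun CN hCN Ca hCa => ⟨(Ca * C0) ^ r * CN N, ENNReal.mul_ne_top
    (ENNReal.rpow_ne_top_of_nonneg hr.le (ENNReal.mul_ne_top hCa hC0)) (hCN N), fun u hg h1 v k x hv => ?_⟩⟩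
  have hST := ST_lemma u hr hr1 hCN (H1_GG h1) (Gr_bb hg) N
  set Gr' : ℕ → ℝ≥0∞ := fun j => GG (fun j x => u j x ^ r) (N * r) j x with hGr
  have hint : ∀ j, ∫⁻ z, ker j (N + (n+1)) (x - z) * u j z ≤ C0 * (CN N * Gr' j) ^ (1/r) := by
    intro j
    have hu : ∀ z, u j z ≤ (CN N * Gr' j) ^ (1/r) * bb j 0 x z ^ (N:ℝ) := by
      intro z
      have h2 := (hST j z).trans (mul_le_mul' le_rfl (GG_tri (fun j x => u j x ^ r) (by positivity : (0:ℝ) ≤ N * r) j 0 x z))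
      have h3 := ENNReal.rpow_le_rpow h2 (by positivity : 0 ≤ 1/r)
      rw [← ENNReal.rpow_mul, mul_one_div_cancel hr.ne', ENNReal.rpow_one] at h3
      refine h3.trans (le_of_eq ?_)
      rw [mul_left_comm, mul_comm, ENNReal.mul_rpow_of_nonneg _ _ (by positivity), ← ENNReal.rpow_mul]
      congr 2; field_simp
    have hker : ∀ z, ker j (N + (n+1)) (x - z) * bb j 0 x z ^ (N:ℝ) = ker j (n+1) (x - z) := by
      intro z
      unfold ker bb
      rw [ENNReal.rpow_natCast, ← ENNReal.ofReal_pow (by positivity), ← ENNReal.ofReal_mul (by positivity)]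
      congr 1
      rw [pow_add, pow_zero, one_mul]
      have : 1 + 2 ^ j * ‖x - z‖ ≠ 0 := by positivity
      field_simp
    calc _ ≤ ∫⁻ z, (CN N * Gr' j) ^ (1/r) * (ker j (n+1) (x - z) * 1) := by
          refine lintegral_mono fun z => ?_
          rw [mul_one, ← hker z, mul_left_comm]
          exact mul_le_mul' le_rfl (hu z)
      _ = (CN N * Gr' j) ^ (1/r) * KC j (fun _ => 1) x := by
          rw [lintegral_const_mul]; rfl
          exact ((measurable_ker j _).comp (by fun_prop)).mul measurable_const
      _ ≤ _ := by
          rw [mul_comm]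
          refine mul_le_mul' ((hK j _ measurable_const x).trans ?_) le_rfl
          exact (mul_le_mul' le_rfl (MM_const_le 1 x)).trans (by simp)
  have hv2 : v ≤ (Ca * C0) * ∑' j, ac s δ k j * (CN N * Gr' j) ^ (1/r) := by
    refine hv.trans ?_
    rw [mul_assoc, ← ENNReal.tsum_mul_left (a := C0)]
    refine mul_le_mul' le_rfl (ENNReal.tsum_le_tsum fun j => ?_)
    rw [mul_left_comm]
    exact mul_le_mul' le_rfl (hint j)
  calc _ ≤ (2 ^ ((k:ℝ) * s) * ((Ca * C0) * ∑' j, ac s δ k j * (CN N * Gr' j) ^ (1/r))) ^ r :=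
        ENNReal.rpow_le_rpow (mul_le_mul' le_rfl hv2) hr.le
    _ ≤ 2 ^ ((k:ℝ) * s * r) * ((Ca * C0) ^ r * ∑' j, ac s δ k j ^ r * (CN N * Gr' j)) := by
        rw [ENNReal.mul_rpow_of_nonneg _ _ hr.le, ENNReal.mul_rpow_of_nonneg _ _ hr.le, ← ENNReal.rpow_mul]
        refine mul_le_mul' le_rfl (mul_le_mul' le_rfl ((tsum_rpow_le _ hr hr1).trans (le_of_eq ?_)))
        refine tsum_congr fun j => ?_
        rw [ENNReal.mul_rpow_of_nonneg _ _ hr.le, ← ENNReal.rpow_mul, one_div_mul_cancel hr.ne', ENNReal.rpow_one]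
    _ = (Ca * C0) ^ r * CN N * ∑' j, c1 (δ * r) k j * (2 ^ ((j:ℝ) * s * r) * Gr' j) := by
        rw [mul_left_comm, mul_assoc ((Ca * C0) ^ r)]
        refine congrArg (fun t => (Ca * C0) ^ r * t) ?_
        rw [← ENNReal.tsum_mul_left, ← ENNReal.tsum_mul_left]
        refine tsum_congr fun j => ?_
        have : (2:ℝ≥0∞) ^ ((k:ℝ) * s * r) * ac s δ k j ^ r = c1 (δ * r) k j * 2 ^ ((j:ℝ) * s * r) := by
          unfold ac c1
          rw [ENNReal.mul_rpow_of_nonneg _ _ hr.le, ← ENNReal.rpow_mul, ← ENNReal.rpow_mul, ← two_rpow_add, ← two_rpow_add, ← two_rpow_add]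
          congr 1; ring
        rw [← mul_assoc, this]; ring
    _ ≤ _ := by
        refine mul_le_mul' le_rfl (ENNReal.tsum_le_tsum fun j => mul_le_mul' le_rfl ?_)
        exact GG_le_KC hr hr1 hN j x

end TL

namespace TL
open scoped LineDeriv

/-- sup of Schwartz seminorms up to order m -/
def QQ {n : ℕ} (m : ℕ) (φ : Sch n) : ℝ := (Finset.Iic (m, m)).sup (schwartzSeminormFamily ℂ (Rn n) ℂ) φ

lemma QQ_nonneg {n : ℕ} (m : ℕ) (φ : Sch n) : 0 ≤ QQ m φ := apply_nonneg _ _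

lemma QQ_le {n : ℕ} {m : ℕ} {φ : Sch n} {M : ℝ} (hM : 0 ≤ M)
    (h : ∀ k l, k ≤ m → l ≤ m → ∀ x, ‖x‖ ^ k * ‖iteratedFDeriv ℝ l φ x‖ ≤ M) : QQ m φ ≤ M := by
  refine Seminorm.finset_sup_apply_le hM fun i hi => ?_
  rw [Finset.mem_Iic] at hi
  exact SchwartzMap.seminorm_le_bound ℂ _ _ _ hM (h i.1 i.2 hi.1 hi.2)

lemma le_QQ {n : ℕ} {m k l : ℕ} (hk : k ≤ m) (hl : l ≤ m) (φ : Sch n) (x : Rn n) :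
    (1 + ‖x‖) ^ k * ‖iteratedFDeriv ℝ l φ x‖ ≤ 2 ^ m * QQ m φ :=
  SchwartzMap.one_add_le_sup_seminorm_apply (𝕜 := ℂ) (m := (m, m)) hk hl φ x

lemma le_QQ0 {n : ℕ} {m k : ℕ} (hk : k ≤ m) (φ : Sch n) (x : Rn n) :
    (1 + ‖x‖) ^ k * ‖φ x‖ ≤ 2 ^ m * QQ m φ := by
  have := le_QQ hk (Nat.zero_le m) φ x
  rwa [norm_iteratedFDeriv_zero] at this

lemma QQ_mono {n : ℕ} {m m' : ℕ} (h : m ≤ m') (φ : Sch n) : QQ m φ ≤ QQ m' φ := by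
  refine Seminorm.le_def.mp (Finset.sup_mono (Finset.Iic_subset_Iic.mpr ?_)) φ
  exact ⟨h, h⟩

lemma sup_le_QQ {n : ℕ} (s : Finset (ℕ × ℕ)) : ∃ m : ℕ, ∀ φ : Sch n,
    s.sup (schwartzSeminormFamily ℂ (Rn n) ℂ) φ ≤ QQ m φ := by
  refine ⟨s.sup (fun i => max i.1 i.2), fun φ => Seminorm.le_def.mp (Finset.sup_mono fun i hi => ?_) φ⟩
  rw [Finset.mem_Iic]
  have := Finset.le_sup (f := fun i : ℕ × ℕ => max i.1 i.2) hi
  exact ⟨(le_max_left _ _).trans this, (le_max_right _ _).trans this⟩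

lemma clm_QQ {n : ℕ} (A : Sch n →L[ℂ] Sch n) (m : ℕ) : ∃ (m' : ℕ) (C : ℝ), 0 ≤ C ∧
    ∀ φ, QQ m (A φ) ≤ C * QQ m' φ := by
  let q : Seminorm ℂ (Sch n) := ((Finset.Iic (m, m)).sup (schwartzSeminormFamily ℂ (Rn n) ℂ)).comp A.toLinearMap
  have hq : Continuous q := by
    have : ∀ t : Finset (ℕ × ℕ), Continuous (fun φ => t.sup (schwartzSeminormFamily ℂ (Rn n) ℂ) φ) := by
      intro t
      classical
      induction t using Finset.induction_on with
      | empty => simp only [Finset.sup_empty]; exact continuous_const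
      | insert a t _ ih =>
        simp only [Finset.sup_insert]
        exact ((schwartz_withSeminorms ℂ (Rn n) ℂ).continuous_seminorm a).sup ih
    exact (this _).comp A.continuous
  obtain ⟨s, C, hC, hs⟩ := Seminorm.bound_of_continuous (schwartz_withSeminorms ℂ (Rn n) ℂ) q hq
  obtain ⟨m', hm'⟩ := sup_le_QQ (n := n) s
  refine ⟨m', C, C.2, fun φ => (Seminorm.le_def.mp hs φ).trans ?_⟩
  exact mul_le_mul_of_nonneg_left (hm' φ) C.2

/-- coordinate derivative on Schwartz space -/
def DD {n : ℕ} (i : Fin n) (g : Sch n) : Sch n := ∂_{(EuclideanSpace.single i (1:ℝ) : Rn n)} g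

def DA {n : ℕ} (L : List (Fin n)) (α : Fin n → ℕ) (g : Sch n) : Sch n :=
  L.foldr (fun i h => (DD i)^[α i] h) g

lemma pd_coe {n : ℕ} (i : Fin n) (g : Sch n) : pd i (fun y => g y) = fun y => DD i g y := by
  ext x; rw [DD, SchwartzMap.lineDerivOp_apply]; rfl

lemma pd_iter_coe {n : ℕ} (i : Fin n) (k : ℕ) (g : Sch n) :
    (pd i)^[k] (fun y => g y) = fun y => ((DD i)^[k] g) y := by
  induction k generalizing g with
  | zero => rfl
  | succ k ih => rw [Function.iterate_succ_apply, Function.iterate_succ_apply, pd_coe, ih]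

lemma mderiv_coe {n : ℕ} (α : Fin n → ℕ) (g : Sch n) :
    mderiv α (fun y => g y) = fun y => DA (List.finRange n) α g y := by
  unfold mderiv DA
  induction (List.finRange n) with
  | nil => rfl
  | cons a t ih => rw [List.foldr_cons, ih, pd_iter_coe, List.foldr_cons]

lemma norm_iteratedFDeriv_DD {n : ℕ} (i : Fin n) (g : Sch n) (k : ℕ) (x : Rn n) :
    ‖iteratedFDeriv ℝ k (DD i g) x‖ ≤ ‖iteratedFDeriv ℝ (k+1) g x‖ := by
  have h : (⇑(DD i g)) = fun y => (fderiv ℝ g y) (EuclideanSpace.single i (1:ℝ)) := by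
    ext y; exact SchwartzMap.lineDerivOp_apply_eq_fderiv _ _ _
  rw [h, ← norm_iteratedFDeriv_fderiv]
  have := norm_iteratedFDeriv_clm_apply_const (𝕜 := ℝ) (f := fderiv ℝ g) (c := (EuclideanSpace.single i (1:ℝ) : Rn n)) (x := x) (n := k) (N := (⊤ : ℕ∞))
    (((g.smooth ⊤).fderiv_right (m := (⊤ : ℕ∞)) (by simp)).contDiffAt) (by exact_mod_cast le_top)
  simpa using this

lemma norm_iteratedFDeriv_DDit {n : ℕ} (i : Fin n) (g : Sch n) (k a : ℕ) (x : Rn n) :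
    ‖iteratedFDeriv ℝ k ((DD i)^[a] g) x‖ ≤ ‖iteratedFDeriv ℝ (k+a) g x‖ := by
  induction a generalizing k with
  | zero => rfl
  | succ a ih =>
    rw [Function.iterate_succ_apply']
    refine (norm_iteratedFDeriv_DD i _ k x).trans ((ih (k+1)).trans (le_of_eq ?_))
    rw [show k + 1 + a = k + (a+1) by ring]

lemma norm_DA {n : ℕ} (L : List (Fin n)) (α : Fin n → ℕ) (g : Sch n) (k : ℕ) (x : Rn n) :
    ‖iteratedFDeriv ℝ k (DA L α g) x‖ ≤ ‖iteratedFDeriv ℝ (k + (L.map α).sum) g x‖ := by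
  induction L generalizing k with
  | nil => rfl
  | cons a t ih =>
    refine (norm_iteratedFDeriv_DDit a _ k (α a) x).trans ((ih (k + α a)).trans (le_of_eq ?_))
    rw [List.map_cons, List.sum_cons, add_assoc]

lemma norm_mderiv_le {n : ℕ} (α : Fin n → ℕ) (g : Sch n) (x : Rn n) :
    ‖mderiv α (fun y => g y) x‖ ≤ ‖iteratedFDeriv ℝ (mdeg α) g x‖ := by
  rw [mderiv_coe, ← norm_iteratedFDeriv_zero (𝕜 := ℝ)]
  refine (norm_DA _ α g 0 x).trans (le_of_eq ?_)
  have : ((List.finRange n).map α).sum = mdeg α := by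
    unfold mdeg; rw [← List.ofFn_eq_map, List.sum_ofFn]
  rw [this, zero_add]

lemma T_bound {n : ℕ} {E : Type*} [NormedAddCommGroup E] [NormedSpace ℂ E] (f : TDist n E) :
    ∃ (m : ℕ) (C : ℝ), 0 ≤ C ∧ ∀ φ, ‖f.toFun φ‖ ≤ C * QQ m φ := by
  obtain ⟨c, K, L, h⟩ := f.bound
  set A : ℝ := (Fintype.card (Fin n → Fin (L+1))) * 2 ^ (K + L)
  refine ⟨K + L, |c| * A, by positivity, fun φ => (h φ).trans ?_⟩
  have h0 : 0 ≤ schSemi K L φ := by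
    refine Real.iSup_nonneg fun x => mul_nonneg (by positivity) (Finset.sum_nonneg fun i _ => ?_)
    split_ifs <;> positivity
  have hs : schSemi K L φ ≤ A * QQ (K+L) φ := by
    refine Real.iSup_le (fun x => ?_) (mul_nonneg (by positivity) (QQ_nonneg _ _))
    have hw : (1 + ‖x‖ ^ 2) ^ ((K : ℝ) / 2) ≤ (1 + ‖x‖) ^ K := by
      calc (1 + ‖x‖ ^ 2) ^ ((K : ℝ) / 2) ≤ ((1 + ‖x‖)^2) ^ ((K : ℝ) / 2) := by
            refine Real.rpow_le_rpow (by positivity) ?_ (by positivity)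
            nlinarith [norm_nonneg x]
        _ = _ := by
            rw [← Real.rpow_natCast (1 + ‖x‖) 2, ← Real.rpow_mul (by positivity), ← Real.rpow_natCast]; congr 1; push_cast; ring
    rw [Finset.mul_sum]
    calc _ ≤ ∑ α : Fin n → Fin (L + 1), 2 ^ (K+L) * QQ (K+L) φ := by
          refine Finset.sum_le_sum fun α _ => ?_
          split_ifs with hα
          · refine le_trans ?_ (le_QQ (k := K) (l := mdeg fun i => (α i:ℕ)) (by omega) (by omega) φ x)
            exact mul_le_mul hw (norm_mderiv_le _ _ _) (by positivity) (by positivity)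
          · rw [mul_zero]; exact mul_nonneg (by positivity) (QQ_nonneg _ _)
      _ = _ := by simp only [Finset.sum_const, Finset.card_univ, nsmul_eq_mul, A]; ring
  calc _ ≤ |c| * schSemi K L φ := mul_le_mul_of_nonneg_right (le_abs_self c) h0
    _ ≤ |c| * (A * QQ (K+L) φ) := mul_le_mul_of_nonneg_left hs (abs_nonneg c)
    _ = _ := by ring

end TL

namespace TL
open scoped LineDeriv

lemma DD_comm {n : ℕ} (i j : Fin n) (g : Sch n) : DD i (DD j g) = DD j (DD i g) := by
  ext x
  have h : ∀ (a b : Fin n), DD a (DD b g) x = fderiv ℝ (fderiv ℝ g) x (EuclideanSpace.single a (1:ℝ)) (EuclideanSpace.single b (1:ℝ)) := by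
    intro a b
    have hb : (⇑(DD b g)) = fun y => (fderiv ℝ g y) (EuclideanSpace.single b (1:ℝ)) := by
      ext y; exact SchwartzMap.lineDerivOp_apply_eq_fderiv _ _ _
    have : DD a (DD b g) x = fderiv ℝ (⇑(DD b g)) x (EuclideanSpace.single a (1:ℝ)) :=
      SchwartzMap.lineDerivOp_apply_eq_fderiv _ _ _
    have hd : DifferentiableAt ℝ (fderiv ℝ g) x :=
      ((g.smooth ⊤).fderiv_right (m := (⊤ : ℕ∞)) (by simp)).differentiable (by simp) x
    rw [this, hb, fderiv_clm_apply hd (differentiableAt_const _)]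
    simp
  rw [h, h]
  have := (g.contDiffAt 2 (x := x)).isSymmSndFDerivAt (by simp)
  exact this _ _

lemma DD_it_comm {n : ℕ} (i j : Fin n) (k : ℕ) (g : Sch n) : DD i ((DD j)^[k] g) = (DD j)^[k] (DD i g) :=
  (Function.Commute.iterate_right (f := DD i) (g := DD j) (fun g => DD_comm i j g) k) g

lemma DA_congr {n : ℕ} (L : List (Fin n)) (α β : Fin n → ℕ) (g : Sch n) (h : ∀ i ∈ L, α i = β i) :
    DA L α g = DA L β g := by
  induction L with
  | nil => rfl
  | cons a t ih =>
    have h1 := ih fun i hi => h i (List.mem_cons_of_mem _ hi)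
    change (DD a)^[α a] (DA t α g) = (DD a)^[β a] (DA t β g)
    rw [h1, h a (List.mem_cons_self)]

lemma DD_DA {n : ℕ} (L : List (Fin n)) (α : Fin n → ℕ) (g : Sch n) (i : Fin n) (hL : L.Nodup) (hi : i ∈ L) :
    DD i (DA L α g) = DA L (Function.update α i (α i + 1)) g := by
  induction L with
  | nil => simp at hi
  | cons a t ih =>
    change DD i ((DD a)^[α a] (DA t α g)) = (DD a)^[Function.update α i (α i + 1) a] (DA t _ g)
    rw [List.nodup_cons] at hL
    by_cases hia : i = a
    · subst hia
      rw [Function.update_self, Function.iterate_succ_apply']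
      congr 2
      refine DA_congr _ _ _ _ fun j hj => ?_
      rw [Function.update_of_ne]
      rintro rfl; exact hL.1 hj
    · have hit : i ∈ t := by
        rcases List.mem_cons.mp hi with h | h
        · exact absurd h hia
        · exact h
      rw [DD_it_comm, ih hL.2 hit, Function.update_of_ne (Ne.symm hia)]

lemma iterated_eq_DA {n : ℕ} (g : Sch n) (l : ℕ) (v : Fin l → Fin n) : ∃ α : Fin n → ℕ, mdeg α = l ∧
    ∂^{fun i => (EuclideanSpace.single (v i) (1:ℝ) : Rn n)} g = DA (List.finRange n) α g := by
  induction l with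
  | zero =>
    refine ⟨0, by simp [mdeg], ?_⟩
    rw [LineDeriv.iteratedLineDerivOp_fin_zero]
    have : ∀ L : List (Fin n), DA L 0 g = g := by
      intro L; induction L with
      | nil => rfl
      | cons a t ih => exact ih
    rw [this]
  | succ l ih =>
    obtain ⟨α, hα, h⟩ := ih (fun i => v i.succ)
    refine ⟨Function.update α (v 0) (α (v 0) + 1), ?_, ?_⟩
    · unfold mdeg at hα ⊢
      rw [Finset.sum_update_of_mem (Finset.mem_univ _), Finset.sdiff_singleton_eq_erase]
      rw [← Finset.add_sum_erase _ _ (Finset.mem_univ (v 0))] at hα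
      omega
    · rw [LineDeriv.iteratedLineDerivOp_succ_left]
      rw [← DD_DA _ _ _ _ (List.nodup_finRange n) (List.mem_finRange _), ← h]
      rfl

lemma opNorm_le_basis {n l : ℕ} (A : ContinuousMultilinearMap ℝ (fun _ : Fin l => Rn n) ℂ) :
    ‖A‖ ≤ ∑ v : Fin l → Fin n, ‖A fun i => EuclideanSpace.single (v i) (1:ℝ)‖ := by
  refine A.opNorm_le_bound (Finset.sum_nonneg fun _ _ => norm_nonneg _) fun m => ?_
  have hm : m = fun i => ∑ j : Fin n, (m i j) • (EuclideanSpace.single j (1:ℝ) : Rn n) := by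
    ext i k
    simp [Pi.single_apply]
  conv_lhs => rw [hm]
  have := A.toMultilinearMap.map_sum (fun i (j : Fin n) => (m i j) • (EuclideanSpace.single j (1:ℝ) : Rn n))
  have h2 : (A fun i => ∑ j : Fin n, (m i j) • (EuclideanSpace.single j (1:ℝ) : Rn n)) =
     ∑ r : Fin l → Fin n, A fun i => (m i (r i)) • (EuclideanSpace.single (r i) (1:ℝ) : Rn n) := this
  rw [h2, Finset.sum_mul]
  refine (norm_sum_le _ _).trans (Finset.sum_le_sum fun r _ => ?_)
  rw [A.map_smul_univ, norm_smul, mul_comm]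
  refine mul_le_mul_of_nonneg_left ?_ (norm_nonneg _)
  rw [norm_prod]
  exact Finset.prod_le_prod (fun _ _ => norm_nonneg _) fun i _ => PiLp.norm_apply_le _ _

lemma iteratedFDeriv_le_of_mderiv {n : ℕ} (g : Sch n) (l : ℕ) (x : Rn n) {c : ℝ}
    (h : ∀ α : Fin n → ℕ, mdeg α = l → ‖mderiv α (fun y => g y) x‖ ≤ c) :
    ‖iteratedFDeriv ℝ l g x‖ ≤ (n ^ l : ℕ) * c := by
  refine (opNorm_le_basis _).trans ?_
  calc _ ≤ ∑ v : Fin l → Fin n, c := by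
        refine Finset.sum_le_sum fun v _ => ?_
        rw [← SchwartzMap.iteratedLineDerivOp_eq_iteratedFDeriv]
        obtain ⟨α, hα, he⟩ := iterated_eq_DA g l v
        rw [he]
        have := h α hα
        rwa [mderiv_coe] at this
    _ = _ := by simp

lemma shiftReflect_apply {n : ℕ} (ψ : Sch n) (x y : Rn n) : shiftReflect ψ x y = ψ (x - y) := rfl

lemma dilate_apply {n : ℕ} (ψ : Sch n) {t : ℝ} (ht : t ≠ 0) (y : Rn n) : dilate ψ t y = ψ (t • y) := by
  unfold dilate; rw [dif_neg ht]; rfl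

lemma norm_iFD_smul {n : ℕ} {g : Rn n → ℂ} (hg : ContDiff ℝ (⊤ : ℕ∞) g) (t : ℝ) (l : ℕ) (y : Rn n) :
    ‖iteratedFDeriv ℝ l (fun z => g (t • z)) y‖ = |t| ^ l * ‖iteratedFDeriv ℝ l g (t • y)‖ := by
  rw [iteratedFDeriv_comp_const_smul t (hg.of_le (by exact_mod_cast le_top))]
  simp [norm_smul]

lemma norm_iFD_dilate {n : ℕ} (ψ : Sch n) {t : ℝ} (ht : t ≠ 0) (l : ℕ) (y : Rn n) :
    ‖iteratedFDeriv ℝ l (dilate ψ t) y‖ = |t| ^ l * ‖iteratedFDeriv ℝ l ψ (t • y)‖ := by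
  rw [← norm_iFD_smul (ψ.smooth ⊤)]
  congr 2; ext z; exact dilate_apply ψ ht z

lemma norm_iFD_shift {n : ℕ} (ψ : Sch n) (x : Rn n) (l : ℕ) (y : Rn n) :
    ‖iteratedFDeriv ℝ l (shiftReflect ψ x) y‖ = ‖iteratedFDeriv ℝ l ψ (x - y)‖ := by
  have h : (⇑(shiftReflect ψ x)) = fun z => (fun w => ψ (x + w)) ((-1:ℝ) • z) := by
    ext z; rw [shiftReflect_apply]; simp [sub_eq_add_neg]
  rw [h, norm_iFD_smul (g := fun w => ψ (x + w)) ((ψ.smooth ⊤).comp (by fun_prop)), iteratedFDeriv_comp_add_left]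
  simp [sub_eq_add_neg]

lemma QQ_shift {n : ℕ} (m : ℕ) (b : Sch n) (x : Rn n) :
    QQ m (shiftReflect b x) ≤ 2 ^ m * (1 + ‖x‖) ^ m * QQ m b := by
  refine QQ_le (mul_nonneg (by positivity) (QQ_nonneg _ _)) fun k l hk hl y => ?_
  rw [norm_iFD_shift]
  have h1 : ‖y‖ ^ k ≤ (1 + ‖x‖) ^ k * (1 + ‖x - y‖) ^ k := by
    rw [← mul_pow]
    refine pow_le_pow_left₀ (norm_nonneg _) ?_ k
    have : ‖y‖ ≤ ‖x‖ + ‖x - y‖ := by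
      calc ‖y‖ = ‖x - (x - y)‖ := by congr 1; abel
        _ ≤ _ := norm_sub_le _ _
    nlinarith [norm_nonneg x, norm_nonneg (x - y), mul_nonneg (norm_nonneg x) (norm_nonneg (x - y))]
  calc _ ≤ ((1 + ‖x‖) ^ k * (1 + ‖x - y‖) ^ k) * ‖iteratedFDeriv ℝ l b (x - y)‖ :=
        mul_le_mul_of_nonneg_right h1 (norm_nonneg _)
    _ = (1 + ‖x‖) ^ k * ((1 + ‖x - y‖) ^ k * ‖iteratedFDeriv ℝ l b (x - y)‖) := by ring
    _ ≤ (1 + ‖x‖) ^ m * (2 ^ m * QQ m b) := by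
        refine mul_le_mul (pow_le_pow_right₀ (by linarith [norm_nonneg x]) hk) (le_QQ hk hl b _) (by positivity) (by positivity)
    _ = _ := by ring

section
variable {n : ℕ} {E : Type*} [NormedAddCommGroup E] [NormedSpace ℂ E]

lemma shiftReflect_add (a b : Sch n) (x : Rn n) : shiftReflect (a + b) x = shiftReflect a x + shiftReflect b x := by
  ext y; rfl

lemma invFourierS_add (a b : Sch n) : invFourierS (a + b) = invFourierS a + invFourierS b := map_add _ _ _

lemma mOp_add (a b : Sch n) (f : TDist n E) (x : Rn n) : mOp (a + b) f x = mOp a f x + mOp b f x := by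
  unfold mOp tdConv
  rw [invFourierS_add, shiftReflect_add, map_add, smul_add]

/-- additive hom in the multiplier -/
def mOpH (f : TDist n E) (x : Rn n) : Sch n →+ E where
  toFun φ := mOp φ f x
  map_add' a b := mOp_add a b f x
  map_zero' := by
    have := mOp_add 0 0 f x
    rw [add_zero] at this
    exact left_eq_add.mp this

lemma mOp_bound (f : TDist n E) : ∃ (m : ℕ) (C : ℝ), 0 ≤ C ∧ ∀ φ x, ‖mOp φ f x‖ ≤ C * (1 + ‖x‖) ^ m * QQ m φ := by
  obtain ⟨m, C, hC, h⟩ := T_bound f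
  obtain ⟨m', C', hC', h'⟩ := clm_QQ ((FourierTransform.fourierCLE ℂ (Sch n)).symm : Sch n →L[ℂ] Sch n) m
  set cc : ℝ := (2 * π) ^ (-(n : ℝ) / 2)
  have hcc : 0 ≤ cc := by positivity
  refine ⟨max m m', cc * (C * (2 ^ m * C')), by positivity, fun φ x => ?_⟩
  have h1 : ‖mOp φ f x‖ = cc * ‖f.toFun (shiftReflect (invFourierS φ) x)‖ := by
    unfold mOp tdConv; rw [norm_smul, Real.norm_of_nonneg hcc]
  rw [h1, mul_assoc, mul_assoc]
  refine mul_le_mul_of_nonneg_left ?_ hcc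
  refine (h _).trans ?_
  rw [mul_assoc]
  refine mul_le_mul_of_nonneg_left ((QQ_shift _ _ _).trans ?_) hC
  calc _ ≤ 2 ^ m * (1 + ‖x‖) ^ m * (C' * QQ m' φ) := mul_le_mul_of_nonneg_left (h' φ) (by positivity)
    _ ≤ 2 ^ m * (1 + ‖x‖) ^ (max m m') * (C' * QQ (max m m') φ) := by
        refine mul_le_mul ?_ (mul_le_mul_of_nonneg_left (QQ_mono (le_max_right _ _) _) hC') (mul_nonneg hC' (QQ_nonneg _ _)) (by positivity)
        exact mul_le_mul_of_nonneg_left (pow_le_pow_right₀ (by linarith [norm_nonneg x]) (le_max_left _ _)) (by positivity)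
    _ = _ := by ring

lemma mOp_tendsto (f : TDist n E) (x : Rn n) {g : ℕ → Sch n} {h : Sch n}
    (H : ∀ m, Tendsto (fun J => QQ m (g J - h)) atTop (𝓝 0)) :
    Tendsto (fun J => mOp (g J) f x) atTop (𝓝 (mOp h f x)) := by
  obtain ⟨m, C, hC, hb⟩ := mOp_bound f
  rw [tendsto_iff_norm_sub_tendsto_zero]
  refine squeeze_zero (fun _ => norm_nonneg _) (fun J => ?_) (by simpa using (H m).const_mul (C * (1 + ‖x‖) ^ m))
  have : mOp (g J) f x - mOp h f x = mOp (g J - h) f x := ((mOpH f x).map_sub (g J) h).symm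
  rw [this]; exact hb _ _
end

/-- product of Schwartz functions -/
def mulS {n : ℕ} (a b : Sch n) : Sch n := SchwartzMap.pairing (ContinuousLinearMap.mul ℂ ℂ) a b

lemma mulS_apply {n : ℕ} (a b : Sch n) (x : Rn n) : mulS a b x = a x * b x := by
  unfold mulS; rw [SchwartzMap.pairing_apply_apply]; rfl

end TL

namespace TL
open scoped LineDeriv

lemma iFD_shift {n : ℕ} (ψ : Sch n) (x : Rn n) (l : ℕ) (y : Rn n) :
    iteratedFDeriv ℝ l (shiftReflect ψ x) y = ((-1:ℝ) ^ l) • iteratedFDeriv ℝ l ψ (x - y) := by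
  have h : (⇑(shiftReflect ψ x)) = fun z => (fun w => ψ (x + w)) ((-1:ℝ) • z) := by
    ext z; rw [shiftReflect_apply]; simp [sub_eq_add_neg]
  rw [h, iteratedFDeriv_comp_const_smul (f := fun w => ψ (x + w)) (-1) (((ψ.smooth ⊤).comp (by fun_prop)).of_le (by exact_mod_cast le_top))]
  beta_reduce
  rw [iteratedFDeriv_comp_add_left]
  simp [sub_eq_add_neg]

lemma QQ_shift_sub {n : ℕ} (m : ℕ) (b : Sch n) (y y0 : Rn n) (hy : ‖y - y0‖ ≤ 1) :
    QQ m (shiftReflect b y - shiftReflect b y0) ≤ ‖y - y0‖ * ((2 + ‖y0‖) ^ m * (2 ^ (m+1) * QQ (m+1) b)) := by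
  have hQ := QQ_nonneg (m+1) b
  refine QQ_le (by positivity) fun k l hk hl z => ?_
  have e : iteratedFDeriv ℝ l (shiftReflect b y - shiftReflect b y0) z =
      ((-1:ℝ) ^ l) • (iteratedFDeriv ℝ l b (y - z) - iteratedFDeriv ℝ l b (y0 - z)) := by
    have : (⇑(shiftReflect b y - shiftReflect b y0)) = ⇑(shiftReflect b y) - ⇑(shiftReflect b y0) := rfl
    rw [this, iteratedFDeriv_sub_apply ((shiftReflect b y).contDiffAt l) ((shiftReflect b y0).contDiffAt l), iFD_shift, iFD_shift, smul_sub]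
  have hseg : ∀ ζ ∈ segment ℝ (y0 - z) (y - z), ‖fderiv ℝ (iteratedFDeriv ℝ l b) ζ‖ * ‖z‖ ^ k ≤ (2 + ‖y0‖) ^ m * (2 ^ (m+1) * QQ (m+1) b) := by
    intro ζ hζ
    rw [norm_fderiv_iteratedFDeriv]
    have h1 : ‖ζ - (y0 - z)‖ ≤ 1 := by
      have := (convex_closedBall (y0 - z) 1).segment_subset (mem_closedBall_self zero_le_one) (y := y - z) (by rw [mem_closedBall, dist_eq_norm]; simpa using hy) hζ
      rwa [mem_closedBall, dist_eq_norm] at this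
    have h2 : ‖z‖ ≤ ‖ζ‖ + ‖y0‖ + 1 := by
      calc ‖z‖ = ‖(ζ - (y0 - z)) - ζ + y0‖ := by congr 1; abel
        _ ≤ ‖(ζ - (y0 - z)) - ζ‖ + ‖y0‖ := norm_add_le _ _
        _ ≤ ‖ζ - (y0 - z)‖ + ‖ζ‖ + ‖y0‖ := by gcongr; exact norm_sub_le _ _
        _ ≤ _ := by linarith
    have h3 : ‖z‖ ^ k ≤ (2 + ‖y0‖) ^ m * (1 + ‖ζ‖) ^ k := by
      calc ‖z‖ ^ k ≤ ((2 + ‖y0‖) * (1 + ‖ζ‖)) ^ k := by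
            refine pow_le_pow_left₀ (norm_nonneg _) (h2.trans ?_) k
            nlinarith [norm_nonneg ζ, norm_nonneg y0, mul_nonneg (norm_nonneg ζ) (norm_nonneg y0)]
        _ = (2 + ‖y0‖) ^ k * (1 + ‖ζ‖) ^ k := mul_pow _ _ _
        _ ≤ _ := by
            refine mul_le_mul_of_nonneg_right (pow_le_pow_right₀ (by linarith [norm_nonneg y0]) hk) (by positivity)
    calc _ ≤ ‖iteratedFDeriv ℝ (l+1) b ζ‖ * ((2 + ‖y0‖) ^ m * (1 + ‖ζ‖) ^ k) := mul_le_mul_of_nonneg_left h3 (norm_nonneg _)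
      _ = (2 + ‖y0‖) ^ m * ((1 + ‖ζ‖) ^ k * ‖iteratedFDeriv ℝ (l+1) b ζ‖) := by ring
      _ ≤ _ := mul_le_mul_of_nonneg_left (le_QQ (by omega) (by omega) b ζ) (by positivity)
  rw [e, norm_smul, norm_pow, norm_neg, norm_one, one_pow, one_mul]
  have hd : Differentiable ℝ (iteratedFDeriv ℝ l b) :=
    (b.smooth ⊤).differentiable_iteratedFDeriv (by exact_mod_cast WithTop.coe_lt_top l)
  by_cases hz : ‖z‖ ^ k = 0
  · rw [hz, zero_mul]; positivity
  have hz' : 0 < ‖z‖ ^ k := lt_of_le_of_ne (by positivity) (Ne.symm hz)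
  have := (convex_segment (𝕜 := ℝ) (y0 - z) (y - z)).norm_image_sub_le_of_norm_fderiv_le (𝕜 := ℝ) (f := iteratedFDeriv ℝ l b)
    (C := ((2 + ‖y0‖) ^ m * (2 ^ (m+1) * QQ (m+1) b)) / ‖z‖ ^ k) (fun ζ _ => hd ζ)
    (fun ζ hζ => (le_div_iff₀ hz').mpr (hseg ζ hζ)) (left_mem_segment ℝ _ _) (right_mem_segment ℝ _ _)
  rw [sub_sub_sub_cancel_right] at this
  calc _ ≤ ‖z‖ ^ k * (((2 + ‖y0‖) ^ m * (2 ^ (m+1) * QQ (m+1) b)) / ‖z‖ ^ k * ‖y - y0‖) := mul_le_mul_of_nonneg_left this hz'.le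
    _ = _ := by field_simp

lemma QQ_shift_tendsto {n : ℕ} (m : ℕ) (b : Sch n) (y0 : Rn n) :
    Tendsto (fun y => QQ m (shiftReflect b y - shiftReflect b y0)) (𝓝 y0) (𝓝 0) := by
  have h : Tendsto (fun y => ‖y - y0‖ * ((2 + ‖y0‖) ^ m * (2 ^ (m+1) * QQ (m+1) b))) (𝓝 y0) (𝓝 0) := by
    have : Continuous fun y : Rn n => ‖y - y0‖ * ((2 + ‖y0‖) ^ m * (2 ^ (m+1) * QQ (m+1) b)) := by fun_prop
    simpa using this.tendsto y0
  refine squeeze_zero' (Eventually.of_forall fun _ => QQ_nonneg _ _) ?_ h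
  filter_upwards [Metric.closedBall_mem_nhds y0 one_pos] with y hy
  exact QQ_shift_sub m b y y0 (by rwa [mem_closedBall, dist_eq_norm] at hy)

lemma mOp_continuous {n : ℕ} {E : Type*} [NormedAddCommGroup E] [NormedSpace ℂ E] (φ : Sch n) (f : TDist n E) :
    Continuous (mOp φ f) := by
  obtain ⟨m, C, hC, h⟩ := T_bound f
  refine Continuous.const_smul ?_ _
  rw [continuous_iff_continuousAt]
  intro y0
  rw [ContinuousAt, tendsto_iff_norm_sub_tendsto_zero]
  refine squeeze_zero (fun _ => norm_nonneg _) (fun y => ?_) (by simpa using (QQ_shift_tendsto m (invFourierS φ) y0).const_mul C)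
  rw [← map_sub]; exact h _

/-- Schwartz convolution -/
def convS {n : ℕ} (a b : Sch n) : Sch n := SchwartzMap.convolution (ContinuousLinearMap.mul ℂ ℂ) a b

lemma inv_mulS {n : ℕ} (a b : Sch n) : invFourierS (mulS a b) = convS (invFourierS a) (invFourierS b) := by
  have h : ∀ c : Sch n, 𝓕 (invFourierS c) = c := fun c => (FourierTransform.fourierCLE ℂ (Sch n)).apply_symm_apply c
  change _ = 𝓕⁻ (SchwartzMap.pairing (ContinuousLinearMap.mul ℂ ℂ) (𝓕 (invFourierS a)) (𝓕 (invFourierS b)))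
  rw [h, h]; rfl

lemma convS_lineDeriv {n : ℕ} (a b : Sch n) (v : Rn n) : ∂_{v} (convS a b) = convS a (∂_{v} b) := by
  change ∂_{v} (𝓕⁻ (SchwartzMap.pairing (ContinuousLinearMap.mul ℂ ℂ) (𝓕 a) (𝓕 b))) =
    𝓕⁻ (SchwartzMap.pairing (ContinuousLinearMap.mul ℂ ℂ) (𝓕 a) (𝓕 (∂_{v} b)))
  rw [SchwartzMap.lineDerivOp_fourierInv_eq, SchwartzMap.fourier_lineDerivOp_eq]
  congr 1
  have : (fun w : Rn n => inner ℝ w v).HasTemperateGrowth := by fun_prop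
  ext ξ
  simp [SchwartzMap.smulLeftCLM_apply_apply this, SchwartzMap.pairing_apply_apply]
  ring

lemma convS_iter {n : ℕ} (a b : Sch n) (l : ℕ) (v : Fin l → Rn n) : ∂^{v} (convS a b) = convS a (∂^{v} b) := by
  induction l with
  | zero => rfl
  | succ l ih =>
    rw [LineDeriv.iteratedLineDerivOp_succ_left, LineDeriv.iteratedLineDerivOp_succ_left, ih, convS_lineDeriv]

lemma convS_apply {n : ℕ} (a b : Sch n) (x z : Rn n) : convS a b (x - z) = ∫ y, a (x - y) * b (y - z) := by
  unfold convS
  rw [SchwartzMap.convolution_apply]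
  unfold MeasureTheory.convolution
  rw [← integral_sub_left_eq_self _ _ x]
  refine integral_congr_ae (Eventually.of_forall fun y => ?_)
  simp only [ContinuousLinearMap.mul_apply']
  congr 2; abel

end TL

namespace TL
open scoped LineDeriv BoundedContinuousFunction

/-- Banach space of weighted jets -/
def VF (n m : ℕ) (i : Fin (m+1) × Fin (m+1)) : Type := Rn n →ᵇ (ContinuousMultilinearMap ℝ (fun _ : Fin (i.2:ℕ) => Rn n) ℂ)

instance (n m : ℕ) (i : Fin (m+1) × Fin (m+1)) : NormedAddCommGroup (VF n m i) :=
  inferInstanceAs (NormedAddCommGroup (Rn n →ᵇ (ContinuousMultilinearMap ℝ (fun _ : Fin (i.2:ℕ) => Rn n) ℂ)))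

instance (n m : ℕ) (i : Fin (m+1) × Fin (m+1)) : NormedSpace ℂ (VF n m i) :=
  inferInstanceAs (NormedSpace ℂ (Rn n →ᵇ (ContinuousMultilinearMap ℝ (fun _ : Fin (i.2:ℕ) => Rn n) ℂ)))

instance (n m : ℕ) (i : Fin (m+1) × Fin (m+1)) : CompleteSpace (VF n m i) :=
  inferInstanceAs (CompleteSpace (Rn n →ᵇ (ContinuousMultilinearMap ℝ (fun _ : Fin (i.2:ℕ) => Rn n) ℂ)))

/-- Banach space of weighted jets -/
abbrev VV (n m : ℕ) : Type := ∀ i : Fin (m+1) × Fin (m+1), VF n m i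

lemma jet_bd {n m : ℕ} (φ : Sch n) (i : Fin (m+1) × Fin (m+1)) (z : Rn n) :
    ‖((‖z‖:ℝ) ^ (i.1:ℕ)) • iteratedFDeriv ℝ (i.2:ℕ) φ z‖ ≤ 2 ^ m * QQ m φ := by
  rw [norm_smul, norm_pow, norm_norm]
  refine le_trans ?_ (le_QQ (Nat.lt_succ_iff.mp i.1.2) (Nat.lt_succ_iff.mp i.2.2) φ z)
  gcongr; linarith

def jet {n : ℕ} (m : ℕ) : Sch n →ₗ[ℂ] VV n m where
  toFun φ := fun i => show (Rn n →ᵇ (ContinuousMultilinearMap ℝ (fun _ : Fin (i.2:ℕ) => Rn n) ℂ)) from BoundedContinuousFunction.ofNormedAddCommGroup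
    (fun z => ((‖z‖:ℝ) ^ (i.1:ℕ)) • iteratedFDeriv ℝ (i.2:ℕ) φ z)
    ((continuous_norm.pow _).smul ((φ.smooth ⊤).continuous_iteratedFDeriv (by exact_mod_cast le_top)))
    (2 ^ m * QQ m φ) (jet_bd φ i)
  map_add' a b := by
    funext i
    refine BoundedContinuousFunction.ext fun z => ContinuousMultilinearMap.ext fun v => ?_
    have : (⇑(a + b)) = ⇑a + ⇑b := rfl
    change ((‖z‖:ℝ) ^ (i.1:ℕ)) • iteratedFDeriv ℝ (i.2:ℕ) (⇑(a+b)) z v = ((‖z‖:ℝ) ^ (i.1:ℕ)) • iteratedFDeriv ℝ (i.2:ℕ) a z v + ((‖z‖:ℝ) ^ (i.1:ℕ)) • iteratedFDeriv ℝ (i.2:ℕ) b z v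
    simp [this, iteratedFDeriv_add_apply (a.contDiffAt (i.2:ℕ)) (b.contDiffAt (i.2:ℕ)), smul_add]
  map_smul' c a := by
    funext i
    refine BoundedContinuousFunction.ext fun z => ContinuousMultilinearMap.ext fun v => ?_
    have : (⇑(c • a)) = c • ⇑a := rfl
    change ((‖z‖:ℝ) ^ (i.1:ℕ)) • iteratedFDeriv ℝ (i.2:ℕ) (⇑(c•a)) z v = c * ((‖z‖:ℝ) ^ (i.1:ℕ)) • iteratedFDeriv ℝ (i.2:ℕ) a z v
    simp [this, iteratedFDeriv_const_smul_apply (a.contDiffAt (i.2:ℕ))]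
    ring

lemma jet_apply {n m : ℕ} (φ : Sch n) (i : Fin (m+1) × Fin (m+1)) (z : Rn n) :
    (show (Rn n →ᵇ (ContinuousMultilinearMap ℝ (fun _ : Fin (i.2:ℕ) => Rn n) ℂ)) from jet m φ i) z = ((‖z‖:ℝ) ^ (i.1:ℕ)) • iteratedFDeriv ℝ (i.2:ℕ) φ z := rfl

lemma jet_norm_le {n m : ℕ} (φ : Sch n) : ‖jet m φ‖ ≤ 2 ^ m * QQ m φ := by
  have : 0 ≤ 2 ^ m * QQ m φ := mul_nonneg (by positivity) (QQ_nonneg _ _)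
  exact (pi_norm_le_iff_of_nonneg this).mpr fun i =>
    (BoundedContinuousFunction.norm_le this).mpr (jet_bd φ i)

lemma le_jet_norm {n m : ℕ} (φ : Sch n) : QQ m φ ≤ ‖jet m φ‖ := by
  refine QQ_le (norm_nonneg _) fun k l hk hl x => ?_
  have h1 := BoundedContinuousFunction.norm_coe_le_norm (show (Rn n →ᵇ (ContinuousMultilinearMap ℝ (fun _ : Fin l => Rn n) ℂ)) from ((jet m φ) (⟨k, by omega⟩, ⟨l, by omega⟩))) x
  have h2 := norm_le_pi_norm (jet m φ) (⟨k, by omega⟩, ⟨l, by omega⟩)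
  change ‖(‖x‖ ^ k) • iteratedFDeriv ℝ l φ x‖ ≤ _ at h1
  rw [norm_smul, norm_pow, norm_norm] at h1
  exact h1.trans h2

lemma jet_inj {n : ℕ} (m : ℕ) : Function.Injective (jet (n := n) m) := by
  rw [injective_iff_map_eq_zero]
  intro φ h
  ext x
  have h1 := le_QQ0 (Nat.zero_le m) φ x
  have h2 := le_jet_norm (m := m) φ
  rw [h, norm_zero] at h2
  have h3 := QQ_nonneg m φ
  have : QQ m φ = 0 := le_antisymm h2 h3
  rw [this, mul_zero, pow_zero, one_mul] at h1
  simpa using h1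

lemma ext_jet {n : ℕ} (m : ℕ) (ℓ : Sch n →ₗ[ℂ] ℂ) (C : ℝ) (hC : 0 ≤ C) (h : ∀ φ, ‖ℓ φ‖ ≤ C * QQ m φ) :
    ∃ g : VV n m →L[ℂ] ℂ, ∀ φ, g (jet m φ) = ℓ φ := by
  let e := LinearEquiv.ofInjective (jet (n := n) m) (jet_inj m)
  let f : (LinearMap.range (jet (n := n) m)) →L[ℂ] ℂ := LinearMap.mkContinuous (ℓ ∘ₗ e.symm.toLinearMap) C (by
    intro v
    obtain ⟨φ, rfl⟩ := e.surjective v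
    simp only [LinearMap.comp_apply, LinearEquiv.coe_coe, LinearEquiv.symm_apply_apply]
    exact (h φ).trans (mul_le_mul_of_nonneg_left (le_jet_norm φ) hC))
  obtain ⟨g, hg, -⟩ := exists_extension_norm_eq (LinearMap.range (jet (n := n) m)) f
  refine ⟨g, fun φ => ?_⟩
  have := hg (e φ)
  have h2 : f (e φ) = ℓ φ := by
    change ℓ (e.symm (e φ)) = _
    rw [LinearEquiv.symm_apply_apply]
  rw [← h2, ← this]; rfl

lemma jet_cont {n m : ℕ} (b : Sch n) : Continuous fun y => jet m (shiftReflect b y) := by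
  rw [continuous_iff_continuousAt]
  intro y0
  rw [ContinuousAt, tendsto_iff_norm_sub_tendsto_zero]
  refine squeeze_zero (fun _ => norm_nonneg _) (fun y => ?_) (by simpa using (QQ_shift_tendsto m b y0).const_mul (2 ^ m))
  rw [← map_sub]; exact jet_norm_le _

lemma jet_integrable {n m : ℕ} (a b : Sch n) (x : Rn n) :
    Integrable (fun y => a (x - y) • jet m (shiftReflect b y)) := by
  have hc : Continuous (fun y => a (x - y) • jet m (shiftReflect b y)) :=
    (a.continuous.comp (by fun_prop)).smul (jet_cont b)
  have hi : Integrable (fun y : Rn n => (1 + ‖y‖) ^ (-((n:ℝ)+1))) := by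
    apply integrable_one_add_norm; simp
  have h0 := QQ_nonneg m b
  have h1 := QQ_nonneg (n+1+m) (shiftReflect a x)
  refine (hi.const_mul (2 ^ (n+1+m) * QQ (n+1+m) (shiftReflect a x) * (2 ^ m * (2 ^ m * QQ m b)))).mono' hc.aestronglyMeasurable (Eventually.of_forall fun y => ?_)
  rw [norm_smul]
  have e1 := le_QQ0 (le_refl _) (shiftReflect a x) y (m := n+1+m)
  rw [shiftReflect_apply, pow_add] at e1
  have e2 : ‖jet m (shiftReflect b y)‖ ≤ 2 ^ m * (2 ^ m * (1 + ‖y‖) ^ m * QQ m b) :=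
    (jet_norm_le _).trans (mul_le_mul_of_nonneg_left (QQ_shift m b y) (by positivity))
  have e3 : (1 + ‖y‖) ^ (-((n:ℝ)+1)) = ((1 + ‖y‖) ^ (n+1))⁻¹ := by
    rw [Real.rpow_neg (by positivity)]; congr 1; exact_mod_cast Real.rpow_natCast _ (n+1)
  rw [e3, ← div_eq_mul_inv, le_div_iff₀ (by positivity)]
  calc _ ≤ ‖a (x - y)‖ * (2 ^ m * (2 ^ m * (1 + ‖y‖) ^ m * QQ m b)) * (1 + ‖y‖) ^ (n+1) := by gcongr
    _ = ((1 + ‖y‖) ^ (n+1) * (1 + ‖y‖) ^ m * ‖a (x - y)‖) * (2 ^ m * (2 ^ m * QQ m b)) := by ring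
    _ ≤ _ := by gcongr

lemma shift_iter {n : ℕ} (b : Sch n) (y z : Rn n) (l : ℕ) (v : Fin l → Rn n) :
    iteratedFDeriv ℝ l (shiftReflect b y) z v = ((-1:ℝ) ^ l) • (∂^{v} b) (y - z) := by
  rw [iFD_shift, SchwartzMap.iteratedLineDerivOp_eq_iteratedFDeriv]; rfl

lemma jet_integral {n m : ℕ} (a b : Sch n) (x : Rn n) :
    ∫ y, a (x - y) • jet m (shiftReflect b y) = jet m (shiftReflect (convS a b) x) := by
  funext i
  refine BoundedContinuousFunction.ext fun z => ContinuousMultilinearMap.ext fun v => ?_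
  let ev : VV n m →L[ℝ] ℂ := (show VF n m i →L[ℝ] ℂ from (ContinuousMultilinearMap.apply ℝ (fun _ : Fin (i.2:ℕ) => Rn n) ℂ v).comp
    (BoundedContinuousFunction.evalCLM ℝ z)).comp (ContinuousLinearMap.proj (R := ℝ) (φ := fun i : Fin (m+1) × Fin (m+1) => VF n m i) i)
  change ev (∫ y, a (x - y) • jet m (shiftReflect b y)) = ev (jet m (shiftReflect (convS a b) x))
  rw [← ev.integral_comp_comm (jet_integrable a b x)]
  have h2 : ev (jet m (shiftReflect (convS a b) x)) = ((‖z‖:ℝ) ^ (i.1:ℕ)) • ((-1:ℝ) ^ (i.2:ℕ)) • (convS a (∂^{v} b)) (x - z) := by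
    rw [← convS_iter, ← shift_iter]; rfl
  have h3 : ∀ y, ev (a (x - y) • jet m (shiftReflect b y)) = ((‖z‖:ℝ) ^ (i.1:ℕ)) • ((-1:ℝ) ^ (i.2:ℕ)) • (a (x - y) * (∂^{v} b) (y - z)) := by
    intro y
    have : ev (a (x - y) • jet m (shiftReflect b y)) = a (x - y) * (((‖z‖:ℝ) ^ (i.1:ℕ)) • iteratedFDeriv ℝ (i.2:ℕ) (shiftReflect b y) z v) := rfl
    rw [this, shift_iter]
    simp only [Complex.real_smul]; ring
  simp_rw [h3]
  rw [integral_smul, integral_smul, h2, convS_apply]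

lemma mOp_mulS_le {n : ℕ} {E : Type*} [NormedAddCommGroup E] [NormedSpace ℂ E] (φ1 φ2 : Sch n) (f : TDist n E) (x : Rn n) :
    ‖mOp (mulS φ1 φ2) f x‖ₑ ≤ ∫⁻ y, ‖invFourierS φ1 (x - y)‖ₑ * ‖mOp φ2 f y‖ₑ := by
  obtain ⟨m, C, hC, hT⟩ := T_bound f
  obtain ⟨e, he1, he2⟩ := exists_dual_vector'' ℂ (mOp (mulS φ1 φ2) f x)
  obtain ⟨g, hg⟩ := ext_jet m (e.toLinearMap ∘ₗ f.toFun) C hC (fun φ => by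
    refine (e.le_opNorm _).trans ?_
    calc _ ≤ 1 * ‖f.toFun φ‖ := by gcongr
      _ ≤ _ := by rw [one_mul]; exact hT φ)
  set c : ℝ := (2 * π) ^ (-(n : ℝ) / 2) with hc
  have key : ∀ ψ : Sch n, ∀ y, e (mOp ψ f y) = c • g (jet m (shiftReflect (invFourierS ψ) y)) := by
    intro ψ y
    rw [hg]; unfold mOp tdConv
    exact e.map_smul_of_tower c _
  have h1 : e (mOp (mulS φ1 φ2) f x) = ∫ y, invFourierS φ1 (x - y) * e (mOp φ2 f y) := by
    rw [key, inv_mulS, ← jet_integral, ← g.integral_comp_comm (jet_integrable _ _ x), ← integral_smul]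
    refine integral_congr_ae (Eventually.of_forall fun y => ?_)
    simp only [map_smul, key, smul_eq_mul, Complex.real_smul]; ring
  have h2 : ‖mOp (mulS φ1 φ2) f x‖ₑ = ‖e (mOp (mulS φ1 φ2) f x)‖ₑ := by
    rw [he2]; simp [enorm_eq_nnnorm]
  rw [h2, h1]
  refine (enorm_integral_le_lintegral_enorm _).trans (lintegral_mono fun y => ?_)
  rw [enorm_mul]
  gcongr
  have : ‖e (mOp φ2 f y)‖ ≤ ‖mOp φ2 f y‖ := by
    refine (e.le_opNorm _).trans ?_
    calc _ ≤ 1 * ‖mOp φ2 f y‖ := by gcongr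
      _ = _ := one_mul _
  exact enorm_le_iff_norm_le.mpr this

end TL

namespace TL

lemma iFD_mul_le {n : ℕ} {a b : Rn n → ℂ} (ha : ContDiff ℝ (⊤ : ℕ∞) a) (hb : ContDiff ℝ (⊤ : ℕ∞) b) (l : ℕ) (x : Rn n)
    {A B : ℝ} (hA : ∀ i ≤ l, ‖iteratedFDeriv ℝ i a x‖ ≤ A) (hB : ∀ i ≤ l, ‖iteratedFDeriv ℝ i b x‖ ≤ B) :
    ‖iteratedFDeriv ℝ l (fun y => a y * b y) x‖ ≤ 2 ^ l * (A * B) := by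
  have hA0 : 0 ≤ A := (norm_nonneg _).trans (hA 0 (Nat.zero_le _))
  refine (norm_iteratedFDeriv_mul_le ha hb x (by exact_mod_cast le_top)).trans ?_
  calc _ ≤ ∑ i ∈ Finset.range (l+1), (l.choose i : ℝ) * (A * B) := by
        refine Finset.sum_le_sum fun i hi => ?_
        rw [mul_assoc]
        have := Finset.mem_range.mp hi
        have h1 := hA i (by omega)
        have h2 := hB (l - i) (by omega)
        gcongr
    _ = _ := by
        rw [← Finset.sum_mul]
        congr 1
        exact_mod_cast Nat.sum_range_choose l

lemma inv_dilate {n : ℕ} (M : Sch n) (k : ℕ) (z : Rn n) :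
    invFourierS (dilate M ((2:ℝ)^k)⁻¹) z = ((2:ℝ) ^ (k * n)) • invFourierS M (((2:ℝ)^k) • z) := by
  have h0 : ((2:ℝ)^k)⁻¹ ≠ 0 := by positivity
  have e : ∀ (g : Sch n) (w : Rn n), invFourierS g w = ∫ v, Complex.exp ((↑(2 * π * inner ℝ v w) * Complex.I)) • g v := by
    intro g w
    rw [← Real.fourierInv_eq', ← SchwartzMap.fourierInv_coe]; rfl
  rw [e, e]
  have := Measure.integral_comp_smul (volume : Measure (Rn n)) (fun v : Rn n => Complex.exp ((↑(2 * π * inner ℝ v ((2:ℝ)^k • z)) * Complex.I)) • M v) ((2:ℝ)^k)⁻¹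
  rw [show ((2:ℝ) ^ (k * n)) = |((((2:ℝ)^k)⁻¹) ^ (Module.finrank ℝ (Rn n)))⁻¹| by
    rw [abs_of_nonneg (by positivity), finrank_euclideanSpace_fin, inv_pow, inv_inv, pow_mul], ← this]
  refine integral_congr_ae (Eventually.of_forall fun v => ?_)
  simp only [dilate_apply M h0]
  congr 5
  rw [inner_smul_left, inner_smul_right]
  simp

lemma kern_bd (n N : ℕ) : ∃ (m : ℕ) (C : ℝ), 0 ≤ C ∧ ∀ (M : Sch n) (k : ℕ) (z : Rn n),
    ‖invFourierS (dilate M ((2:ℝ)^k)⁻¹) z‖ₑ ≤ ENNReal.ofReal (C * QQ m M) * ker k N z := by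
  obtain ⟨m, C, hC, h⟩ := clm_QQ (n := n) ((FourierTransform.fourierCLE ℂ (Sch n)).symm : Sch n →L[ℂ] Sch n) N
  refine ⟨m, 2 ^ N * C, by positivity, fun M k z => ?_⟩
  have hQ := QQ_nonneg m M
  unfold ker
  rw [← ENNReal.ofReal_mul (by positivity), inv_dilate, ← ofReal_norm, norm_smul, Real.norm_of_nonneg (by positivity)]
  refine ENNReal.ofReal_le_ofReal ?_
  have h1 := le_QQ0 (le_refl N) (invFourierS M) ((2:ℝ)^k • z)
  rw [norm_smul, Real.norm_of_nonneg (by positivity)] at h1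
  have h2 : QQ N (invFourierS M) ≤ C * QQ m M := h M
  rw [← mul_assoc, mul_comm _ ((2:ℝ)^(k*n)), mul_assoc]
  refine mul_le_mul_of_nonneg_left ?_ (by positivity)
  rw [← div_eq_mul_inv, le_div_iff₀ (by positivity), mul_comm]
  refine h1.trans ?_
  rw [mul_assoc]; gcongr

lemma master (n N : ℕ) : ∃ (m : ℕ) (C : ℝ), 0 ≤ C ∧
    ∀ (E : Type*) [NormedAddCommGroup E] [NormedSpace ℂ E] (f : TDist n E) (x : Rn n) (M b : ℕ → Sch n) (A : ℕ → ℝ) (h : Sch n),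
    (∀ k, QQ m (M k) ≤ A k) →
    (∀ m', Tendsto (fun J => QQ m' ((∑ k ∈ Finset.range J, mulS (dilate (M k) ((2:ℝ)^k)⁻¹) (b k)) - h)) atTop (𝓝 0)) →
    ‖mOp h f x‖ₑ ≤ ENNReal.ofReal C * ∑' k, ENNReal.ofReal (A k) * ∫⁻ y, ker k N (x - y) * ‖mOp (b k) f y‖ₑ := by
  obtain ⟨m, C, hC, hk⟩ := kern_bd n N
  refine ⟨m, C, hC, fun E _ _ f x M b A h hA hT => ?_⟩
  have ht := (mOp_tendsto f x hT).enorm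
  refine le_of_tendsto' ht fun J => ?_
  have e : mOp (∑ k ∈ Finset.range J, mulS (dilate (M k) ((2:ℝ)^k)⁻¹) (b k)) f x =
      ∑ k ∈ Finset.range J, mOp (mulS (dilate (M k) ((2:ℝ)^k)⁻¹) (b k)) f x := map_sum (mOpH f x) _ _
  rw [e]
  refine (enorm_sum_le _ _).trans ?_
  rw [← ENNReal.tsum_mul_left]
  refine le_trans ?_ (ENNReal.sum_le_tsum (Finset.range J))
  refine Finset.sum_le_sum fun k _ => (mOp_mulS_le _ _ f x).trans ?_
  rw [← mul_assoc, ← ENNReal.ofReal_mul hC, ← lintegral_const_mul' _ _ ENNReal.ofReal_ne_top]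
  refine lintegral_mono fun y => ?_
  rw [← mul_assoc]
  have h1 := hk (M k) k (x - y)
  have h2 := hA k
  refine mul_le_mul_left ?_ _
  refine h1.trans (mul_le_mul_left ?_ _)
  exact ENNReal.ofReal_le_ofReal (mul_le_mul_of_nonneg_left h2 hC)

/-- cutoff sequences -/
structure Cut {n : ℕ} (G : ℕ → Rn n → ℂ) : Prop where
  smooth : ∀ J, ContDiff ℝ (⊤ : ℕ∞) (G J)
  one : ∃ c > (0:ℝ), ∀ J, 1 ≤ J → ∀ ξ, ‖ξ‖ < c * 2 ^ J → G J ξ = 1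
  bd : ∀ l, ∃ C : ℝ, ∀ J ξ, ‖iteratedFDeriv ℝ l (G J) ξ‖ ≤ C * (J + 1)

lemma uniform_bd {P : ℕ → ℝ → Prop} (hP : ∀ l C C', C ≤ C' → P l C → P l C') (h : ∀ l, ∃ C, P l C) (m : ℕ) :
    ∃ C : ℝ, 0 ≤ C ∧ ∀ l ≤ m, P l C := by
  choose C hC using h
  refine ⟨∑ l ∈ Finset.range (m+1), |C l|, Finset.sum_nonneg fun _ _ => abs_nonneg _, fun l hl => hP l (C l) _ ?_ (hC l)⟩
  exact (le_abs_self _).trans (Finset.single_le_sum (f := fun l => |C l|) (fun _ _ => abs_nonneg _) (Finset.mem_range.mpr (by omega)))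

lemma cut_tendsto {n : ℕ} {G : ℕ → Rn n → ℂ} (hG : Cut G) (h : Sch n) (H : ℕ → Sch n) (J0 : ℕ)
    (hH : ∀ J, J0 ≤ J → ∀ ξ, H J ξ = h ξ * G J ξ) (m : ℕ) :
    Tendsto (fun J => QQ m (H J - h)) atTop (𝓝 0) := by
  obtain ⟨c, hc, hone⟩ := hG.one
  obtain ⟨C, hC0, hC⟩ := uniform_bd (P := fun l C => ∀ J ξ, ‖iteratedFDeriv ℝ l (fun z => G J z - 1) ξ‖ ≤ C * (J + 1))
    (fun l C C' h1 h2 J ξ => (h2 J ξ).trans (by gcongr)) (fun l => by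
      obtain ⟨C, hC⟩ := hG.bd l
      refine ⟨C + 1, fun J ξ => ?_⟩
      have : iteratedFDeriv ℝ l (fun z => G J z - 1) ξ = iteratedFDeriv ℝ l (G J) ξ - iteratedFDeriv ℝ l (fun _ : Rn n => (1:ℂ)) ξ := by
        exact iteratedFDeriv_sub_apply ((hG.smooth J).contDiffAt.of_le (by exact_mod_cast le_top)) contDiffAt_const
      rw [this]
      refine (norm_sub_le _ _).trans ?_
      have h1 : ‖iteratedFDeriv ℝ l (fun _ : Rn n => (1:ℂ)) ξ‖ ≤ 1 := by
        rcases Nat.eq_zero_or_pos l with rfl | hl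
        · rw [norm_iteratedFDeriv_zero]; simp
        · rw [iteratedFDeriv_const_of_ne (by omega)]; simp
      have := hC J ξ
      have hJ : (0:ℝ) ≤ J := by positivity
      nlinarith) m
  set K : ℝ := 2 ^ m * (2 ^ (m+1) * QQ (m+1) h * C) / c with hK
  have hQ := QQ_nonneg (m+1) h
  have hlim : Tendsto (fun J : ℕ => K * (((J:ℝ) + 1) * (2 ^ J)⁻¹)) atTop (𝓝 0) := by
    have h1 : Tendsto (fun J : ℕ => (J:ℝ) ^ 1 / (2:ℝ) ^ J) atTop (𝓝 0) := tendsto_pow_const_div_const_pow_of_one_lt 1 one_lt_two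
    have h2 : Tendsto (fun J : ℕ => ((2:ℝ) ^ J)⁻¹) atTop (𝓝 0) := tendsto_inv_atTop_zero.comp (tendsto_pow_atTop_atTop_of_one_lt one_lt_two)
    have := (h1.add h2).const_mul K
    simp only [add_zero, mul_zero, pow_one] at this
    refine this.congr fun J => ?_
    rw [div_eq_mul_inv]; ring
  refine squeeze_zero' (Eventually.of_forall fun _ => QQ_nonneg _ _) ?_ hlim
  filter_upwards [eventually_ge_atTop J0, eventually_ge_atTop 1] with J hJ hJ1
  have hK0 : 0 ≤ K := by positivity
  refine QQ_le (by positivity) fun k l hk hl ξ => ?_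
  have hf : (⇑(H J - h)) = fun z => h z * (G J z - 1) := by
    ext z; rw [sub_apply, hH J hJ]; ring
  rw [hf]
  by_cases hξ : ‖ξ‖ < c * 2 ^ J
  · have : (fun z => h z * (G J z - 1)) =ᶠ[𝓝 ξ] fun _ => 0 := by
      have : {z : Rn n | ‖z‖ < c * 2 ^ J} ∈ 𝓝 ξ := (isOpen_lt continuous_norm continuous_const).mem_nhds hξ
      filter_upwards [this] with z hz
      rw [hone J hJ1 z hz]; simp
    rw [this.iteratedFDeriv ℝ l |>.self_of_nhds]
    simp only [iteratedFDeriv_fun_zero]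
    simp; positivity
  · push Not at hξ
    have hpos : 0 < 1 + ‖ξ‖ := by positivity
    have h1 := iFD_mul_le (h.smooth ⊤) ((hG.smooth J).sub contDiff_const) l ξ
      (A := 2 ^ (m+1) * QQ (m+1) h / (1 + ‖ξ‖) ^ (k+1)) (B := C * (J+1))
      (fun i hi => by
        rw [le_div_iff₀ (by positivity), mul_comm]
        exact le_QQ (by omega) (by omega) h ξ) (fun i hi => hC i (by omega) J ξ)
    have hk' : ‖ξ‖ ^ k ≤ (1 + ‖ξ‖) ^ k := by gcongr; linarith
    calc ‖ξ‖ ^ k * _ ≤ (1 + ‖ξ‖) ^ k * (2 ^ l * (2 ^ (m+1) * QQ (m+1) h / (1 + ‖ξ‖) ^ (k+1) * (C * (J+1)))) := by gcongr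
      _ = 2 ^ l * (2 ^ (m+1) * QQ (m+1) h * C) * (J+1) / (1 + ‖ξ‖) := by field_simp; ring
      _ ≤ 2 ^ m * (2 ^ (m+1) * QQ (m+1) h * C) * (J+1) / (c * 2 ^ J) := by
          gcongr
          · norm_num
          · linarith
      _ = _ := by rw [hK]; field_simp

end TL

namespace TL

lemma iFD_zero_of_ev {n : ℕ} {g : Rn n → ℂ} {ξ : Rn n} (h : ∀ᶠ z in 𝓝 ξ, g z = 0) (l : ℕ) :
    iteratedFDeriv ℝ l g ξ = 0 := by
  have h' : g =ᶠ[𝓝 ξ] fun _ => 0 := h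
  rw [h'.iteratedFDeriv ℝ l |>.self_of_nhds]
  simp only [iteratedFDeriv_fun_zero]; rfl

lemma iFD_le {n : ℕ} {m k i : ℕ} (hk : k ≤ m) (hi : i ≤ m) (B : Sch n) (ξ : Rn n) :
    ‖iteratedFDeriv ℝ i B ξ‖ ≤ 2 ^ m * QQ m B / (1 + ‖ξ‖) ^ k := by
  rw [le_div_iff₀ (by positivity), mul_comm]; exact le_QQ hk hi B ξ

lemma QQ_prod {n : ℕ} {m : ℕ} {σ : ℕ} {g : Rn n → ℂ} (hg : ContDiff ℝ (⊤ : ℕ∞) g) {B P : Sch n} {A : ℝ} (hA0 : 0 ≤ A)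
    (hP : ∀ ξ, P ξ = g ξ * B ξ)
    (hA : ∀ ξ, (∀ᶠ z in 𝓝 ξ, B z = 0) ∨ ∀ i ≤ m, ‖iteratedFDeriv ℝ i g ξ‖ ≤ A * (1 + ‖ξ‖) ^ σ) :
    QQ m P ≤ A * (2 ^ m * 2 ^ (m + σ) * QQ (m + σ) B) := by
  have hQ := QQ_nonneg (m + σ) B
  refine QQ_le (by positivity) fun k l hk hl ξ => ?_
  have hf : (⇑P) = fun z => g z * B z := funext hP
  rw [hf]
  rcases hA ξ with h | h
  · rw [iFD_zero_of_ev (h.mono fun z hz => by simp [hz]), norm_zero, mul_zero]; positivity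
  · have h1 := iFD_mul_le hg (B.smooth ⊤) l ξ (fun i hi => h i (by omega))
      (fun i hi => iFD_le (m := m + σ) (k := k + σ) (by omega) (by omega) B ξ)
    have hk' : ‖ξ‖ ^ k ≤ (1 + ‖ξ‖) ^ k := by gcongr; linarith
    have hl' : (2:ℝ) ^ l ≤ 2 ^ m := by gcongr; norm_num
    calc ‖ξ‖ ^ k * _ ≤ (1 + ‖ξ‖) ^ k * (2 ^ m * (A * (1 + ‖ξ‖) ^ σ * (2 ^ (m + σ) * QQ (m + σ) B / (1 + ‖ξ‖) ^ (k + σ)))) := by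
          refine mul_le_mul hk' (h1.trans ?_) (norm_nonneg _) (by positivity)
          gcongr
      _ = _ := by
          have : (1 + ‖ξ‖) ≠ 0 := by positivity
          rw [pow_add (1 + ‖ξ‖)]; field_simp

lemma QQ_mulS {n : ℕ} (m : ℕ) (a b : Sch n) : QQ m (mulS a b) ≤ 2 ^ m * QQ m a * (2 ^ m * 2 ^ m * QQ m b) := by
  refine QQ_prod (σ := 0) (a.smooth ⊤) (mul_nonneg (by positivity) (QQ_nonneg _ _)) (mulS_apply a b) fun ξ => Or.inr fun i hi => ?_
  simpa using iFD_le (Nat.zero_le m) hi a ξ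

lemma QQ_dilate {n : ℕ} (m : ℕ) (ψ : Sch n) {t : ℝ} (ht : 0 < t) :
    QQ m (dilate ψ t) ≤ (1 + t) ^ m * (1 + t⁻¹) ^ m * (2 ^ m * QQ m ψ) := by
  have hQ := QQ_nonneg m ψ
  refine QQ_le (by positivity) fun k l hk hl ξ => ?_
  rw [norm_iFD_dilate ψ ht.ne', abs_of_pos ht]
  have h1 := le_QQ hk hl ψ (t • ξ)
  have e : ‖ξ‖ ^ k = (t⁻¹) ^ k * ‖t • ξ‖ ^ k := by
    rw [norm_smul, Real.norm_of_nonneg ht.le, ← mul_pow]; congr 1; field_simp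
  have h2 : ‖t • ξ‖ ^ k ≤ (1 + ‖t • ξ‖) ^ k := by gcongr; linarith
  have ht' : 0 < t⁻¹ := by positivity
  have h3 : (t⁻¹) ^ k ≤ (1 + t⁻¹) ^ m := (pow_le_pow_left₀ ht'.le (by linarith) k).trans (pow_le_pow_right₀ (by linarith) hk)
  have h4 : t ^ l ≤ (1 + t) ^ m := (pow_le_pow_left₀ ht.le (by linarith) l).trans (pow_le_pow_right₀ (by linarith) hl)
  calc _ = t ^ l * (t⁻¹) ^ k * (‖t • ξ‖ ^ k * ‖iteratedFDeriv ℝ l ψ (t • ξ)‖) := by rw [e]; ring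
    _ ≤ (1 + t) ^ m * (1 + t⁻¹) ^ m * (2 ^ m * QQ m ψ) := by
      have : ‖t • ξ‖ ^ k * ‖iteratedFDeriv ℝ l ψ (t • ξ)‖ ≤ 2 ^ m * QQ m ψ := (mul_le_mul_of_nonneg_right h2 (norm_nonneg _)).trans h1
      gcongr

lemma smooth_smul {n : ℕ} (H : Sch n) (t : ℝ) : ContDiff ℝ (⊤ : ℕ∞) fun ξ => H (t • ξ) :=
  (H.smooth ⊤).comp (contDiff_const_smul t)

lemma QQ_high {n : ℕ} (H : Sch n) {ρ : ℝ} (hρ : 0 < ρ) (m M : ℕ) : ∃ C : ℝ, 0 ≤ C ∧ ∀ t : ℝ, 1 ≤ t → ∀ B P : Sch n,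
    (∀ ξ, ‖ξ‖ < ρ → B ξ = 0) → (∀ ξ, P ξ = H (t • ξ) * B ξ) → QQ m P ≤ C * QQ m B * (t ^ M)⁻¹ := by
  have hQ := QQ_nonneg (m + M) H
  refine ⟨2 ^ (m + M) * QQ (m + M) H / ρ ^ (m + M) * (2 ^ m * 2 ^ m), by positivity, fun t ht B P hB hP => ?_⟩
  have ht0 : 0 < t := by linarith
  have := QQ_prod (σ := 0) (m := m) (smooth_smul H t) (A := 2 ^ (m + M) * QQ (m + M) H / ρ ^ (m + M) * (t ^ M)⁻¹) (by positivity) hP fun ξ => ?_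
  · refine this.trans (le_of_eq ?_); simp only [add_zero]; ring
  · by_cases hξ : ‖ξ‖ < ρ
    · left
      have : {z : Rn n | ‖z‖ < ρ} ∈ 𝓝 ξ := (isOpen_lt continuous_norm continuous_const).mem_nhds hξ
      filter_upwards [this] with z hz using hB z hz
    · right
      intro i hi
      push Not at hξ
      rw [norm_iFD_smul (H.smooth ⊤), abs_of_pos ht0, pow_zero, mul_one]
      have h1 := iFD_le (m := m + M) (k := m + M) le_rfl (by omega : i ≤ m + M) H (t • ξ)
      have h2 : t * ρ ≤ 1 + ‖t • ξ‖ := by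
        rw [norm_smul, Real.norm_of_nonneg ht0.le]
        have := mul_le_mul_of_nonneg_left hξ ht0.le
        linarith
      calc _ ≤ t ^ m * (2 ^ (m + M) * QQ (m + M) H / (t * ρ) ^ (m + M)) := by
            gcongr
            exact h1.trans (by gcongr)
        _ = _ := by rw [mul_pow, pow_add t]; field_simp

/-- vanishing order at the origin -/
def Van {n : ℕ} (σ : ℕ) (H : Sch n) : Prop := ∃ C : ℝ, 0 ≤ C ∧ ∀ i ≤ σ, ∀ x, ‖iteratedFDeriv ℝ i H x‖ ≤ C * ‖x‖ ^ (σ - i)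

lemma van_of {n : ℕ} (σ : ℕ) (H : Sch n) (h : ∀ i < σ, iteratedFDeriv ℝ i H 0 = 0) : Van σ H := by
  have hQ := QQ_nonneg σ H
  refine ⟨2 ^ σ * QQ σ H, by positivity, ?_⟩
  have key : ∀ e, e ≤ σ → ∀ x, ‖iteratedFDeriv ℝ (σ - e) H x‖ ≤ 2 ^ σ * QQ σ H * ‖x‖ ^ e := by
    intro e
    induction e with
    | zero => intro _ x; simpa using iFD_le (Nat.zero_le σ) le_rfl H x
    | succ e ih =>
      intro he x
      have hd : Differentiable ℝ (iteratedFDeriv ℝ (σ - (e+1)) H) :=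
        (H.smooth ⊤).differentiable_iteratedFDeriv (by generalize σ - (e+1) = a; exact_mod_cast WithTop.coe_lt_top a)
      have := (convex_closedBall (0 : Rn n) ‖x‖).norm_image_sub_le_of_norm_fderiv_le (𝕜 := ℝ) (f := iteratedFDeriv ℝ (σ - (e+1)) H)
        (C := 2 ^ σ * QQ σ H * ‖x‖ ^ e) (fun ζ _ => hd ζ) (fun ζ hζ => by
          rw [norm_fderiv_iteratedFDeriv, show σ - (e+1) + 1 = σ - e by omega]
          refine (ih (by omega) ζ).trans ?_
          rw [mem_closedBall, dist_zero_right] at hζ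
          gcongr) (mem_closedBall_self (norm_nonneg _)) (y := x) (by simp)
      rw [h _ (by omega), sub_zero, sub_zero] at this
      rw [pow_succ, ← mul_assoc]; exact this
  intro i hi x
  have := key (σ - i) (by omega) x
  rwa [show σ - (σ - i) = i by omega] at this

lemma QQ_low {n : ℕ} {H : Sch n} {σ : ℕ} (hv : Van σ H) (m : ℕ) : ∃ C : ℝ, 0 ≤ C ∧ ∀ t : ℝ, 0 < t → t ≤ 2 → ∀ B P : Sch n,
    (∀ ξ, P ξ = H (t • ξ) * B ξ) → QQ m P ≤ C * QQ (m + σ) B * t ^ σ := by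
  obtain ⟨C, hC, h⟩ := hv
  have hQ := QQ_nonneg m H
  refine ⟨(C + 2 ^ m * (2 ^ m * QQ m H)) * (2 ^ m * 2 ^ (m + σ)), by positivity, fun t ht ht2 B P hP => ?_⟩
  have := QQ_prod (σ := σ) (m := m) (smooth_smul H t) (A := (C + 2 ^ m * (2 ^ m * QQ m H)) * t ^ σ) (by positivity) hP fun ξ => Or.inr ?_
  · refine this.trans (le_of_eq ?_); ring
  · intro i hi
    rw [norm_iFD_smul (H.smooth ⊤), abs_of_pos ht]
    by_cases hiσ : i ≤ σ
    · calc _ ≤ t ^ i * (C * ‖t • ξ‖ ^ (σ - i)) := by gcongr; exact h i hiσ _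
        _ = C * t ^ σ * ‖ξ‖ ^ (σ - i) := by
          rw [norm_smul, Real.norm_of_nonneg ht.le, mul_pow]
          have : t ^ σ = t ^ i * t ^ (σ - i) := by rw [← pow_add]; congr 1; omega
          rw [this]; ring
        _ ≤ C * t ^ σ * (1 + ‖ξ‖) ^ σ := by
          gcongr
          calc ‖ξ‖ ^ (σ - i) ≤ (1 + ‖ξ‖) ^ (σ - i) := by gcongr; linarith
            _ ≤ _ := pow_le_pow_right₀ (by linarith [norm_nonneg ξ]) (by omega)
        _ ≤ _ := by
          gcongr
          have : 0 ≤ 2 ^ m * (2 ^ m * QQ m H) := by positivity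
          linarith
    · have h1 := iFD_le (Nat.zero_le m) hi H (t • ξ)
      rw [pow_zero, div_one] at h1
      have h2 : t ^ i ≤ t ^ σ * 2 ^ m := by
        have : t ^ i = t ^ σ * t ^ (i - σ) := by rw [← pow_add]; congr 1; omega
        rw [this]
        gcongr
        calc t ^ (i - σ) ≤ 2 ^ (i - σ) := by gcongr
          _ ≤ _ := by gcongr; norm_num; omega
      have h3 : 1 ≤ (1 + ‖ξ‖) ^ σ := one_le_pow₀ (by linarith [norm_nonneg ξ])
      calc _ ≤ t ^ σ * 2 ^ m * (2 ^ m * QQ m H) := by gcongr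
        _ = (2 ^ m * (2 ^ m * QQ m H)) * t ^ σ * 1 := by ring
        _ ≤ _ := by gcongr; linarith

lemma van_mom {n : ℕ} {S : ℤ} {ψ : Sch n} (hmom : ∀ α : Fin n → ℕ, (mdeg α : ℤ) ≤ S → mderiv α (fun y => ψ y) 0 = 0) :
    Van (S + 1).toNat ψ := by
  refine van_of _ _ fun i hi => ?_
  have := iteratedFDeriv_le_of_mderiv ψ i 0 (c := 0) (fun α hα => by rw [hmom α (by omega)]; simp)
  simpa using this

end TL

namespace TL

lemma cutoff_exists (n : ℕ) {a b : ℝ} (ha : 0 < a) (hab : a < b) : ∃ θ : Sch n,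
    (∀ ξ, ‖ξ‖ ≤ a → θ ξ = 1) ∧ (∀ ξ, b ≤ ‖ξ‖ → θ ξ = 0) := by
  let β : ContDiffBump (0 : Rn n) := ⟨a, b, ha, hab⟩
  have hc : ContDiff ℝ (⊤ : ℕ∞) (fun ξ => ((β ξ : ℝ) : ℂ)) := Complex.ofRealCLM.contDiff.comp β.contDiff
  have hs : HasCompactSupport (fun ξ => ((β ξ : ℝ) : ℂ)) := β.hasCompactSupport.comp_left (g := fun r : ℝ => (r : ℂ)) (by simp)
  refine ⟨hs.toSchwartzMap hc, fun ξ hξ => ?_, fun ξ hξ => ?_⟩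
  · have := β.one_of_mem_closedBall (x := ξ) (by simpa using hξ)
    change ((β ξ : ℝ) : ℂ) = 1
    rw [this]; simp
  · have := β.zero_of_le_dist (x := ξ) (by simpa using hξ)
    change ((β ξ : ℝ) : ℂ) = 0
    rw [this]; simp

lemma div_exists {n : ℕ} (ζ ψ : Sch n) {R : ℝ} (hR : ∀ ξ, R ≤ ‖ξ‖ → ζ ξ = 0) {K : Set (Rn n)} (hK : IsClosed K)
    (hζ : ∀ ξ, ζ ξ ≠ 0 → ξ ∈ K) (hψ : ∀ ξ ∈ K, ψ ξ ≠ 0) : ∃ ω : Sch n, ∀ ξ, ω ξ * ψ ξ = ζ ξ := by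
  have hc : ContDiff ℝ (⊤ : ℕ∞) (fun ξ => ζ ξ / ψ ξ) := by
    rw [contDiff_iff_contDiffAt]
    intro ξ
    by_cases h : ξ ∈ K
    · simp only [div_eq_mul_inv]
      exact ((ζ.smooth ⊤).contDiffAt).mul (((ψ.smooth ⊤).contDiffAt).inv (hψ ξ h))
    · have : (fun ξ => ζ ξ / ψ ξ) =ᶠ[𝓝 ξ] fun _ => 0 := by
        filter_upwards [hK.isOpen_compl.mem_nhds h] with z hz
        have : ζ z = 0 := by by_contra h'; exact hz (hζ z h')
        simp [this]
      exact contDiffAt_const.congr_of_eventuallyEq this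
  have hs : HasCompactSupport (fun ξ => ζ ξ / ψ ξ) := by
    refine HasCompactSupport.intro (isCompact_closedBall (0 : Rn n) R) fun ξ hξ => ?_
    rw [mem_closedBall, dist_zero_right, not_le] at hξ
    simp [hR ξ hξ.le]
  refine ⟨hs.toSchwartzMap hc, fun ξ => ?_⟩
  change ζ ξ / ψ ξ * ψ ξ = ζ ξ
  by_cases h : ζ ξ = 0
  · simp [h]
  · rw [div_mul_cancel₀ _ (hψ ξ (hζ ξ h))]

/-- a fattened dyadic family -/
structure Fat {n : ℕ} (Bj : ℕ → Sch n) : Prop where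
  one0 : ∀ ξ, ‖ξ‖ ≤ 2 → Bj 0 ξ = 1
  onej : ∀ j, 0 < j → ∀ ξ, 1/2 ≤ ‖ξ‖ → ‖ξ‖ ≤ 2 → Bj j ξ = 1
  zero : ∀ j, 0 < j → ∀ ξ, ‖ξ‖ < 1/4 → Bj j ξ = 0
  bd : ∀ m, ∃ C : ℝ, 0 ≤ C ∧ ∀ j, QQ m (Bj j) ≤ C

lemma fat_exists (n : ℕ) : ∃ Bj : ℕ → Sch n, Fat Bj := by
  obtain ⟨B0, h1, h2⟩ := cutoff_exists n (a := 2) (b := 4) (by norm_num) (by norm_num)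
  obtain ⟨B1, h3, h4⟩ := cutoff_exists n (a := 1/4) (b := 1/2) (by norm_num) (by norm_num)
  refine ⟨fun j => if j = 0 then B0 else B0 - B1, fun ξ hξ => by simpa using h1 ξ hξ, fun j hj ξ a b => ?_, fun j hj ξ a => ?_, fun m => ?_⟩
  · simp [hj.ne', h1 ξ b, h4 ξ a]
  · simp [hj.ne', h1 ξ (by linarith), h3 ξ a.le]
  · have := QQ_nonneg m B0
    have h' := QQ_nonneg m (B0 - B1)
    refine ⟨QQ m B0 + QQ m (B0 - B1), by positivity, fun j => ?_⟩
    by_cases hj : j = 0 <;> simp [hj, this, h']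

lemma phi_bd {n : ℕ} {φ : ℕ → Sch n} (hφ : SmoothResolution n φ) (l : ℕ) : ∃ c : ℝ, 0 ≤ c ∧ ∀ j ξ,
    ‖iteratedFDeriv ℝ l (φ j) ξ‖ ≤ c * ((2:ℝ) ^ (j * l))⁻¹ := by
  classical
  choose c hc using hφ.deriv_bound
  let s : Finset (Fin n → ℕ) := Fintype.piFinset fun _ => Finset.range (l+1)
  refine ⟨((n ^ l : ℕ) : ℝ) * ∑ α ∈ s, |c α|, by positivity, fun j ξ => ?_⟩
  rw [mul_assoc]
  refine iteratedFDeriv_le_of_mderiv (φ j) l ξ fun α hα => (hc α j ξ).trans ?_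
  have e : (2:ℝ) ^ (-(j:ℝ) * (mdeg α : ℝ)) = ((2:ℝ) ^ (j * l))⁻¹ := by
    rw [hα, neg_mul, Real.rpow_neg (by norm_num)]; congr 1
    rw [← Nat.cast_mul, Real.rpow_natCast]
  rw [e]
  refine mul_le_mul_of_nonneg_right ((le_abs_self _).trans ?_) (by positivity)
  refine Finset.single_le_sum (f := fun α => |c α|) (fun _ _ => abs_nonneg _) ?_
  rw [Fintype.mem_piFinset]
  intro i
  rw [Finset.mem_range]
  have : α i ≤ mdeg α := Finset.single_le_sum (f := α) (fun _ _ => Nat.zero_le _) (Finset.mem_univ i)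
  omega

lemma phi_zero {n : ℕ} {φ : ℕ → Sch n} (hφ : SmoothResolution n φ) (j : ℕ) (ξ : Rn n) (h : 2 ^ (j+1) < ‖ξ‖) : φ j ξ = 0 := by
  by_contra h'
  rcases Nat.eq_zero_or_pos j with rfl | hj
  · have : ‖ξ‖ ≤ 2 := hφ.supp0 h'
    norm_num at h; linarith
  · have := (hφ.suppj j hj h').2
    rw [show ((j:ℝ) + 1) = ((j+1 : ℕ) : ℝ) by push_cast; rfl, Real.rpow_natCast] at this
    linarith

lemma phi_zero' {n : ℕ} {φ : ℕ → Sch n} (hφ : SmoothResolution n φ) (j : ℕ) (hj : 0 < j) (ξ : Rn n) (h : 2 * ‖ξ‖ < 2 ^ j) : φ j ξ = 0 := by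
  by_contra h'
  have := (hφ.suppj j hj h').1
  rw [Real.rpow_sub (by norm_num), Real.rpow_natCast, Real.rpow_one] at this
  linarith

lemma phi_fat {n : ℕ} {φ : ℕ → Sch n} (hφ : SmoothResolution n φ) {Bj : ℕ → Sch n} (hB : Fat Bj) (j : ℕ) (ξ : Rn n) :
    Bj j (((2:ℝ)^j)⁻¹ • ξ) * φ j ξ = φ j ξ := by
  by_cases h : φ j ξ = 0
  · simp [h]
  have h1 : ‖ξ‖ ≤ 2 ^ (j+1) := by by_contra h'; push Not at h'; exact h (phi_zero hφ j ξ h')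
  have e : ‖((2:ℝ)^j)⁻¹ • ξ‖ = ‖ξ‖ / 2 ^ j := by rw [norm_smul, Real.norm_of_nonneg (by positivity)]; field_simp
  rcases Nat.eq_zero_or_pos j with rfl | hj
  · rw [hB.one0 _ (by rw [e]; norm_num at h1 ⊢; exact h1), one_mul]
  · have h2 : 2 ^ j ≤ 2 * ‖ξ‖ := by by_contra h'; push Not at h'; exact h (phi_zero' hφ j hj ξ h')
    rw [hB.onej j hj _ (by rw [e, le_div_iff₀ (by positivity)]; linarith) (by rw [e, div_le_iff₀ (by positivity)]; rw [pow_succ] at h1; linarith), one_mul]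

lemma phi_cut {n : ℕ} {φ : ℕ → Sch n} (hφ : SmoothResolution n φ) : Cut (fun J ξ => ∑ j ∈ Finset.range J, φ j ξ) where
  smooth J := ContDiff.sum fun j _ => (φ j).smooth ⊤
  one := by
    refine ⟨1/2, by norm_num, fun J hJ ξ h => ?_⟩
    rw [← hφ.sum_eq ξ]
    symm
    refine tsum_eq_sum fun j hj => phi_zero' hφ j ?_ ξ ?_
    · rw [Finset.mem_range] at hj; omega
    · rw [Finset.mem_range, not_lt] at hj
      have : (2:ℝ) ^ J ≤ 2 ^ j := by gcongr; norm_num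
      linarith
  bd l := by
    obtain ⟨c, hc, h⟩ := phi_bd hφ l
    refine ⟨c, fun J ξ => ?_⟩
    have : iteratedFDeriv ℝ l (fun ξ => ∑ j ∈ Finset.range J, φ j ξ) ξ = ∑ j ∈ Finset.range J, iteratedFDeriv ℝ l (φ j) ξ := by
      rw [iteratedFDeriv_fun_sum_apply fun j _ => ((φ j).contDiffAt l)]
    rw [this]
    calc _ ≤ ∑ j ∈ Finset.range J, c := by
          refine norm_sum_le_of_le _ fun j _ => (h j ξ).trans ?_
          refine mul_le_of_le_one_right hc (inv_le_one_of_one_le₀ (one_le_pow₀ (by norm_num)))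
      _ ≤ _ := by rw [Finset.sum_const, Finset.card_range, nsmul_eq_mul]; nlinarith

end TL

namespace TL
universe uE

lemma QQ_zero {n : ℕ} (m : ℕ) : QQ m (0 : Sch n) = 0 := map_zero _

lemma sum_apply' {n : ℕ} (s : Finset ℕ) (g : ℕ → Sch n) (ξ : Rn n) : (∑ k ∈ s, g k) ξ = ∑ k ∈ s, g k ξ := by
  simp

lemma phi_expand (n N : ℕ) {φ : ℕ → Sch n} (hφ : SmoothResolution n φ) {Bj : ℕ → Sch n} (hB : Fat Bj) :
    ∃ (m : ℕ) (C : ℝ), 0 ≤ C ∧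
    ∀ (E : Type uE) [NormedAddCommGroup E] [NormedSpace ℂ E] (f : TDist n E) (y : Rn n) (h : Sch n),
    ‖mOp h f y‖ₑ ≤ ENNReal.ofReal C * ∑' j, ENNReal.ofReal (QQ m (mulS (dilate h ((2:ℝ)^j)) (Bj j))) *
      ∫⁻ z, ker j N (y - z) * ‖mOp (φ j) f z‖ₑ := by
  obtain ⟨m, C, hC, hm⟩ := master n N
  refine ⟨m, C, hC, fun E _ _ f y h => hm E f y _ φ _ h (fun k => le_rfl) ?_⟩
  intro m'
  refine cut_tendsto (phi_cut hφ) h _ 0 (fun J _ ξ => ?_) m'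
  rw [sum_apply', Finset.mul_sum]
  refine Finset.sum_congr rfl fun j _ => ?_
  rw [mulS_apply, dilate_apply _ (by positivity), mulS_apply, dilate_apply _ (by positivity), mul_assoc, phi_fat hφ hB, smul_smul,
    mul_inv_cancel₀ (by positivity), one_smul]

lemma H1_phi (n : ℕ) {φ : ℕ → Sch n} (hφ : SmoothResolution n φ) :
    ∃ CN : ℕ → ℝ≥0∞, (∀ N, CN N ≠ ∞) ∧ ∀ (E : Type uE) [NormedAddCommGroup E] [NormedSpace ℂ E] (f : TDist n E),
      H1 CN (fun j x => ‖mOp (φ j) f x‖ₑ) := by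
  obtain ⟨Bj, hB⟩ := fat_exists n
  choose m C hC hm using fun N => master.{uE} n N
  choose D hD hDB using fun N => hB.bd (m N)
  refine ⟨fun N => ENNReal.ofReal (C N) * ENNReal.ofReal (D N), fun N => ENNReal.mul_ne_top ENNReal.ofReal_ne_top ENNReal.ofReal_ne_top,
    fun E _ _ f N j x => ?_⟩
  have := hm N E f x (fun k => if k = j then Bj j else 0) φ (fun k => if k = j then D N else 0) (φ j) (fun k => ?_) ?_
  · refine this.trans ?_
    rw [mul_assoc]
    refine mul_le_mul_right ?_ _
    rw [tsum_eq_single j (by intro k hk; simp [hk]), ← ENNReal.tsum_mul_left]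
    refine le_trans ?_ (ENNReal.le_tsum 0)
    simp
  · by_cases hk : k = j
    · simp only [hk, if_true]; exact hDB N j
    · simp only [hk, if_false]; rw [QQ_zero]
  · intro m'
    refine tendsto_const_nhds.congr' ?_
    filter_upwards [eventually_gt_atTop j] with J hJ
    have : (∑ k ∈ Finset.range J, mulS (dilate (if k = j then Bj j else 0) ((2:ℝ)^k)⁻¹) (φ k)) - φ j = 0 := by
      ext ξ
      rw [sub_apply, sum_apply', Finset.sum_eq_single j]
      · rw [mulS_apply, dilate_apply _ (by positivity), if_pos rfl, phi_fat hφ hB]; simp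
      · intro k _ hk
        rw [mulS_apply, dilate_apply _ (by positivity), if_neg hk]; simp
      · intro h; exact absurd (Finset.mem_range.mpr hJ) h
    rw [this, QQ_zero]

lemma QQ_phi {n : ℕ} {φ : ℕ → Sch n} (hφ : SmoothResolution n φ) (m : ℕ) : ∃ C : ℝ, 0 ≤ C ∧ ∀ j, QQ m (φ j) ≤ C * (2 ^ j) ^ m := by
  obtain ⟨C, hC, h⟩ := uniform_bd (P := fun l C => ∀ j ξ, ‖iteratedFDeriv ℝ l (φ j) ξ‖ ≤ C) (fun l C C' h1 h2 j ξ => (h2 j ξ).trans h1)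
    (fun l => by
      obtain ⟨c, hc, h⟩ := phi_bd hφ l
      exact ⟨c, fun j ξ => (h j ξ).trans (mul_le_of_le_one_right hc (inv_le_one_of_one_le₀ (one_le_pow₀ (by norm_num))))⟩) m
  refine ⟨2 ^ m * C, by positivity, fun j => QQ_le (by positivity) fun k l hk hl ξ => ?_⟩
  by_cases hξ : 2 ^ (j+1) < ‖ξ‖
  · rw [iFD_zero_of_ev, norm_zero, mul_zero]; · positivity
    filter_upwards [(isOpen_lt continuous_const continuous_norm).mem_nhds hξ] with z hz using phi_zero hφ j z hz
  · push Not at hξ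
    have h2 : ‖ξ‖ ^ k ≤ (2 ^ (j+1)) ^ m := (pow_le_pow_left₀ (norm_nonneg _) hξ k).trans
      (pow_le_pow_right₀ (one_le_pow₀ (by norm_num)) hk)
    calc _ ≤ (2 ^ (j+1)) ^ m * C := by gcongr; exact h l hl j ξ
      _ = _ := by rw [pow_succ, mul_pow]; ring

lemma Gr_of {n : ℕ} {E : Type*} [NormedAddCommGroup E] [NormedSpace ℂ E] (b : ℕ → Sch n)
    (hb : ∀ m, ∃ C : ℝ, 0 ≤ C ∧ ∀ j, QQ m (b j) ≤ C * (2 ^ j) ^ m) (f : TDist n E) : Gr (fun j x => ‖mOp (b j) f x‖ₑ) := by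
  obtain ⟨m, C, hC, h⟩ := mOp_bound f
  obtain ⟨D, hD, hD'⟩ := hb m
  refine ⟨ENNReal.ofReal (C * D), m, ENNReal.ofReal_ne_top, fun k y => ?_⟩
  beta_reduce
  rw [← ENNReal.ofReal_mul (by positivity), ← ofReal_norm]
  refine ENNReal.ofReal_le_ofReal ((h _ _).trans ?_)
  calc _ ≤ C * (1 + ‖y‖) ^ m * (D * (2 ^ k) ^ m) := by gcongr; exact hD' k
    _ = _ := by rw [mul_pow]; ring

/-- basic two-sided coefficient -/
def ar (σ M k j : ℕ) : ℝ := if j ≤ k then ((2:ℝ) ^ ((k - j) * σ))⁻¹ else ((2:ℝ) ^ ((j - k) * M))⁻¹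

lemma ar_nonneg (σ M k j : ℕ) : 0 ≤ ar σ M k j := by unfold ar; split_ifs <;> positivity

lemma QQ_ar {n : ℕ} {H : Sch n} {σ : ℕ} (hv : Van σ H) {Bj : ℕ → Sch n} (hB : Fat Bj) (m M : ℕ) : ∃ C : ℝ, 0 ≤ C ∧
    ∀ (k j : ℕ) (τ : ℝ), ((2:ℝ)^(k+1))⁻¹ ≤ τ → τ ≤ 2 * ((2:ℝ)^k)⁻¹ →
      QQ m (mulS (dilate (dilate H τ) ((2:ℝ)^j)) (Bj j)) ≤ C * ar σ M k j := by
  obtain ⟨C1, hC1, h1⟩ := QQ_low hv m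
  obtain ⟨C2, hC2, h2⟩ := QQ_high H (ρ := 1/4) (by norm_num) m M
  obtain ⟨D1, hD1, hb1⟩ := hB.bd (m + σ)
  obtain ⟨D2, hD2, hb2⟩ := hB.bd m
  refine ⟨C1 * D1 * 2 ^ σ + C2 * D2 * 2 ^ M, by positivity, fun k j τ ht1 ht2 => ?_⟩
  have hτ : 0 < τ := lt_of_lt_of_le (by positivity) ht1
  have hP : ∀ ξ, mulS (dilate (dilate H τ) ((2:ℝ)^j)) (Bj j) ξ = H ((τ * 2 ^ j) • ξ) * Bj j ξ := by
    intro ξ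
    rw [mulS_apply, dilate_apply _ (by positivity), dilate_apply _ hτ.ne', smul_smul]
  unfold ar
  split_ifs with hjk
  · obtain ⟨e, rfl⟩ := Nat.exists_eq_add_of_le hjk
    have e1 : τ * 2 ^ j ≤ 2 * (2 ^ e)⁻¹ := by
      calc τ * 2 ^ j ≤ 2 * ((2:ℝ)^(j+e))⁻¹ * 2 ^ j := by gcongr
        _ = _ := by rw [pow_add]; field_simp
    have e2 : (2:ℝ) * (2 ^ e)⁻¹ ≤ 2 := by
      have : ((2:ℝ) ^ e)⁻¹ ≤ 1 := inv_le_one_of_one_le₀ (one_le_pow₀ (by norm_num))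
      linarith
    refine (h1 (τ * 2 ^ j) (by positivity) (e1.trans e2) (Bj j) _ hP).trans ?_
    rw [Nat.add_sub_cancel_left]
    calc _ ≤ C1 * D1 * (2 * (2 ^ e)⁻¹) ^ σ := by gcongr; exact hb1 j
      _ = C1 * D1 * 2 ^ σ * (2 ^ (e * σ))⁻¹ := by rw [mul_pow, inv_pow, pow_mul]; ring
      _ ≤ _ := by gcongr; linarith [show 0 ≤ C2 * D2 * 2 ^ M by positivity]
  · push Not at hjk
    obtain ⟨e, rfl⟩ := Nat.exists_eq_add_of_lt hjk
    have e1 : (2:ℝ) ^ e ≤ τ * 2 ^ (k + e + 1) := by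
      calc (2:ℝ) ^ e = ((2:ℝ)^(k+1))⁻¹ * 2 ^ (k + e + 1) := by
            rw [show k + e + 1 = (k + 1) + e by ring, pow_add _ (k+1)]; field_simp
        _ ≤ _ := by gcongr
    refine (h2 _ ((one_le_pow₀ (by norm_num)).trans e1) (Bj (k+e+1)) _ (hB.zero _ (by omega)) hP).trans ?_
    rw [show k + e + 1 - k = e + 1 by omega]
    calc _ ≤ C2 * D2 * (((2:ℝ) ^ e) ^ M)⁻¹ := by gcongr; exact hb2 _
      _ = C2 * D2 * 2 ^ M * (2 ^ ((e + 1) * M))⁻¹ := by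
          rw [show (e+1) * M = e * M + M by ring, pow_add, ← pow_mul]; field_simp
      _ ≤ _ := by gcongr; linarith [show 0 ≤ C1 * D1 * 2 ^ σ by positivity]

lemma ker_shift {n : ℕ} {d : ℝ} (hd : 0 < d) (N k j : ℕ) {x y : Rn n} (h : dist x y ≤ d * ((2:ℝ)^k)⁻¹) (z : Rn n) :
    ker j N (y - z) ≤ ENNReal.ofReal ((1 + d) ^ N * (2 ^ ((j - k) * N))) * ker j N (x - z) := by
  unfold ker
  rw [← ENNReal.ofReal_mul (by positivity)]
  refine ENNReal.ofReal_le_ofReal ?_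
  have h1 : ‖x - z‖ ≤ ‖y - z‖ + d * ((2:ℝ)^k)⁻¹ := by
    calc ‖x - z‖ = ‖(y - z) + (x - y)‖ := by congr 1; abel
      _ ≤ ‖y - z‖ + ‖x - y‖ := norm_add_le _ _
      _ ≤ _ := by rw [dist_eq_norm] at h; gcongr
  have h0 : (2:ℝ) ^ j * ((2:ℝ)^k)⁻¹ ≤ 2 ^ (j - k) := by
    rw [← div_eq_mul_inv, div_le_iff₀ (by positivity), ← pow_add]
    gcongr
    · norm_num
    · omega
  have h3 : (1:ℝ) ≤ 2 ^ (j - k) := one_le_pow₀ (by norm_num)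
  have h2 : 1 + 2 ^ j * ‖x - z‖ ≤ (1 + d) * 2 ^ (j - k) * (1 + 2 ^ j * ‖y - z‖) := by
    have hnn : 0 ≤ 2 ^ j * ‖y - z‖ := by positivity
    calc 1 + 2 ^ j * ‖x - z‖ ≤ 1 + 2 ^ j * (‖y - z‖ + d * ((2:ℝ)^k)⁻¹) := by gcongr
      _ = 1 + 2 ^ j * ‖y - z‖ + d * (2 ^ j * ((2:ℝ)^k)⁻¹) := by ring
      _ ≤ 2 ^ (j-k) * (1 + 2 ^ j * ‖y - z‖) + d * (2 ^ (j-k) * (1 + 2 ^ j * ‖y - z‖)) := by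
        refine add_le_add (by nlinarith) (mul_le_mul_of_nonneg_left (h0.trans (by nlinarith)) hd.le)
      _ = _ := by ring
  have h4 := pow_le_pow_left₀ (by positivity) h2 N
  rw [mul_pow, mul_pow] at h4
  calc _ ≤ 2 ^ (j * n) * ((1 + d) ^ N * (2 ^ (j-k)) ^ N * ((1 + 2 ^ j * ‖x - z‖) ^ N)⁻¹) := by
        refine mul_le_mul_of_nonneg_left ?_ (by positivity)
        rw [← div_eq_mul_inv, le_div_iff₀ (by positivity), inv_mul_le_iff₀ (by positivity)]
        linarith
    _ = _ := by rw [pow_mul]; ring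

lemma ar_le_ac {s δ : ℝ} {σ L : ℕ} (hδ : δ = σ - s) (hL : |s| + δ ≤ L) (N k j : ℕ) :
    ENNReal.ofReal (ar σ (N + L) k j * 2 ^ ((j - k) * N)) ≤ ac s δ k j := by
  have e : ac s δ k j = ENNReal.ofReal ((2:ℝ) ^ (((j:ℝ) - k) * s + -(δ * |(k:ℝ) - j|))) := by
    unfold ac c1
    rw [← two_rpow_add, ← ENNReal.ofReal_rpow_of_pos (by norm_num)]; simp
  rw [e]
  refine ENNReal.ofReal_le_ofReal ?_
  unfold ar
  split_ifs with h
  · rw [Nat.sub_eq_zero_of_le h, zero_mul, pow_zero, mul_one, ← Real.rpow_natCast, ← Real.rpow_neg (by norm_num)]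
    refine Real.rpow_le_rpow_of_exponent_le (by norm_num) ?_
    have : (j:ℝ) ≤ k := by exact_mod_cast h
    rw [abs_of_nonneg (by linarith)]
    push_cast [h]
    rw [hδ]; apply le_of_eq; ring
  · push Not at h
    have : (2:ℝ) ^ ((j - k) * (N + L)) = 2 ^ ((j - k) * N) * 2 ^ ((j - k) * L) := by rw [mul_add, pow_add]
    rw [this, mul_inv, mul_right_comm, inv_mul_cancel₀ (by positivity), one_mul, ← Real.rpow_natCast, ← Real.rpow_neg (by norm_num)]
    refine Real.rpow_le_rpow_of_exponent_le (by norm_num) ?_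
    have h' : (k:ℝ) ≤ j := by exact_mod_cast h.le
    rw [abs_of_nonpos (by linarith)]
    push_cast [h.le]
    have := neg_abs_le s
    nlinarith

lemma key2 (n N σ : ℕ) {s δ d : ℝ} (hδ : δ = σ - s) (hd : 0 < d) {φ : ℕ → Sch n} (hφ : SmoothResolution n φ) :
    ∀ (H : Sch n) (σ' : ℕ), Van σ' H → ∃ Ca : ℝ≥0∞, Ca ≠ ∞ ∧ ∀ (E : Type uE) [NormedAddCommGroup E] [NormedSpace ℂ E] (f : TDist n E)
      (k : ℕ) (τ : ℝ) (x y : Rn n), (σ' = σ ∨ k = 0) → ((2:ℝ)^(k+1))⁻¹ ≤ τ → τ ≤ 2 * ((2:ℝ)^k)⁻¹ →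
      dist x y ≤ d * ((2:ℝ)^k)⁻¹ →
      ‖mOp (dilate H τ) f y‖ₑ ≤ Ca * ∑' j, ac s δ k j * ∫⁻ z, ker j N (x - z) * ‖mOp (φ j) f z‖ₑ := by
  intro H σ' hv
  obtain ⟨Bj, hB⟩ := fat_exists n
  obtain ⟨L, hL⟩ := exists_nat_ge (|s| + δ)
  obtain ⟨m, C, hC, hm⟩ := phi_expand.{uE} n N hφ hB
  obtain ⟨C2, hC2, h2⟩ := QQ_ar hv hB m (N + L)
  refine ⟨ENNReal.ofReal C * ENNReal.ofReal (C2 * (1 + d) ^ N), ENNReal.mul_ne_top ENNReal.ofReal_ne_top ENNReal.ofReal_ne_top,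
    fun E _ _ f k τ x y hk ht1 ht2 hxy => (hm E f y _).trans ?_⟩
  rw [mul_assoc]
  refine mul_le_mul_right ?_ _
  rw [← ENNReal.tsum_mul_left]
  refine ENNReal.tsum_le_tsum fun j => ?_
  have e1 : ar σ' (N + L) k j = ar σ (N + L) k j := by
    rcases hk with rfl | rfl
    · rfl
    · unfold ar; simp
  have e2 := h2 k j τ ht1 ht2
  rw [e1] at e2
  have e3 : ∫⁻ z, ker j N (y - z) * ‖mOp (φ j) f z‖ₑ ≤ ENNReal.ofReal ((1 + d) ^ N * (2 ^ ((j - k) * N))) *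
      ∫⁻ z, ker j N (x - z) * ‖mOp (φ j) f z‖ₑ := by
    rw [← lintegral_const_mul' _ _ ENNReal.ofReal_ne_top]
    refine lintegral_mono fun z => ?_
    rw [← mul_assoc]
    exact mul_le_mul_left (ker_shift hd N k j hxy z) _
  have h0 := ar_nonneg σ (N+L) k j
  calc _ ≤ ENNReal.ofReal (C2 * ar σ (N + L) k j) * (ENNReal.ofReal ((1 + d) ^ N * (2 ^ ((j - k) * N))) *
      ∫⁻ z, ker j N (x - z) * ‖mOp (φ j) f z‖ₑ) := by gcongr
    _ = ENNReal.ofReal (C2 * (1 + d) ^ N) * (ENNReal.ofReal (ar σ (N + L) k j * 2 ^ ((j - k) * N)) *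
      ∫⁻ z, ker j N (x - z) * ‖mOp (φ j) f z‖ₑ) := by
      rw [← mul_assoc, ← mul_assoc, ← ENNReal.ofReal_mul (by positivity), ← ENNReal.ofReal_mul (by positivity)]
      congr 2; ring
    _ ≤ _ := by gcongr; exact ar_le_ac hδ hL N k j

end TL

namespace TL
universe uE

lemma rpow_cmp (s : ℝ) (k : ℕ) {t : ℝ} (h1 : ((2:ℝ)^(k+1))⁻¹ ≤ t) (h2 : t ≤ 2 * ((2:ℝ)^k)⁻¹) :
    ENNReal.ofReal (t ^ (-s)) ≤ 2 ^ |s| * 2 ^ ((k:ℝ) * s) ∧ (2:ℝ≥0∞) ^ ((k:ℝ) * s) ≤ 2 ^ |s| * ENNReal.ofReal (t ^ (-s)) := by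
  have ht : 0 < t := lt_of_lt_of_le (by positivity) h1
  have e0 : (2:ℝ) ^ (Real.logb 2 t) = t := Real.rpow_logb (by norm_num) (by norm_num) ht
  set a := Real.logb 2 t with ha
  have l1 : -((k:ℝ) + 1) ≤ a := by
    rw [← e0] at h1
    rw [← Real.rpow_natCast, ← Real.rpow_neg (by norm_num)] at h1
    have := (Real.rpow_le_rpow_left_iff (by norm_num : (1:ℝ) < 2)).mp h1
    push_cast at this; linarith
  have l2 : a ≤ 1 - k := by
    rw [← e0] at h2
    have h3 : (2:ℝ) * ((2:ℝ)^k)⁻¹ = 2 ^ (1 - (k:ℝ)) := by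
      rw [Real.rpow_sub (by norm_num), Real.rpow_one, Real.rpow_natCast]; rfl
    rw [h3] at h2
    exact (Real.rpow_le_rpow_left_iff (by norm_num : (1:ℝ) < 2)).mp h2
  have e1 : ENNReal.ofReal (t ^ (-s)) = 2 ^ (-(a * s)) := by
    rw [← e0, ← Real.rpow_mul (by norm_num), ← ENNReal.ofReal_rpow_of_pos (by norm_num)]; simp
  have l3 : |(a + k) * s| ≤ |s| := by
    rw [abs_mul]
    refine mul_le_of_le_one_left (abs_nonneg _) ?_
    rw [abs_le]; constructor <;> linarith
  rw [abs_le] at l3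
  rw [e1, ← two_rpow_add, ← two_rpow_add]
  constructor
  · refine ENNReal.rpow_le_rpow_of_exponent_le (by norm_num) ?_; nlinarith
  · refine ENNReal.rpow_le_rpow_of_exponent_le (by norm_num) ?_; nlinarith

/-- continuous `L_q(dt/t)` quasi-norm -/
def contQ (s : ℝ) (q : ℝ≥0∞) (g : ℝ → ℝ≥0∞) : ℝ≥0∞ :=
  if q = ∞ then essSup (fun t : ℝ => ENNReal.ofReal (t ^ (-s)) * g t) (volume.restrict (Ioc (0 : ℝ) 1))
  else (∫⁻ t in Ioc (0 : ℝ) 1, (ENNReal.ofReal (t ^ (-s)) * g t) ^ q.toReal * ENNReal.ofReal t⁻¹) ^ (1 / q.toReal)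

lemma le_lqSum {q : ℝ≥0∞} (hq : 0 < q) (a : ℕ → ℝ≥0∞) (j : ℕ) : a j ≤ lqSum q a := by
  unfold lqSum
  split_ifs with h
  · exact le_iSup a j
  · have hq' : 0 < q.toReal := ENNReal.toReal_pos hq.ne' h
    calc a j = (a j ^ q.toReal) ^ (1 / q.toReal) := by
          rw [← ENNReal.rpow_mul, mul_one_div_cancel hq'.ne', ENNReal.rpow_one]
      _ ≤ _ := ENNReal.rpow_le_rpow (ENNReal.le_tsum j) (by positivity)

lemma block_exists {t : ℝ} (h : t ∈ Ioc (0:ℝ) 1) : ∃ k : ℕ, t ∈ Ioc (((2:ℝ)^(k+1))⁻¹) (((2:ℝ)^k)⁻¹) := by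
  obtain ⟨k, h1, h2⟩ := exists_nat_pow_near_of_lt_one (x := t) (y := (2:ℝ)⁻¹) h.1 h.2 (by norm_num) (by norm_num)
  exact ⟨k, by rw [← inv_pow]; exact h1, by rw [← inv_pow]; exact h2⟩

lemma block_le {k : ℕ} {t : ℝ} (h : t ≤ ((2:ℝ)^k)⁻¹) : t ≤ 2 * ((2:ℝ)^k)⁻¹ := by
  have : 0 < ((2:ℝ)^k)⁻¹ := by positivity
  linarith

lemma contQ_le {s : ℝ} {q : ℝ≥0∞} (hq : 0 < q) (g : ℝ → ℝ≥0∞) (v : ℕ → ℝ≥0∞)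
    (h : ∀ k, ∀ t ∈ Ioc (((2:ℝ)^(k+1))⁻¹) (((2:ℝ)^k)⁻¹), g t ≤ v k) :
    contQ s q g ≤ 2 ^ |s| * lqSum q (fun k => 2 ^ ((k:ℝ) * s) * v k) := by
  have hpt : ∀ k : ℕ, ∀ t ∈ Ioc (((2:ℝ)^(k+1))⁻¹) (((2:ℝ)^k)⁻¹), ENNReal.ofReal (t ^ (-s)) * g t ≤
      2 ^ |s| * (2 ^ ((k:ℝ) * s) * v k) := by
    intro k t ht
    rw [← mul_assoc]
    exact mul_le_mul' (rpow_cmp s k ht.1.le (block_le ht.2)).1 (h k t ht)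
  rw [← lqSum_mul hq]
  unfold contQ
  split_ifs with hq'
  · refine essSup_le_of_ae_le _ ?_
    refine (ae_restrict_iff' measurableSet_Ioc).mpr (Eventually.of_forall fun t ht => ?_)
    obtain ⟨k, hk⟩ := block_exists ht
    exact (hpt k t hk).trans (le_lqSum hq (fun k : ℕ => 2 ^ |s| * (2 ^ ((k:ℝ) * s) * v k)) k)
  · have hq0 : 0 < q.toReal := ENNReal.toReal_pos hq.ne' hq'
    unfold lqSum
    rw [if_neg hq']
    refine ENNReal.rpow_le_rpow ?_ (by positivity)
    calc _ ≤ ∫⁻ t in ⋃ k : ℕ, Ioc (((2:ℝ)^(k+1))⁻¹) (((2:ℝ)^k)⁻¹), (ENNReal.ofReal (t ^ (-s)) * g t) ^ q.toReal * ENNReal.ofReal t⁻¹ :=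
          lintegral_mono_set fun t ht => by
            obtain ⟨k, hk⟩ := block_exists ht
            exact mem_iUnion.mpr ⟨k, hk⟩
      _ ≤ ∑' k : ℕ, ∫⁻ t in Ioc (((2:ℝ)^(k+1))⁻¹) (((2:ℝ)^k)⁻¹), (ENNReal.ofReal (t ^ (-s)) * g t) ^ q.toReal * ENNReal.ofReal t⁻¹ :=
          lintegral_iUnion_le _ _
      _ ≤ _ := ENNReal.tsum_le_tsum fun k => ?_
    calc _ ≤ ∫⁻ t in Ioc (((2:ℝ)^(k+1))⁻¹) (((2:ℝ)^k)⁻¹), (2 ^ |s| * (2 ^ ((k:ℝ) * s) * v k)) ^ q.toReal * ENNReal.ofReal (2^(k+1)) := by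
          refine setLIntegral_mono (by fun_prop) fun t ht => ?_
          refine mul_le_mul' (ENNReal.rpow_le_rpow (hpt k t ht) hq0.le) (ENNReal.ofReal_le_ofReal ?_)
          exact inv_le_of_inv_le₀ (by positivity) ht.1.le
      _ ≤ _ := by
          rw [lintegral_const, Measure.restrict_apply_univ, Real.volume_Ioc, mul_assoc, ← ENNReal.ofReal_mul (by positivity)]
          refine mul_le_of_le_one_right bot_le ?_
          rw [ENNReal.ofReal_le_one, pow_succ]
          apply le_of_eq; field_simp; norm_num

lemma r_exists {p : ℝ} {q : ℝ≥0∞} (hp : 0 < p) (hq : 0 < q) : ∃ r : ℝ, 0 < r ∧ r ≤ 1 ∧ r < p ∧ ENNReal.ofReal r ≤ q := by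
  by_cases h : q = ∞
  · exact ⟨min 1 (p/2), by positivity, min_le_left _ _, (min_le_right _ _).trans_lt (by linarith), by simp [h]⟩
  · have hq0 : 0 < q.toReal := ENNReal.toReal_pos hq.ne' h
    refine ⟨min (min 1 (p/2)) q.toReal, by positivity, (min_le_left _ _).trans (min_le_left _ _),
      ((min_le_left _ _).trans (min_le_right _ _)).trans_lt (by linarith), ?_⟩
    exact (ENNReal.ofReal_le_ofReal (min_le_right _ _)).trans (ENNReal.ofReal_toReal_le)

lemma lpN_le {n : ℕ} {p : ℝ≥0∞} (hp : 0 < p) (hp' : p ≠ ∞) {C : ℝ≥0∞} {g h : Rn n → ℝ≥0∞}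
    (H : ∫⁻ x, g x ^ p.toReal ≤ C * ∫⁻ x, h x ^ p.toReal) : lpNormENN p g ≤ C ^ (1 / p.toReal) * lpNormENN p h := by
  have h0 : 0 < p.toReal := ENNReal.toReal_pos hp.ne' hp'
  unfold lpNormENN
  rw [if_neg hp', if_neg hp', ← ENNReal.mul_rpow_of_nonneg _ _ (by positivity)]
  exact ENNReal.rpow_le_rpow H (by positivity)

lemma lpN_mono {n : ℕ} {p : ℝ≥0∞} (hp' : p ≠ ∞) {g h : Rn n → ℝ≥0∞} (H : ∀ x, g x ≤ h x) : lpNormENN p g ≤ lpNormENN p h := by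
  unfold lpNormENN
  rw [if_neg hp', if_neg hp']
  refine ENNReal.rpow_le_rpow (lintegral_mono fun x => ENNReal.rpow_le_rpow (H x) ?_) ?_ <;> positivity

lemma lpN_mul {n : ℕ} {p : ℝ≥0∞} (hp : 0 < p) (hp' : p ≠ ∞) {C : ℝ≥0∞} (hC : C ≠ ∞) (g : Rn n → ℝ≥0∞) :
    lpNormENN p (fun x => C * g x) = C * lpNormENN p g := by
  have h0 : 0 < p.toReal := ENNReal.toReal_pos hp.ne' hp'
  unfold lpNormENN
  rw [if_neg hp', if_neg hp']
  simp_rw [ENNReal.mul_rpow_of_nonneg _ _ h0.le]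
  rw [lintegral_const_mul' _ _ (ENNReal.rpow_ne_top_of_nonneg h0.le hC), ENNReal.mul_rpow_of_nonneg _ _ (by positivity),
    ← ENNReal.rpow_mul, mul_one_div_cancel h0.ne', ENNReal.rpow_one]

lemma dilate_one {n : ℕ} (ψ : Sch n) : dilate ψ 1 = ψ := by
  ext x; rw [dilate_apply _ one_ne_zero, one_smul]

lemma sup_le_phi (n : ℕ) {s d : ℝ} {p q : ℝ≥0∞} (hp : 0 < p) (hp' : p ≠ ∞) (hq : 0 < q) (hd : 0 < d)
    {φ : ℕ → Sch n} (hφ : SmoothResolution n φ) (Ψ ψ : Sch n) (σ : ℕ) (hσ : s < σ) (hv : Van σ ψ) :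
    ∃ C : ℝ≥0∞, C ≠ ∞ ∧ ∀ (E : Type uE) [NormedAddCommGroup E] [NormedSpace ℂ E] (f : TDist n E),
      triebelContNormSup s p q d Ψ ψ f ≤ C * triebelNorm s p q φ f := by
  have hp0 : 0 < p.toReal := ENNReal.toReal_pos hp.ne' hp'
  obtain ⟨r, hr, hr1, hrp, hrq⟩ := r_exists hp0 hq
  set δ : ℝ := σ - s with hδ
  have hδ0 : 0 < δ := by linarith
  obtain ⟨N, hN⟩ := pre_ineq n s δ hr hr1
  obtain ⟨Ca, hCa, ha⟩ := key2.{uE} n N σ hδ hd hφ ψ σ hv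
  obtain ⟨Cb, hCb, hb⟩ := key2.{uE} n N σ hδ hd hφ Ψ 0 (van_of 0 Ψ (by intro i hi; omega))
  obtain ⟨CN, hCN, hH⟩ := H1_phi.{uE} n hφ
  have hCab : Ca + Cb ≠ ∞ := ENNReal.add_ne_top.mpr ⟨hCa, hCb⟩
  obtain ⟨B, hB, hB'⟩ := hN CN hCN (Ca + Cb) hCab
  obtain ⟨C, hC, hm⟩ := main_ineq n hr hrp hrq (mul_pos hδ0 hr) hB
  refine ⟨(1 + 2 ^ |s|) * C ^ (1 / p.toReal), ENNReal.mul_ne_top (ENNReal.add_ne_top.mpr ⟨by simp, ENNReal.rpow_ne_top_of_nonneg (abs_nonneg _) (by simp)⟩)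
    (ENNReal.rpow_ne_top_of_nonneg (by positivity) hC), fun E _ _ f => ?_⟩
  set v : ℕ → Rn n → ℝ≥0∞ := fun k x => (Ca + Cb) * ∑' j, ac s δ k j * ∫⁻ z, ker j N (x - z) * ‖mOp (φ j) f z‖ₑ with hvdef
  have hX := hm (fun k x => 2 ^ ((k:ℝ) * s) * v k x) (fun j x => (2 : ℝ≥0∞) ^ ((j : ℝ) * s) * (‖mOp (φ j) f x‖₊ : ℝ≥0∞))
    (fun j => ((mOp_continuous (φ j) f).enorm.measurable.const_mul _))
    (fun k x => hB' (fun j x => ‖mOp (φ j) f x‖ₑ) (Gr_of φ (QQ_phi hφ) f) (hH E f) (v k x) k x le_rfl)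
  have hX' := lpN_le hp hp' hX
  have e1 : ∀ x, supBall d (mOp Ψ f) x ≤ lqSum q (fun k => 2 ^ ((k:ℝ) * s) * v k x) := by
    intro x
    refine le_trans ?_ (le_lqSum hq (fun k : ℕ => 2 ^ ((k:ℝ) * s) * v k x) 0)
    simp only [Nat.cast_zero, zero_mul, ENNReal.rpow_zero, one_mul]
    refine iSup₂_le fun y hy => ?_
    have := hb E f 0 1 x y (Or.inr rfl) (by norm_num) (by norm_num) (by simpa using hy)
    rw [dilate_one] at this
    exact this.trans (mul_le_mul_left le_add_self _)
  have e2 : ∀ x, contQ s q (fun t => supLocal d ψ f t x) ≤ 2 ^ |s| * lqSum q (fun k => 2 ^ ((k:ℝ) * s) * v k x) := by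
    intro x
    refine contQ_le hq _ _ fun k t ht => ?_
    refine iSup₂_le fun y hy => iSup₂_le fun τ hτ => ?_
    refine (ha E f k τ x y (Or.inl rfl) (ht.1.le.trans hτ.1) (hτ.2.trans (by linarith [ht.2])) (hy.trans (by gcongr; exact ht.2))).trans ?_
    exact mul_le_mul_left le_self_add _
  have e1' := lpN_mono hp' e1
  have e2' := lpN_mono hp' e2
  rw [lpN_mul hp hp' (ENNReal.rpow_ne_top_of_nonneg (abs_nonneg _) (by simp))] at e2'
  calc triebelContNormSup s p q d Ψ ψ f ≤ lpNormENN p (fun x => lqSum q (fun k => 2 ^ ((k:ℝ) * s) * v k x)) +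
        2 ^ |s| * lpNormENN p (fun x => lqSum q (fun k => 2 ^ ((k:ℝ) * s) * v k x)) := add_le_add e1' e2'
    _ = (1 + 2 ^ |s|) * lpNormENN p (fun x => lqSum q (fun k => 2 ^ ((k:ℝ) * s) * v k x)) := by ring
    _ ≤ _ := by rw [mul_assoc]; exact mul_le_mul_right hX' _

lemma I_le_sup (n : ℕ) {s d : ℝ} {p q : ℝ≥0∞} (hp : 0 < p) (hp' : p ≠ ∞) (hd : 0 < d) (Ψ ψ : Sch n)
    {E : Type*} [NormedAddCommGroup E] [NormedSpace ℂ E] (f : TDist n E) :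
    triebelContNormI s p q Ψ ψ f ≤ triebelContNormSup s p q d Ψ ψ f := by
  have h0 : ∀ t, t ∈ Ioc (0:ℝ) 1 → ∀ x, (‖mOp (dilate ψ t) f x‖₊ : ℝ≥0∞) ≤ supLocal d ψ f t x := by
    intro t ht x
    unfold supLocal
    exact le_iSup₂_of_le x (by rw [dist_self]; exact mul_nonneg hd.le ht.1.le) (le_iSup₂_of_le t ⟨le_rfl, by linarith [ht.1]⟩ le_rfl)
  unfold triebelContNormI triebelContNormSup
  refine add_le_add ?_ (lpN_mono hp' fun x => ?_)
  · rw [eLpNorm_eq_lintegral_rpow_enorm_toReal hp.ne' hp']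
    unfold lpNormENN
    rw [if_neg hp']
    refine ENNReal.rpow_le_rpow (lintegral_mono fun x => ENNReal.rpow_le_rpow ?_ ENNReal.toReal_nonneg) (by positivity)
    exact le_iSup₂_of_le (f := fun y (_ : dist x y ≤ d) => (‖mOp Ψ f y‖₊ : ℝ≥0∞)) x (by simpa using hd.le) le_rfl
  · split_ifs with h
    · refine essSup_mono_ae ?_
      refine (ae_restrict_iff' measurableSet_Ioc).mpr (Eventually.of_forall fun t ht => ?_)
      exact mul_le_mul_right (h0 t ht x) _
    · refine ENNReal.rpow_le_rpow (lintegral_mono_ae ?_) (by positivity)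
      refine (ae_restrict_iff' measurableSet_Ioc).mpr (Eventually.of_forall fun t ht => ?_)
      have := h0 t ht x
      gcongr

end TL

namespace TL
universe uE

/-- cut-off data adapted to `Ψ`, `ψ` -/
structure Dat {n : ℕ} (ε : ℝ) (Ψ ψ θ χ ω ω0 : Sch n) : Prop where
  eps : 0 < ε
  chi : ∀ ξ, χ ξ = θ ξ - θ ((2:ℝ) • ξ)
  one : ∀ ξ, ‖ξ‖ ≤ ε → θ ξ = 1
  zero : ∀ ξ, 3 * ε / 2 ≤ ‖ξ‖ → θ ξ = 0
  om : ∀ t ∈ Icc (9/8 : ℝ) (5/4), ∀ ξ, χ ξ * ω (t • ξ) * ψ (t • ξ) = χ ξ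
  om0 : ∀ ξ, θ ξ * ω0 ξ * Ψ ξ = θ ξ

lemma dat_exists {n : ℕ} {ε : ℝ} (hε : 0 < ε) {Ψ ψ : Sch n}
    (hΨ : ∀ x : Rn n, ‖x‖ < 2 * ε → 0 < ‖Ψ x‖)
    (hψ : ∀ x : Rn n, ε / 2 < ‖x‖ → ‖x‖ < 2 * ε → 0 < ‖ψ x‖) : ∃ θ χ ω ω0 : Sch n, Dat ε Ψ ψ θ χ ω ω0 := by
  obtain ⟨θ, h1, h2⟩ := cutoff_exists n (a := ε) (b := 3 * ε / 2) hε (by linarith)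
  obtain ⟨θ1, a1, a2⟩ := cutoff_exists n (a := 17 * ε / 32) (b := 9 * ε / 16) (by positivity) (by linarith)
  obtain ⟨θ2, b1, b2⟩ := cutoff_exists n (a := 15 * ε / 8) (b := 31 * ε / 16) (by positivity) (by linarith)
  obtain ⟨θ3, c1, c2⟩ := cutoff_exists n (a := 3 * ε / 2) (b := 7 * ε / 4) (by positivity) (by linarith)
  obtain ⟨ω, hω⟩ := div_exists (θ2 - θ1) ψ (R := 31 * ε / 16) (fun ξ h => by rw [sub_apply, b2 ξ h, a2 ξ (by linarith), sub_self])
    (K := {ξ | 17 * ε / 32 ≤ ‖ξ‖ ∧ ‖ξ‖ ≤ 31 * ε / 16})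
    ((isClosed_le continuous_const continuous_norm).inter (isClosed_le continuous_norm continuous_const))
    (fun ξ h => by
      by_contra h'
      apply h
      rw [sub_apply]
      by_cases h3 : 17 * ε / 32 ≤ ‖ξ‖
      · have h4 : 31 * ε / 16 < ‖ξ‖ := by by_contra h4; push Not at h4; exact h' ⟨h3, h4⟩
        rw [b2 ξ h4.le, a2 ξ (by linarith), sub_self]
      · push Not at h3
        rw [b1 ξ (by linarith), a1 ξ h3.le, sub_self])
    (fun ξ h => norm_pos_iff.mp (hψ ξ (by linarith [h.1]) (by linarith [h.2])))
  obtain ⟨ω0, hω0⟩ := div_exists θ3 Ψ (R := 7 * ε / 4) c2 (K := {ξ | ‖ξ‖ ≤ 7 * ε / 4})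
    (isClosed_le continuous_norm continuous_const)
    (fun ξ h => by
      by_contra h'
      simp only [mem_ofPred_eq] at h'
      push Not at h'
      exact h (c2 ξ h'.le))
    (fun ξ h => norm_pos_iff.mp (hΨ ξ (by simp only [mem_ofPred_eq] at h; linarith)))
  refine ⟨θ, θ - dilate θ 2, ω, ω0, hε, fun ξ => ?_, h1, h2, fun t ht ξ => ?_, fun ξ => ?_⟩
  · rw [sub_apply, dilate_apply _ (by norm_num)]
  · rw [sub_apply, dilate_apply _ (by norm_num)]
    have e2 : ‖(2:ℝ) • ξ‖ = 2 * ‖ξ‖ := by rw [norm_smul, Real.norm_of_nonneg (by norm_num)]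
    have et : ‖t • ξ‖ = t * ‖ξ‖ := by rw [norm_smul, Real.norm_of_nonneg (by linarith [ht.1])]
    by_cases h3 : ‖ξ‖ ≤ ε / 2
    · rw [h1 ξ (by linarith), h1 ((2:ℝ) • ξ) (by rw [e2]; linarith)]; simp
    push Not at h3
    by_cases h4 : 3 * ε / 2 ≤ ‖ξ‖
    · rw [h2 ξ h4, h2 ((2:ℝ) • ξ) (by rw [e2]; linarith)]; simp
    push Not at h4
    rw [mul_assoc, hω, sub_apply, b1 _ (by rw [et]; nlinarith [ht.1, ht.2, norm_nonneg ξ]), a2 _ (by rw [et]; nlinarith [ht.1, ht.2, norm_nonneg ξ])]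
    simp
  · by_cases h4 : 3 * ε / 2 ≤ ‖ξ‖
    · rw [h2 ξ h4]; simp
    · push Not at h4
      rw [mul_assoc, hω0, c1 ξ h4.le, mul_one]

/-- the analysing symbols -/
def bb' {n : ℕ} (Ψ ψ : Sch n) (t : ℝ) (k : ℕ) : Sch n := if k = 0 then Ψ else dilate ψ (t * ((2:ℝ)^k)⁻¹)

/-- the localized inverse symbols -/
def LL {n : ℕ} (θ χ ω ω0 : Sch n) (t : ℝ) (k : ℕ) : Sch n := if k = 0 then mulS θ ω0 else mulS χ (dilate ω t)

section
variable {n : ℕ} {ε : ℝ} {Ψ ψ θ χ ω ω0 : Sch n}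

lemma chi_zero (D : Dat ε Ψ ψ θ χ ω ω0) {ξ : Rn n} (h : ‖ξ‖ < ε / 2) : χ ξ = 0 := by
  have e2 : ‖(2:ℝ) • ξ‖ = 2 * ‖ξ‖ := by rw [norm_smul, Real.norm_of_nonneg (by norm_num)]
  have := D.eps
  rw [D.chi, D.one ξ (by linarith), D.one _ (by rw [e2]; linarith), sub_self]

lemma chi_zero' (D : Dat ε Ψ ψ θ χ ω ω0) {ξ : Rn n} (h : 3 * ε / 2 ≤ ‖ξ‖) : χ ξ = 0 := by
  have e2 : ‖(2:ℝ) • ξ‖ = 2 * ‖ξ‖ := by rw [norm_smul, Real.norm_of_nonneg (by norm_num)]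
  have := D.eps
  rw [D.chi, D.zero ξ h, D.zero _ (by rw [e2]; linarith), sub_self]

lemma theta_cut (D : Dat ε Ψ ψ θ χ ω ω0) : Cut (fun J ξ => θ (((2:ℝ) ^ (J - 1))⁻¹ • ξ)) where
  smooth J := smooth_smul θ _
  one := by
    have := D.eps
    refine ⟨ε / 2, by positivity, fun J hJ ξ h => D.one _ ?_⟩
    obtain ⟨J, rfl⟩ := Nat.exists_eq_add_of_le' hJ
    rw [norm_smul, Real.norm_of_nonneg (by positivity), Nat.add_sub_cancel, inv_mul_le_iff₀ (by positivity)]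
    rw [pow_succ] at h; linarith
  bd l := by
    have hQ := QQ_nonneg l θ
    refine ⟨2 ^ l * QQ l θ, fun J ξ => ?_⟩
    rw [norm_iFD_smul (θ.smooth ⊤)]
    have h1 := le_QQ (Nat.zero_le l) (le_refl l) θ (((2:ℝ) ^ (J - 1))⁻¹ • ξ)
    rw [pow_zero, one_mul] at h1
    have h2 : |((2:ℝ) ^ (J - 1))⁻¹| ^ l ≤ 1 := by
      rw [abs_of_pos (by positivity)]
      exact pow_le_one₀ (by positivity) (inv_le_one_of_one_le₀ (one_le_pow₀ (by norm_num)))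
    calc _ ≤ 1 * (2 ^ l * QQ l θ) := mul_le_mul h2 h1 (norm_nonneg _) zero_le_one
      _ ≤ _ := by
        have : (0:ℝ) ≤ J := by positivity
        have : 0 ≤ 2 ^ l * QQ l θ := by positivity
        nlinarith

lemma tele (D : Dat ε Ψ ψ θ χ ω ω0) (j : ℕ) (ξ : Rn n) (i : ℕ) :
    θ (((2:ℝ)^j)⁻¹ • ξ) + ∑ k ∈ Finset.range i, χ (((2:ℝ)^(j+1+k))⁻¹ • ξ) = θ (((2:ℝ)^(j+i))⁻¹ • ξ) := by
  induction i with
  | zero => simp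
  | succ i ih =>
    rw [Finset.sum_range_succ, ← add_assoc, ih, D.chi, smul_smul,
      show (2:ℝ) * ((2:ℝ)^(j+1+i))⁻¹ = ((2:ℝ)^(j+i))⁻¹ by rw [show j+1+i = (j+i)+1 by ring, pow_succ]; field_simp,
      show j+1+i = j+(i+1) by ring]
    ring

lemma LL_bb (D : Dat ε Ψ ψ θ χ ω ω0) {t : ℝ} (ht : t ∈ Icc (9/8 : ℝ) (5/4)) (k : ℕ) (ξ : Rn n) :
    LL θ χ ω ω0 t k (((2:ℝ)^k)⁻¹ • ξ) * bb' Ψ ψ t k ξ = if k = 0 then θ ξ else χ (((2:ℝ)^k)⁻¹ • ξ) := by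
  have ht0 : 0 < t := by linarith [ht.1]
  unfold LL bb'
  split_ifs with h
  · subst h; simp only [pow_zero, inv_one, one_smul, mulS_apply]; exact D.om0 ξ
  · rw [mulS_apply, dilate_apply _ ht0.ne', dilate_apply _ (by positivity), mul_smul]
    exact D.om t ht _

lemma LL_bd (θ χ ω ω0 : Sch n) (m : ℕ) : ∃ C : ℝ, 0 ≤ C ∧ ∀ t ∈ Icc (9/8 : ℝ) (5/4), ∀ k, QQ m (LL θ χ ω ω0 t k) ≤ C := by
  have h1 := QQ_nonneg m θ
  have h2 := QQ_nonneg m ω0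
  have h3 := QQ_nonneg m χ
  have h4 := QQ_nonneg m ω
  refine ⟨2 ^ m * QQ m θ * (2 ^ m * 2 ^ m * QQ m ω0) + 2 ^ m * QQ m χ * (2 ^ m * 2 ^ m * (3 ^ m * 2 ^ m * (2 ^ m * QQ m ω))), by positivity, fun t ht k => ?_⟩
  have ht0 : 0 < t := by linarith [ht.1]
  unfold LL
  split_ifs with h
  · exact (QQ_mulS m θ ω0).trans (le_add_of_nonneg_right (by positivity))
  · refine (QQ_mulS m χ _).trans (le_trans ?_ (le_add_of_nonneg_left (by positivity)))
    have h5 : t⁻¹ ≤ 1 := inv_le_one_of_one_le₀ (by linarith [ht.1])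
    have h6 : QQ m (dilate ω t) ≤ 3 ^ m * 2 ^ m * (2 ^ m * QQ m ω) := by
      refine (QQ_dilate m ω ht0).trans ?_
      gcongr
      · linarith [ht.2]
      · linarith
    gcongr

lemma LL_zero (D : Dat ε Ψ ψ θ χ ω ω0) (t : ℝ) {k : ℕ} (hk : k ≠ 0) {ξ : Rn n} (h : ‖ξ‖ < ε / 2) : LL θ χ ω ω0 t k ξ = 0 := by
  unfold LL; rw [if_neg hk, mulS_apply, chi_zero D h, zero_mul]

lemma LL_zero' (D : Dat ε Ψ ψ θ χ ω ω0) (t : ℝ) (k : ℕ) {ξ : Rn n} (h : 3 * ε / 2 ≤ ‖ξ‖) : LL θ χ ω ω0 t k ξ = 0 := by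
  unfold LL
  split_ifs
  · rw [mulS_apply, D.zero ξ h, zero_mul]
  · rw [mulS_apply, chi_zero' D h, zero_mul]

lemma QQ_bb (Ψ ψ : Sch n) {t : ℝ} (ht : t ∈ Icc (9/8 : ℝ) (5/4)) (m : ℕ) : ∃ C : ℝ, 0 ≤ C ∧ ∀ j, QQ m (bb' Ψ ψ t j) ≤ C * (2 ^ j) ^ m := by
  have h1 := QQ_nonneg m Ψ
  have h2 := QQ_nonneg m ψ
  have ht0 : 0 < t := by linarith [ht.1]
  refine ⟨QQ m Ψ + 3 ^ m * 2 ^ m * (2 ^ m * QQ m ψ), by positivity, fun j => ?_⟩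
  have hj : (1:ℝ) ≤ 2 ^ j := one_le_pow₀ (by norm_num)
  unfold bb'
  split_ifs with h
  · subst h; simp only [pow_zero, one_pow, mul_one]
    exact le_add_of_nonneg_right (by positivity)
  · refine (QQ_dilate m ψ (by positivity)).trans ?_
    have h3 : t * ((2:ℝ)^j)⁻¹ ≤ 2 := by
      have : ((2:ℝ)^j)⁻¹ ≤ 1 := inv_le_one_of_one_le₀ hj
      have : 0 < ((2:ℝ)^j)⁻¹ := by positivity
      nlinarith [ht.2]
    have h4 : (t * ((2:ℝ)^j)⁻¹)⁻¹ ≤ 2 ^ j := by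
      rw [mul_inv, inv_inv]
      exact mul_le_of_le_one_left (by positivity) (inv_le_one_of_one_le₀ (by linarith [ht.1]))
    calc _ ≤ (3:ℝ) ^ m * (2 * 2 ^ j) ^ m * (2 ^ m * QQ m ψ) := by
          gcongr
          · linarith
          · linarith
      _ = 3 ^ m * 2 ^ m * (2 ^ m * QQ m ψ) * (2 ^ j) ^ m := by rw [mul_pow]; ring
      _ ≤ _ := by gcongr; linarith

lemma psi_expand (n N : ℕ) {ε : ℝ} {Ψ ψ θ χ ω ω0 : Sch n} (D : Dat ε Ψ ψ θ χ ω ω0) :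
    ∃ (m : ℕ) (C : ℝ), 0 ≤ C ∧
    ∀ (E : Type uE) [NormedAddCommGroup E] [NormedSpace ℂ E] (f : TDist n E) (y : Rn n) (h : Sch n), ∀ t ∈ Icc (9/8 : ℝ) (5/4),
    ‖mOp h f y‖ₑ ≤ ENNReal.ofReal C * ∑' j, ENNReal.ofReal (QQ m (mulS (dilate h ((2:ℝ)^j)) (LL θ χ ω ω0 t j))) *
      ∫⁻ z, ker j N (y - z) * ‖mOp (bb' Ψ ψ t j) f z‖ₑ := by
  obtain ⟨m, C, hC, hm⟩ := master n N
  refine ⟨m, C, hC, fun E _ _ f y h t ht => hm E f y _ _ _ h (fun k => le_rfl) ?_⟩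
  intro m'
  refine cut_tendsto (theta_cut D) h _ 1 (fun J hJ ξ => ?_) m'
  obtain ⟨J, rfl⟩ := Nat.exists_eq_add_of_le' hJ
  rw [sum_apply', Nat.add_sub_cancel]
  have e : ∀ k, mulS (dilate (mulS (dilate h ((2:ℝ)^k)) (LL θ χ ω ω0 t k)) ((2:ℝ)^k)⁻¹) (bb' Ψ ψ t k) ξ =
      h ξ * (if k = 0 then θ ξ else χ (((2:ℝ)^k)⁻¹ • ξ)) := by
    intro k
    rw [mulS_apply, dilate_apply _ (by positivity), mulS_apply, dilate_apply _ (by positivity), mul_assoc, LL_bb D ht, smul_smul,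
      mul_inv_cancel₀ (by positivity), one_smul]
  simp only [e]
  rw [← Finset.mul_sum, Finset.sum_range_succ', if_pos rfl]
  congr 1
  have := tele D 0 ξ J
  simp only [pow_zero, inv_one, one_smul, zero_add] at this
  rw [← this, add_comm]
  congr 1
  refine Finset.sum_congr rfl fun k _ => ?_
  rw [if_neg (by omega), add_comm]

end

end TL

namespace TL
universe uE

lemma tsum_shift_le (a : ℕ → ℝ≥0∞) (j : ℕ) (h : ∀ k < j, a k = 0) : ∑' k, a k = ∑' l, a (j + l) := by
  refine ((add_right_injective j).tsum_eq (f := a) fun k hk => ?_).symm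
  by_contra h'
  refine hk (h k ?_)
  by_contra h''
  exact h' ⟨k - j, by simp only; omega⟩

lemma QQ_bbLL {n : ℕ} {ε : ℝ} {Ψ ψ θ χ ω ω0 : Sch n} (D : Dat ε Ψ ψ θ χ ω ω0) (m M : ℕ) : ∃ C : ℝ, 0 ≤ C ∧ ∀ t ∈ Icc (9/8 : ℝ) (5/4),
    ∀ j l, QQ m (mulS (dilate (bb' Ψ ψ t j) ((2:ℝ)^(j+(l+1)))) (LL θ χ ω ω0 t (j+(l+1)))) ≤ C * ((2:ℝ)^((l+1)*M))⁻¹ := by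
  have hε := D.eps
  obtain ⟨C1, hC1, h1⟩ := QQ_high Ψ (ρ := ε / 2) (by positivity) m M
  obtain ⟨C2, hC2, h2⟩ := QQ_high ψ (ρ := ε / 2) (by positivity) m M
  obtain ⟨C3, hC3, h3⟩ := LL_bd θ χ ω ω0 m
  refine ⟨(C1 + C2) * C3, by positivity, fun t ht j l => ?_⟩
  have ht0 : 0 < t := by linarith [ht.1]
  have h4 := h3 t ht (j+(l+1))
  have h5 := QQ_nonneg m (LL θ χ ω ω0 t (j+(l+1)))
  have hl : (1:ℝ) ≤ 2 ^ (l+1) := one_le_pow₀ (by norm_num)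
  rcases Nat.eq_zero_or_pos j with rfl | hj
  · simp only [zero_add] at h4 h5 ⊢
    refine (h1 (2 ^ (l+1)) hl (LL θ χ ω ω0 t (l+1)) _ (fun ξ h => LL_zero D t (by omega) h) (fun ξ => ?_)).trans ?_
    · rw [mulS_apply, dilate_apply _ (by positivity)]; simp [bb']
    · rw [pow_mul]; gcongr; exact le_add_of_nonneg_right hC2
  · refine (h2 (t * 2 ^ (l+1)) (by nlinarith [ht.1]) (LL θ χ ω ω0 t (j+(l+1))) _ (fun ξ h => LL_zero D t (by omega) h) (fun ξ => ?_)).trans ?_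
    · rw [mulS_apply, dilate_apply _ (by positivity), bb', if_neg hj.ne', dilate_apply _ (by positivity), smul_smul]
      congr 3
      rw [pow_add]; field_simp
    · rw [pow_mul]; gcongr
      · exact le_add_of_nonneg_left hC1
      · exact le_mul_of_one_le_left (by positivity) (by linarith [ht.1])

lemma H1_psi (n : ℕ) {ε : ℝ} {Ψ ψ θ χ ω ω0 : Sch n} (D : Dat ε Ψ ψ θ χ ω ω0) :
    ∃ CN : ℕ → ℝ≥0∞, (∀ N, CN N ≠ ∞) ∧ ∀ (E : Type uE) [NormedAddCommGroup E] [NormedSpace ℂ E] (f : TDist n E),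
      ∀ t ∈ Icc (9/8 : ℝ) (5/4), H1 CN (fun j x => ‖mOp (bb' Ψ ψ t j) f x‖ₑ) := by
  choose m C hC hm using fun N => master.{uE} n N
  choose C1 hC1 h1 using fun N => QQ_bbLL D (m N) N
  have hQ : ∀ N, 0 ≤ QQ (m N) θ := fun N => QQ_nonneg _ _
  refine ⟨fun N => ENNReal.ofReal (C N) * ENNReal.ofReal (QQ (m N) θ + C1 N), fun N => ENNReal.mul_ne_top ENNReal.ofReal_ne_top ENNReal.ofReal_ne_top,
    fun E _ _ f t ht N j x => ?_⟩
  have hC1' := hC1 N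
  have hQ' := hQ N
  have := hm N E f x (fun k => if k < j then 0 else if k = j then θ else mulS (dilate (bb' Ψ ψ t j) ((2:ℝ)^k)) (LL θ χ ω ω0 t k))
    (bb' Ψ ψ t) (fun k => if k < j then 0 else (QQ (m N) θ + C1 N) * ((2:ℝ)^((k-j)*N))⁻¹) (bb' Ψ ψ t j) (fun k => ?_) ?_
  · refine this.trans ?_
    rw [mul_assoc]
    refine mul_le_mul_right ?_ _
    rw [tsum_shift_le _ j (by intro k hk; simp [hk]), ← ENNReal.tsum_mul_left]
    refine ENNReal.tsum_le_tsum fun l => ?_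
    simp only [Nat.add_sub_cancel_left, show ¬ (j + l < j) by omega, if_false]
    rw [ENNReal.ofReal_mul (by positivity), mul_assoc]
  · by_cases hk : k < j
    · simp only [hk, if_true]; rw [QQ_zero]
    · simp only [hk, if_false]
      by_cases hk' : k = j
      · simp only [hk', if_true]; simp; exact hC1'
      · simp only [hk', if_false]
        obtain ⟨l, rfl⟩ := Nat.exists_eq_add_of_lt (show j < k by omega)
        refine (h1 N t ht j l).trans ?_
        rw [show j + l + 1 - j = l + 1 by omega]
        gcongr
        linarith
  · intro m'
    refine cut_tendsto (theta_cut D) _ _ (j+1) (fun J hJ ξ => ?_) m'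
    obtain ⟨i, rfl⟩ := Nat.exists_eq_add_of_le hJ
    rw [sum_apply', Finset.sum_range_add, Finset.sum_range_succ, Finset.sum_eq_zero, zero_add, show j + 1 + i - 1 = j + i by omega, ← tele D j ξ i, mul_add,
      Finset.mul_sum]
    · congr 1
      · rw [mulS_apply, dilate_apply _ (by positivity), if_neg (lt_irrefl _), if_pos rfl, mul_comm]
      · refine Finset.sum_congr rfl fun k _ => ?_
        rw [mulS_apply, dilate_apply _ (by positivity), if_neg (by omega), if_neg (by omega), mulS_apply, dilate_apply _ (by positivity),
          mul_assoc, LL_bb D ht, if_neg (by omega), smul_smul, mul_inv_cancel₀ (by positivity), one_smul]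
    · intro k hk
      rw [mulS_apply, dilate_apply _ (by positivity), if_pos (Finset.mem_range.mp hk)]; simp

lemma QQ_phiLL {n : ℕ} {ε : ℝ} {Ψ ψ θ χ ω ω0 : Sch n} (D : Dat ε Ψ ψ θ χ ω ω0) {φ : ℕ → Sch n} (hφ : SmoothResolution n φ) (s : ℝ) (m : ℕ) :
    ∃ C : ℝ, 0 ≤ C ∧ ∀ t ∈ Icc (9/8 : ℝ) (5/4), ∀ j k,
      ENNReal.ofReal (QQ m (mulS (dilate (φ j) ((2:ℝ)^k)) (LL θ χ ω ω0 t k))) ≤ ENNReal.ofReal C * ac s 1 j k := by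
  have hε := D.eps
  obtain ⟨c, hc⟩ : ∃ c : ℕ, 4 / ε + 3 * ε < 2 ^ c := pow_unbounded_of_one_lt _ (by norm_num)
  obtain ⟨C3, hC3, h3⟩ := LL_bd θ χ ω ω0 m
  obtain ⟨C4, hC4, h4⟩ := uniform_bd (P := fun l C => ∀ j ξ, ‖iteratedFDeriv ℝ l (φ j) ξ‖ ≤ C * ((2:ℝ) ^ (j * l))⁻¹)
    (fun l C C' h1 h2 j ξ => (h2 j ξ).trans (by gcongr)) (fun l => by obtain ⟨c, _, h⟩ := phi_bd hφ l; exact ⟨c, h⟩) m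
  set A := C4 * 2 ^ (c * m) * (2 ^ m * 2 ^ m * C3) with hA
  have hA0 : 0 ≤ A := by positivity
  refine ⟨A * 2 ^ ((|s| + 1) * c), by positivity, fun t ht j k => ?_⟩
  by_cases hjk : j ≤ k + c ∧ k ≤ j + c
  · have q1 : QQ m (mulS (dilate (φ j) ((2:ℝ)^k)) (LL θ χ ω ω0 t k)) ≤ A := by
      have := QQ_prod (σ := 0) (m := m) (A := C4 * 2 ^ (c * m)) ((dilate (φ j) ((2:ℝ)^k)).smooth ⊤) (by positivity) (mulS_apply _ (LL θ χ ω ω0 t k))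
        (fun ξ => Or.inr fun i hi => ?_)
      · refine this.trans ?_
        rw [add_zero, hA]
        gcongr
        exact h3 t ht k
      · rw [norm_iFD_dilate _ (by positivity), abs_of_pos (by positivity), pow_zero, mul_one]
        calc _ ≤ ((2:ℝ) ^ k) ^ i * (C4 * ((2:ℝ) ^ (j * i))⁻¹) := by gcongr; exact h4 i hi j _
          _ = C4 * (((2:ℝ) ^ k) ^ i * ((2:ℝ) ^ (j * i))⁻¹) := by ring
          _ ≤ C4 * (2 ^ c) ^ i := by
            gcongr
            rw [← div_eq_mul_inv, div_le_iff₀ (by positivity), ← pow_mul, ← pow_mul, ← pow_add, ← add_mul]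
            refine pow_le_pow_right₀ (by norm_num) (Nat.mul_le_mul_right _ (by omega))
          _ ≤ _ := by
            rw [← pow_mul]
            gcongr
            norm_num
    have q2 : 1 ≤ ENNReal.ofReal (2 ^ ((|s| + 1) * c)) * ac s 1 j k := by
      unfold ac c1
      rw [← ENNReal.ofReal_rpow_of_pos (by norm_num)]
      simp only [ENNReal.ofReal_ofNat]
      rw [← two_rpow_add, ← two_rpow_add, one_mul]
      rw [← ENNReal.rpow_zero (x := 2)]
      refine ENNReal.rpow_le_rpow_of_exponent_le (by norm_num) ?_
      have a1 : (j:ℝ) ≤ k + c := by exact_mod_cast hjk.1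
      have a2 : (k:ℝ) ≤ j + c := by exact_mod_cast hjk.2
      have a3 : |(j:ℝ) - k| ≤ c := abs_le.mpr ⟨by linarith, by linarith⟩
      have a4 : |((k:ℝ) - j) * s| ≤ c * |s| := by
        rw [abs_mul, abs_sub_comm]; gcongr
      have := neg_abs_le (((k:ℝ) - j) * s)
      linarith
    calc _ ≤ ENNReal.ofReal A * 1 := by rw [mul_one]; exact ENNReal.ofReal_le_ofReal q1
      _ ≤ ENNReal.ofReal A * (ENNReal.ofReal (2 ^ ((|s| + 1) * c)) * ac s 1 j k) := mul_le_mul_right q2 _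
      _ = _ := by rw [← mul_assoc, ← ENNReal.ofReal_mul hA0]
  · have : mulS (dilate (φ j) ((2:ℝ)^k)) (LL θ χ ω ω0 t k) = 0 := by
      ext ξ
      rw [mulS_apply, dilate_apply _ (by positivity)]
      have en : ‖(2:ℝ)^k • ξ‖ = 2^k * ‖ξ‖ := by rw [norm_smul, Real.norm_of_nonneg (by positivity)]
      have p1 : 0 < 4 / ε := by positivity
      by_cases h5 : 3 * ε / 2 ≤ ‖ξ‖
      · rw [LL_zero' D t k h5]; simp
      push Not at h5
      by_cases h6 : k + c < j
      · rw [phi_zero' hφ j (by omega), zero_mul]; · rfl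
        have : (2:ℝ) ^ (k + c) ≤ 2 ^ j := pow_le_pow_right₀ (by norm_num) h6.le
        rw [pow_add] at this
        rw [en]
        have : (2:ℝ)^k * ‖ξ‖ < 2 ^ k * (3 * ε / 2) := by gcongr
        have : (2:ℝ)^k * (3 * ε) < 2 ^ k * 2 ^ c := by gcongr; linarith
        linarith
      · have h7 : j + c < k := by omega
        by_cases h8 : ‖ξ‖ < ε / 2
        · rw [LL_zero D t (by omega) h8]; simp
        push Not at h8
        rw [phi_zero hφ j, zero_mul]; · rfl
        have : (2:ℝ) ^ (j + c) ≤ 2 ^ k := pow_le_pow_right₀ (by norm_num) h7.le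
        rw [pow_add] at this
        rw [en, pow_succ]
        calc (2:ℝ) ^ j * 2 = 2 ^ j * (4 / ε) * (ε / 2) := by field_simp; norm_num
          _ < 2 ^ j * 2 ^ c * (ε / 2) := by gcongr; linarith
          _ ≤ 2 ^ k * ‖ξ‖ := by gcongr
    rw [this, QQ_zero, ENNReal.ofReal_zero]; exact bot_le

lemma key1 (n N : ℕ) {ε : ℝ} {Ψ ψ θ χ ω ω0 : Sch n} (D : Dat ε Ψ ψ θ χ ω ω0) {φ : ℕ → Sch n} (hφ : SmoothResolution n φ) (s : ℝ) :
    ∃ Ca : ℝ≥0∞, Ca ≠ ∞ ∧ ∀ (E : Type uE) [NormedAddCommGroup E] [NormedSpace ℂ E] (f : TDist n E), ∀ t ∈ Icc (9/8 : ℝ) (5/4), ∀ j x,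
      ‖mOp (φ j) f x‖ₑ ≤ Ca * ∑' k, ac s 1 j k * ∫⁻ z, ker k N (x - z) * ‖mOp (bb' Ψ ψ t k) f z‖ₑ := by
  obtain ⟨m, C, hC, hm⟩ := psi_expand.{uE} n N D
  obtain ⟨C2, hC2, h2⟩ := QQ_phiLL D hφ s m
  refine ⟨ENNReal.ofReal C * ENNReal.ofReal C2, ENNReal.mul_ne_top ENNReal.ofReal_ne_top ENNReal.ofReal_ne_top,
    fun E _ _ f t ht j x => (hm E f x _ t ht).trans ?_⟩
  rw [mul_assoc]
  refine mul_le_mul_right ?_ _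
  rw [← ENNReal.tsum_mul_left]
  refine ENNReal.tsum_le_tsum fun k => ?_
  rw [← mul_assoc]
  exact mul_le_mul_left (h2 t ht j k) _

end TL

namespace TL
universe uE

lemma iFD_dilate {n : ℕ} (ψ : Sch n) {t : ℝ} (ht : t ≠ 0) (l : ℕ) (y : Rn n) :
    iteratedFDeriv ℝ l (dilate ψ t) y = (t ^ l) • iteratedFDeriv ℝ l ψ (t • y) := by
  have h : (⇑(dilate ψ t)) = fun z => ψ (t • z) := by
    ext z; rw [dilate_apply _ ht]
  rw [h, iteratedFDeriv_comp_const_smul (f := ψ) t ((ψ.smooth ⊤).of_le (by exact_mod_cast le_top))]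

lemma QQ_dilate_sub {n : ℕ} (m : ℕ) (ψ : Sch n) {t t0 : ℝ} (h0 : 0 < t0) (ht : t0 / 2 ≤ t) :
    QQ m (dilate ψ t - dilate ψ t0) ≤ (∑ l ∈ Finset.range (m+1), |t ^ l - t0 ^ l|) * ((1 + 2 / t0) ^ m * (2 ^ m * QQ m ψ)) +
      |t - t0| * ((1 + t0) ^ m * ((1 + 2 / t0) ^ (m+1) * (2 ^ (m+1) * QQ (m+1) ψ))) := by
  have hQ := QQ_nonneg (m+1) ψ
  have hQ' := QQ_nonneg m ψ
  have ht0 : 0 < t := by linarith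
  have hc : (0:ℝ) < 2 / t0 := by positivity
  have base : ∀ M k l : ℕ, k ≤ M → l ≤ M → ∀ τ, t0 / 2 ≤ τ → ∀ z : Rn n, ‖z‖ ^ k * ‖iteratedFDeriv ℝ l ψ (τ • z)‖ ≤ (1 + 2 / t0) ^ M * (2 ^ M * QQ M ψ) := by
    intro M k l hk hl τ hτ z
    have h1 : ‖z‖ ^ k ≤ (1 + 2 / t0) ^ M * (1 + ‖τ • z‖) ^ k := by
      have h2 : ‖z‖ ≤ (1 + 2 / t0) * (1 + ‖τ • z‖) := by
        rw [norm_smul, Real.norm_eq_abs, abs_of_pos (by linarith)]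
        have : ‖z‖ ≤ (2 / t0) * (τ * ‖z‖) := by
          have : 1 ≤ (2 / t0) * τ := by rw [div_mul_eq_mul_div, le_div_iff₀ h0]; linarith
          nlinarith [norm_nonneg z]
        have h3 : 0 ≤ τ * ‖z‖ := mul_nonneg (by linarith) (norm_nonneg z)
        nlinarith
      calc ‖z‖ ^ k ≤ ((1 + 2 / t0) * (1 + ‖τ • z‖)) ^ k := pow_le_pow_left₀ (norm_nonneg _) h2 k
        _ = (1 + 2 / t0) ^ k * (1 + ‖τ • z‖) ^ k := mul_pow _ _ _
        _ ≤ _ := mul_le_mul_of_nonneg_right (pow_le_pow_right₀ (by linarith) hk) (by positivity)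
    calc _ ≤ ((1 + 2 / t0) ^ M * (1 + ‖τ • z‖) ^ k) * ‖iteratedFDeriv ℝ l ψ (τ • z)‖ := mul_le_mul_of_nonneg_right h1 (norm_nonneg _)
      _ = (1 + 2 / t0) ^ M * ((1 + ‖τ • z‖) ^ k * ‖iteratedFDeriv ℝ l ψ (τ • z)‖) := by ring
      _ ≤ _ := mul_le_mul_of_nonneg_left (le_QQ hk hl ψ _) (by positivity)
  refine QQ_le (by positivity) fun k l hk hl z => ?_
  have e : iteratedFDeriv ℝ l (dilate ψ t - dilate ψ t0) z =
      (t ^ l - t0 ^ l) • iteratedFDeriv ℝ l ψ (t • z) + t0 ^ l • (iteratedFDeriv ℝ l ψ (t • z) - iteratedFDeriv ℝ l ψ (t0 • z)) := by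
    have : (⇑(dilate ψ t - dilate ψ t0)) = ⇑(dilate ψ t) - ⇑(dilate ψ t0) := rfl
    rw [this, iteratedFDeriv_sub_apply ((dilate ψ t).contDiffAt l) ((dilate ψ t0).contDiffAt l), iFD_dilate _ ht0.ne', iFD_dilate _ h0.ne', smul_sub, sub_smul]
    abel
  have hd : Differentiable ℝ (iteratedFDeriv ℝ l ψ) :=
    (ψ.smooth ⊤).differentiable_iteratedFDeriv (by exact_mod_cast WithTop.coe_lt_top l)
  have hmv : ‖z‖ ^ k * ‖iteratedFDeriv ℝ l ψ (t • z) - iteratedFDeriv ℝ l ψ (t0 • z)‖ ≤ |t - t0| * ((1 + 2 / t0) ^ (m+1) * (2 ^ (m+1) * QQ (m+1) ψ)) := by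
    by_cases hz : ‖z‖ = 0
    · have : z = 0 := norm_eq_zero.mp hz
      subst this; simp only [smul_zero, sub_self, norm_zero, mul_zero]; positivity
    have hz0 : 0 < ‖z‖ := lt_of_le_of_ne (norm_nonneg _) (Ne.symm hz)
    have := (convex_segment (𝕜 := ℝ) (t0 • z) (t • z)).norm_image_sub_le_of_norm_fderiv_le (𝕜 := ℝ) (f := iteratedFDeriv ℝ l ψ)
      (C := ((1 + 2 / t0) ^ (m+1) * (2 ^ (m+1) * QQ (m+1) ψ)) / ‖z‖ ^ (k+1)) (fun ζ _ => hd ζ)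
      (fun ζ hζ => by
        rw [le_div_iff₀ (by positivity), norm_fderiv_iteratedFDeriv, mul_comm]
        obtain ⟨a, b, ha, hb, hab, rfl⟩ := hζ
        rw [smul_smul, smul_smul, ← add_smul]
        refine base (m+1) (k+1) (l+1) (by omega) (by omega) _ ?_ z
        nlinarith) (left_mem_segment ℝ _ _) (right_mem_segment ℝ _ _)
    rw [← sub_smul, norm_smul, Real.norm_eq_abs] at this
    calc _ ≤ ‖z‖ ^ k * (((1 + 2 / t0) ^ (m+1) * (2 ^ (m+1) * QQ (m+1) ψ)) / ‖z‖ ^ (k+1) * (|t - t0| * ‖z‖)) := mul_le_mul_of_nonneg_left this (by positivity)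
      _ = _ := by rw [pow_succ ‖z‖]; field_simp
  rw [e]
  calc _ ≤ ‖z‖ ^ k * (|t ^ l - t0 ^ l| * ‖iteratedFDeriv ℝ l ψ (t • z)‖ + t0 ^ l * ‖iteratedFDeriv ℝ l ψ (t • z) - iteratedFDeriv ℝ l ψ (t0 • z)‖) := by
        refine mul_le_mul_of_nonneg_left ((norm_add_le _ _).trans ?_) (by positivity)
        rw [norm_smul, norm_smul, Real.norm_eq_abs, Real.norm_eq_abs, abs_of_pos (pow_pos h0 l)]
    _ = |t ^ l - t0 ^ l| * (‖z‖ ^ k * ‖iteratedFDeriv ℝ l ψ (t • z)‖) + t0 ^ l * (‖z‖ ^ k * ‖iteratedFDeriv ℝ l ψ (t • z) - iteratedFDeriv ℝ l ψ (t0 • z)‖) := by ring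
    _ ≤ _ := by
        refine add_le_add (mul_le_mul ?_ (base m k l hk hl t ht z) (by positivity) (by positivity)) ?_
        · exact Finset.single_le_sum (f := fun l => |t ^ l - t0 ^ l|) (fun _ _ => abs_nonneg _) (Finset.mem_range.mpr (by omega))
        · have h5 : t0 ^ l ≤ (1 + t0) ^ m := (pow_le_pow_left₀ h0.le (by linarith) l).trans (pow_le_pow_right₀ (by linarith) hl)
          calc _ ≤ (1 + t0) ^ m * (|t - t0| * ((1 + 2 / t0) ^ (m+1) * (2 ^ (m+1) * QQ (m+1) ψ))) := mul_le_mul h5 hmv (by positivity) (by positivity)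
            _ = _ := by ring

lemma QQ_dilate_tendsto {n : ℕ} (m : ℕ) (ψ : Sch n) {t0 : ℝ} (h0 : 0 < t0) :
    Tendsto (fun t => QQ m (dilate ψ t - dilate ψ t0)) (𝓝 t0) (𝓝 0) := by
  have h : Tendsto (fun t => (∑ l ∈ Finset.range (m+1), |t ^ l - t0 ^ l|) * ((1 + 2 / t0) ^ m * (2 ^ m * QQ m ψ)) +
      |t - t0| * ((1 + t0) ^ m * ((1 + 2 / t0) ^ (m+1) * (2 ^ (m+1) * QQ (m+1) ψ)))) (𝓝 t0) (𝓝 0) := by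
    have : Continuous fun t : ℝ => (∑ l ∈ Finset.range (m+1), |t ^ l - t0 ^ l|) * ((1 + 2 / t0) ^ m * (2 ^ m * QQ m ψ)) +
      |t - t0| * ((1 + t0) ^ m * ((1 + 2 / t0) ^ (m+1) * (2 ^ (m+1) * QQ (m+1) ψ))) := by fun_prop
    simpa using this.tendsto t0
  refine squeeze_zero' (Eventually.of_forall fun _ => QQ_nonneg _ _) ?_ h
  filter_upwards [Ici_mem_nhds (show t0 / 2 < t0 by linarith)] with t ht
  exact QQ_dilate_sub m ψ h0 ht

lemma bb_continuous {n : ℕ} {E : Type*} [NormedAddCommGroup E] [NormedSpace ℂ E] (Ψ ψ : Sch n) (f : TDist n E) (m : ℕ) (y : Rn n) :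
    Continuous fun t : ℝ => mOp (bb' Ψ ψ (max (9/8) t) m) f y := by
  rcases Nat.eq_zero_or_pos m with rfl | hm
  · simp only [bb', if_true]; exact continuous_const
  simp only [bb', if_neg hm.ne']
  refine continuous_iff_seqContinuous.mpr fun u t0 hu => ?_
  have hp : 0 < max (9/8) t0 * ((2:ℝ)^m)⁻¹ := mul_pos (lt_max_of_lt_left (by norm_num)) (by positivity)
  refine mOp_tendsto f y fun k => ?_
  refine (QQ_dilate_tendsto k ψ hp).comp ?_
  have : Continuous fun t : ℝ => max (9/8) t * ((2:ℝ)^m)⁻¹ := by fun_prop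
  exact (this.tendsto t0).comp hu

end TL

namespace TL
universe uE

/-- averaging measure -/
def nu : Measure ℝ := (8:ℝ≥0∞) • volume.restrict (Icc (9/8:ℝ) (5/4))

lemma nu_univ : nu univ = 1 := by
  rw [nu, Measure.smul_apply, Measure.restrict_apply_univ, Real.volume_Icc, smul_eq_mul]
  rw [show (8:ℝ≥0∞) = ENNReal.ofReal 8 by simp, ← ENNReal.ofReal_mul (by norm_num)]
  norm_num

instance : IsProbabilityMeasure nu := ⟨nu_univ⟩

lemma add_rpow_le (a b : ℝ≥0∞) {y : ℝ} (hy : 0 ≤ y) : (a + b) ^ y ≤ 2 ^ y * (a ^ y + b ^ y) := by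
  have h : a + b ≤ 2 * max a b := by
    rw [two_mul]; exact add_le_add (le_max_left _ _) (le_max_right _ _)
  refine (ENNReal.rpow_le_rpow h hy).trans ?_
  rw [ENNReal.mul_rpow_of_nonneg _ _ hy]
  gcongr
  rcases le_total a b with h | h
  · rw [max_eq_right h]; exact le_add_self
  · rw [max_eq_left h]; exact le_self_add

lemma nu_ae : ∀ᵐ t ∂nu, t ∈ Icc (9/8:ℝ) (5/4) :=
  Measure.ae_smul_measure (ae_restrict_mem measurableSet_Icc) _

lemma scale_mem {t : ℝ} (ht : t ∈ Icc (9/8:ℝ) (5/4)) (m : ℕ) :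
    0 < t * ((2:ℝ)^m)⁻¹ ∧ ((2:ℝ)^(m+1))⁻¹ ≤ t * ((2:ℝ)^m)⁻¹ ∧ t * ((2:ℝ)^m)⁻¹ ≤ 2 * ((2:ℝ)^m)⁻¹ := by
  have h : (0:ℝ) < ((2:ℝ)^m)⁻¹ := by positivity
  refine ⟨mul_pos (by linarith [ht.1]) h, ?_, mul_le_mul_of_nonneg_right (by linarith [ht.2]) h.le⟩
  rw [pow_succ, mul_inv, mul_comm]
  exact mul_le_mul_of_nonneg_right (by linarith [ht.1]) h.le

lemma scale_mem1 {t : ℝ} (ht : t ∈ Icc (9/8:ℝ) (5/4)) {m : ℕ} (hm : 1 ≤ m) : t * ((2:ℝ)^m)⁻¹ ∈ Ioc (0:ℝ) 1 := by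
  refine ⟨(scale_mem ht m).1, (scale_mem ht m).2.2.trans ?_⟩
  rw [← div_eq_mul_inv, div_le_one (by positivity)]
  calc (2:ℝ) = 2 ^ 1 := by norm_num
    _ ≤ _ := pow_le_pow_right₀ (by norm_num) hm

lemma avg_le {s r : ℝ} {q : ℝ≥0∞} (hr : 0 < r) (hq : ENNReal.ofReal r ≤ q) : ∃ C : ℝ≥0∞, C ≠ ∞ ∧
    ∀ (g : ℝ → ℝ≥0∞) (W : ℕ → ℝ≥0∞),
    (∀ m, 1 ≤ m → AEMeasurable (fun t => g (t * ((2:ℝ)^m)⁻¹)) nu) →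
    (∀ m, 1 ≤ m → W m = (∫⁻ t, ((2:ℝ≥0∞) ^ ((m:ℝ) * s) * g (t * ((2:ℝ)^m)⁻¹)) ^ r ∂nu) ^ (1 / r)) →
    lqSum q W ≤ C * (W 0 + contQ s q g) := by
  have h2 : (2:ℝ≥0∞) ^ |s| ≠ ∞ := ENNReal.rpow_ne_top_of_nonneg (abs_nonneg s) (by norm_num)
  have h2' : 1 ≤ (2:ℝ≥0∞) ^ |s| := by
    rw [← ENNReal.rpow_zero (x := 2)]; exact ENNReal.rpow_le_rpow_of_exponent_le (by norm_num) (abs_nonneg s)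
  by_cases hq' : q = ∞
  · refine ⟨2 ^ |s|, h2, fun g W _ hW => ?_⟩
    rw [lqSum, if_pos hq', contQ, if_pos hq']
    set M := essSup (fun t : ℝ => ENNReal.ofReal (t ^ (-s)) * g t) (volume.restrict (Ioc (0 : ℝ) 1)) with hM
    refine iSup_le fun m => ?_
    rcases Nat.eq_zero_or_pos m with rfl | hm
    · exact le_self_add.trans (le_mul_of_one_le_left bot_le h2')
    rw [hW m hm]
    have hae : ∀ᵐ t ∂nu, (2:ℝ≥0∞) ^ ((m:ℝ) * s) * g (t * ((2:ℝ)^m)⁻¹) ≤ 2 ^ |s| * M := by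
      have h1 : ∀ᵐ t ∂(volume.restrict (Ioc (0 : ℝ) 1)), ENNReal.ofReal (t ^ (-s)) * g t ≤ M := ENNReal.ae_le_essSup _
      rw [ae_restrict_iff' measurableSet_Ioc, ae_iff] at h1
      have h3 : ∀ᵐ t : ℝ, t * ((2:ℝ)^m)⁻¹ ∈ Ioc (0:ℝ) 1 → ENNReal.ofReal ((t * ((2:ℝ)^m)⁻¹) ^ (-s)) * g (t * ((2:ℝ)^m)⁻¹) ≤ M := by
        rw [ae_iff]
        have := Real.volume_preimage_mul_right (a := ((2:ℝ)^m)⁻¹) (by positivity) {a : ℝ | ¬(a ∈ Ioc (0:ℝ) 1 → ENNReal.ofReal (a ^ (-s)) * g a ≤ M)}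
        rw [h1, mul_zero] at this
        exact this
      have h4 : ∀ᵐ t ∂nu, t * ((2:ℝ)^m)⁻¹ ∈ Ioc (0:ℝ) 1 → ENNReal.ofReal ((t * ((2:ℝ)^m)⁻¹) ^ (-s)) * g (t * ((2:ℝ)^m)⁻¹) ≤ M :=
        Measure.ae_smul_measure (ae_restrict_of_ae h3) _
      filter_upwards [h4, nu_ae] with t ht hT
      obtain ⟨-, h5, h6⟩ := scale_mem hT m
      calc _ ≤ 2 ^ |s| * ENNReal.ofReal ((t * ((2:ℝ)^m)⁻¹) ^ (-s)) * g (t * ((2:ℝ)^m)⁻¹) := mul_le_mul_left (rpow_cmp s m h5 h6).2 _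
        _ ≤ _ := by rw [mul_assoc]; exact mul_le_mul_right (ht (scale_mem1 hT hm)) _
    calc _ ≤ (∫⁻ t, (2 ^ |s| * M) ^ r ∂nu) ^ (1 / r) := by
          refine ENNReal.rpow_le_rpow (lintegral_mono_ae ?_) (by positivity)
          filter_upwards [hae] with t ht
          exact ENNReal.rpow_le_rpow ht hr.le
      _ = 2 ^ |s| * M := by
          rw [lintegral_const, nu_univ, mul_one, ← ENNReal.rpow_mul, mul_one_div_cancel hr.ne', ENNReal.rpow_one]
      _ ≤ _ := mul_le_mul_right le_add_self _
  · have hq0 : 0 < q.toReal := ENNReal.toReal_pos (fun h => by rw [h] at hq; simp at hq; linarith) hq'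
    have hrq : r ≤ q.toReal := (ENNReal.ofReal_le_iff_le_toReal hq').mp hq
    set Q := q.toReal with hQ
    refine ⟨2 ^ (1 / Q) * (16 * (2 ^ |s|) ^ Q + 1) ^ (1 / Q), ?_, fun g W hg hW => ?_⟩
    · have : (2:ℝ≥0∞) ^ (1/Q) ≠ ∞ := ENNReal.rpow_ne_top_of_nonneg (by positivity) (by norm_num)
      refine ENNReal.mul_ne_top this (ENNReal.rpow_ne_top_of_nonneg (by positivity) ?_)
      exact ENNReal.add_ne_top.mpr ⟨ENNReal.mul_ne_top (by norm_num) (ENNReal.rpow_ne_top_of_nonneg hq0.le h2), by norm_num⟩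
    rw [lqSum, if_neg hq', contQ, if_neg hq']
    set H : ℝ → ℝ≥0∞ := fun t => (ENNReal.ofReal (t ^ (-s)) * g t) ^ Q * ENNReal.ofReal t⁻¹ with hH
    set A : ℕ → Set ℝ := fun m => Icc (9/8 * ((2:ℝ)^m)⁻¹) (5/4 * ((2:ℝ)^m)⁻¹) with hA
    have hAm : ∀ m, A m = (fun t => t * ((2:ℝ)^m)⁻¹) '' Icc (9/8:ℝ) (5/4) := fun m => by
      rw [image_mul_right_Icc' _ _ (by positivity)]
    have step : ∀ m, 1 ≤ m → W m ^ Q ≤ 16 * (2 ^ |s|) ^ Q * ∫⁻ t in A m, H t := by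
      intro m hm
      have hcv : ∫⁻ t in A m, H t = ∫⁻ t in Icc (9/8:ℝ) (5/4), ENNReal.ofReal |((2:ℝ)^m)⁻¹| * H (t * ((2:ℝ)^m)⁻¹) := by
        rw [hAm]
        refine lintegral_image_eq_lintegral_abs_deriv_mul measurableSet_Icc (f' := fun _ => ((2:ℝ)^m)⁻¹) (fun t _ => ?_) ?_ H
        · exact (hasDerivAt_mul_const _).hasDerivWithinAt
        · exact (mul_left_injective₀ (by positivity)).injOn
      rw [hW m hm, ← ENNReal.rpow_mul, show 1 / r * Q = Q / r by ring]
      have hJ := jensen_pow nu (h := fun t => ((2:ℝ≥0∞) ^ ((m:ℝ) * s) * g (t * ((2:ℝ)^m)⁻¹)) ^ r) (((hg m hm).const_mul _).pow_const r) (Q := Q / r) ((one_le_div hr).mpr hrq)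
      rw [nu_univ, ENNReal.one_rpow, one_mul] at hJ
      refine hJ.trans ?_
      have e1 : ∀ a : ℝ≥0∞, (a ^ r) ^ (Q / r) = a ^ Q := fun a => by rw [← ENNReal.rpow_mul, mul_div_cancel₀ _ hr.ne']
      simp only [e1]
      rw [nu, lintegral_smul_measure, smul_eq_mul, hcv, show (16:ℝ≥0∞) * (2 ^ |s|) ^ Q = 8 * (2 * (2 ^ |s|) ^ Q) by rw [← mul_assoc]; norm_num, mul_assoc]
      refine mul_le_mul_right ?_ _
      rw [← lintegral_const_mul' _ _ (ENNReal.mul_ne_top (by norm_num) (ENNReal.rpow_ne_top_of_nonneg hq0.le h2))]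
      refine setLIntegral_mono_ae' measurableSet_Icc (Eventually.of_forall fun t ht => ?_)
      obtain ⟨h7, h5, h6⟩ := scale_mem ht m
      simp only [hH]
      have h8 : (1:ℝ≥0∞) ≤ 2 * (ENNReal.ofReal |((2:ℝ)^m)⁻¹| * ENNReal.ofReal (t * ((2:ℝ)^m)⁻¹)⁻¹) := by
        have ht0 : 0 < t := by linarith [ht.1]
        rw [← ENNReal.ofReal_mul (abs_nonneg _), show (2:ℝ≥0∞) = ENNReal.ofReal 2 by simp, ← ENNReal.ofReal_mul (by norm_num), ENNReal.one_le_ofReal, abs_of_pos (by positivity)]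
        have : 2 * (((2:ℝ)^m)⁻¹ * (t * ((2:ℝ)^m)⁻¹)⁻¹) = 2 / t := by field_simp
        rw [this, one_le_div ht0]; linarith [ht.2]
      calc _ ≤ ((2 ^ |s|) * (ENNReal.ofReal ((t * ((2:ℝ)^m)⁻¹) ^ (-s)) * g (t * ((2:ℝ)^m)⁻¹))) ^ Q := by
            refine ENNReal.rpow_le_rpow ?_ hq0.le
            rw [← mul_assoc]
            exact mul_le_mul_left (rpow_cmp s m h5 h6).2 _
        _ = (2 ^ |s|) ^ Q * (ENNReal.ofReal ((t * ((2:ℝ)^m)⁻¹) ^ (-s)) * g (t * ((2:ℝ)^m)⁻¹)) ^ Q * 1 := by rw [ENNReal.mul_rpow_of_nonneg _ _ hq0.le, mul_one]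
        _ ≤ (2 ^ |s|) ^ Q * (ENNReal.ofReal ((t * ((2:ℝ)^m)⁻¹) ^ (-s)) * g (t * ((2:ℝ)^m)⁻¹)) ^ Q * (2 * (ENNReal.ofReal |((2:ℝ)^m)⁻¹| * ENNReal.ofReal (t * ((2:ℝ)^m)⁻¹)⁻¹)) := mul_le_mul_right h8 _
        _ = _ := by ring
    have hsum : ∑' m, ∫⁻ t in A (m+1), H t ≤ ∫⁻ t in Ioc (0:ℝ) 1, H t := by
      rw [← lintegral_iUnion (fun m => measurableSet_Icc) ?_]
      · refine lintegral_mono_set (iUnion_subset fun m => ?_)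
        change A (m+1) ⊆ _
        rw [hAm]
        rintro _ ⟨t, ht, rfl⟩
        exact scale_mem1 ht (by omega)
      · have : ∀ m m', m < m' → Disjoint (A (m+1)) (A (m'+1)) := by
          intro m m' h
          refine Set.disjoint_left.mpr fun t h1 h2 => ?_
          have h3 : 2 * ((2:ℝ)^(m'+1))⁻¹ ≤ ((2:ℝ)^(m+1))⁻¹ := by
            rw [← div_eq_mul_inv, div_le_iff₀ (by positivity), inv_mul_eq_div, le_div_iff₀ (by positivity), ← pow_succ']
            exact pow_le_pow_right₀ (by norm_num) (by omega)
          have h4 : (0:ℝ) < ((2:ℝ)^(m+1))⁻¹ := by positivity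
          have h5 := h1.1
          have h6 := h2.2
          linarith
        intro m m' h
        rcases lt_or_gt_of_ne h with h | h
        · exact this _ _ h
        · exact (this _ _ h).symm
    set I := ∫⁻ t in Ioc (0:ℝ) 1, H t with hI
    set K : ℝ≥0∞ := 16 * (2 ^ |s|) ^ Q with hK
    calc (∑' j, W j ^ Q) ^ (1 / Q) = (W 0 ^ Q + ∑' j, W (j+1) ^ Q) ^ (1 / Q) := by rw [tsum_eq_zero_add' ENNReal.summable]
      _ ≤ ((K + 1) * (W 0 ^ Q + I)) ^ (1 / Q) := by
          refine ENNReal.rpow_le_rpow ?_ (by positivity)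
          rw [mul_add]
          refine add_le_add (le_mul_of_one_le_left bot_le le_add_self) ?_
          calc _ ≤ ∑' j, K * ∫⁻ t in A (j+1), H t := ENNReal.tsum_le_tsum fun j => step _ (by omega)
            _ ≤ K * I := by rw [ENNReal.tsum_mul_left]; exact mul_le_mul_right hsum _
            _ ≤ _ := mul_le_mul_left le_self_add _
      _ = (K + 1) ^ (1/Q) * (W 0 ^ Q + I) ^ (1/Q) := ENNReal.mul_rpow_of_nonneg _ _ (by positivity)
      _ ≤ (K + 1) ^ (1/Q) * (2 ^ (1/Q) * ((W 0 ^ Q) ^ (1/Q) + I ^ (1/Q))) := mul_le_mul_right (add_rpow_le _ _ (by positivity)) _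
      _ = _ := by rw [← ENNReal.rpow_mul, mul_one_div_cancel hq0.ne', ENNReal.rpow_one]; ring

end TL

namespace TL
universe uE

lemma avg_swap {n : ℕ} {B v : ℝ≥0∞} (hB : B ≠ ∞) (a : ℕ → ℝ≥0∞) (b : ℕ → ℕ → ℝ≥0∞) (Φ : ℕ → ℝ → Rn n → ℝ≥0∞)
    (hΦ : ∀ m, Measurable (Function.uncurry (Φ m))) (x : Rn n)
    (h : ∀ t ∈ Icc (9/8:ℝ) (5/4), v ≤ B * ∑' j, a j * ∑' m, b j m * KC m (Φ m t) x) :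
    v ≤ B * ∑' j, a j * ∑' m, b j m * KC m (fun y => ∫⁻ t, Φ m t y ∂nu) x := by
  have hk : ∀ m, Measurable fun z : ℝ × Rn n => ker m (n+1) (x - z.2) * Φ m z.1 z.2 := fun m =>
    ((measurable_ker m _).comp (measurable_const.sub measurable_snd)).mul (hΦ m)
  have hK : ∀ m, Measurable fun t => KC m (Φ m t) x := fun m => (hk m).lintegral_prod_right'
  have hb : ∀ j m, Measurable fun t => b j m * KC m (Φ m t) x := fun j m => (hK m).const_mul _
  have hs : ∀ j, Measurable fun t => ∑' m, b j m * KC m (Φ m t) x := fun j => Measurable.tsum (hb j)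
  calc v = ∫⁻ _, v ∂nu := by rw [lintegral_const, nu_univ, mul_one]
    _ ≤ ∫⁻ t, B * ∑' j, a j * ∑' m, b j m * KC m (Φ m t) x ∂nu := by
        refine lintegral_mono_ae ?_
        filter_upwards [nu_ae] with t ht using h t ht
    _ = B * ∑' j, a j * ∑' m, b j m * ∫⁻ t, KC m (Φ m t) x ∂nu := by
        rw [lintegral_const_mul' _ _ hB, lintegral_tsum fun j => ((hs j).const_mul _).aemeasurable]
        congr 2; ext j
        rw [lintegral_const_mul _ (hs j), lintegral_tsum fun m => (hb j m).aemeasurable]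
        congr 2; ext m
        rw [lintegral_const_mul _ (hK m)]
    _ = _ := by
        have e : ∀ m, ∫⁻ t, KC m (Φ m t) x ∂nu = KC m (fun y => ∫⁻ t, Φ m t y ∂nu) x := by
          intro m
          unfold KC
          rw [lintegral_lintegral_swap (hk m).aemeasurable]
          refine lintegral_congr fun y => ?_
          rw [lintegral_const_mul]
          exact (hΦ m).comp (measurable_id.prodMk measurable_const)
        simp only [e]

lemma phi_le_I (n : ℕ) {s ε : ℝ} {p q : ℝ≥0∞} (hp : 0 < p) (hp' : p ≠ ∞) (hq : 0 < q) (hε : 0 < ε)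
    {φ : ℕ → Sch n} (hφ : SmoothResolution n φ) (Ψ ψ : Sch n)
    (hΨ : ∀ x : Rn n, ‖x‖ < 2 * ε → 0 < ‖Ψ x‖)
    (hψ : ∀ x : Rn n, ε / 2 < ‖x‖ → ‖x‖ < 2 * ε → 0 < ‖ψ x‖) :
    ∃ C : ℝ≥0∞, C ≠ ∞ ∧ ∀ (E : Type uE) [NormedAddCommGroup E] [NormedSpace ℂ E] (f : TDist n E),
      triebelNorm s p q φ f ≤ C * triebelContNormI s p q Ψ ψ f := by
  have hp0 : 0 < p.toReal := ENNReal.toReal_pos hp.ne' hp'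
  obtain ⟨r, hr, hr1, hrp, hrq⟩ := r_exists hp0 hq
  obtain ⟨θ, χ, ω, ω0, D⟩ := dat_exists hε hΨ hψ
  obtain ⟨N, hN⟩ := pre_ineq n s 1 hr hr1
  obtain ⟨Ca, hCa, ha⟩ := key1.{uE} n N D hφ s
  obtain ⟨CN, hCN, hH⟩ := H1_psi.{uE} n D
  obtain ⟨B, hB, hB'⟩ := hN CN hCN Ca hCa
  obtain ⟨C, hC, hm⟩ := main_ineq n hr hrp hrq (mul_pos one_pos hr) hB
  obtain ⟨C', hC', hA⟩ := avg_le (s := s) hr hrq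
  have h2p : (2:ℝ≥0∞) ^ p.toReal ≠ ∞ := ENNReal.rpow_ne_top_of_nonneg hp0.le (by norm_num)
  have h2p' : (2:ℝ≥0∞) ^ (1/p.toReal) ≠ ∞ := ENNReal.rpow_ne_top_of_nonneg (by positivity) (by norm_num)
  refine ⟨C ^ (1 / p.toReal) * (C' * (2 * 2 ^ (1/p.toReal))), ENNReal.mul_ne_top (ENNReal.rpow_ne_top_of_nonneg (by positivity) hC)
    (ENNReal.mul_ne_top hC' (ENNReal.mul_ne_top (by norm_num) h2p')), fun E _ _ f => ?_⟩
  set uu : ℕ → ℝ → Rn n → ℝ≥0∞ := fun m t y => ‖mOp (bb' Ψ ψ (max (9/8) t) m) f y‖ₑ with huu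
  have muu : ∀ m, Measurable (Function.uncurry (uu m)) := fun m =>
    measurable_uncurry_of_continuous_of_measurable (fun y => (bb_continuous Ψ ψ f m y).enorm) (fun t => (mOp_continuous _ f).enorm.measurable)
  set Φ : ℕ → ℝ → Rn n → ℝ≥0∞ := fun m t y => ((2:ℝ≥0∞) ^ ((m:ℝ) * s) * uu m t y) ^ r with hΦ
  have mΦ : ∀ m, Measurable (Function.uncurry (Φ m)) := fun m => ((muu m).const_mul _).pow_const r
  set W : ℕ → Rn n → ℝ≥0∞ := fun m y => (∫⁻ t, Φ m t y ∂nu) ^ (1 / r) with hW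
  have mW : ∀ m, Measurable (W m) := fun m => ((mΦ m).lintegral_prod_left').pow_const _
  have Wr : ∀ m y, W m y ^ r = ∫⁻ t, Φ m t y ∂nu := fun m y => by
    simp only [hW]; rw [← ENNReal.rpow_mul, one_div_mul_cancel hr.ne', ENNReal.rpow_one]
  have hX := hm (fun j x => (2 : ℝ≥0∞) ^ ((j : ℝ) * s) * (‖mOp (φ j) f x‖₊ : ℝ≥0∞)) W mW (fun k x => by
    simp only [Wr]
    refine avg_swap hB (fun j => c1 (1 * r) k j) c2 Φ mΦ x fun t ht => ?_
    have e : max (9/8) t = t := max_eq_right ht.1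
    have := hB' (fun j x => ‖mOp (bb' Ψ ψ t j) f x‖ₑ) (Gr_of _ (QQ_bb Ψ ψ ht) f) (hH E f t ht) ‖mOp (φ k) f x‖ₑ k x (ha E f t ht k x)
    simp only [hΦ, huu, e]
    exact this)
  have hX' := lpN_le hp hp' hX
  have hpt : ∀ x, lqSum q (fun m => W m x) ≤ C' * (‖mOp Ψ f x‖ₑ + contQ s q (fun t => (‖mOp (dilate ψ t) f x‖₊ : ℝ≥0∞))) := by
    intro x
    have hbb : ∀ m, 1 ≤ m → ∀ᵐ t ∂nu, uu m t x = (‖mOp (dilate ψ (t * ((2:ℝ)^m)⁻¹)) f x‖₊ : ℝ≥0∞) := by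
      intro m hm
      filter_upwards [nu_ae] with t ht
      simp only [huu, max_eq_right ht.1, bb', if_neg (show m ≠ 0 by omega)]
      rfl
    have h1 := hA (fun t => (‖mOp (dilate ψ t) f x‖₊ : ℝ≥0∞)) (fun m => W m x) (fun m hm => ?_) (fun m hm => ?_)
    · have hW0 : W 0 x = ‖mOp Ψ f x‖ₑ := by
        simp only [hW, hΦ, huu, bb', if_true, Nat.cast_zero, zero_mul, ENNReal.rpow_zero, one_mul]
        rw [lintegral_const, nu_univ, mul_one, ← ENNReal.rpow_mul, mul_one_div_cancel hr.ne', ENNReal.rpow_one]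
      rw [← hW0]; exact h1
    · exact ((muu m).comp (measurable_id.prodMk measurable_const)).aemeasurable.congr (hbb m hm)
    · simp only [hW]
      congr 1
      refine lintegral_congr_ae ?_
      filter_upwards [hbb m hm] with t ht
      simp only [hΦ]; rw [ht]
  have hY := lpN_mono hp' hpt
  rw [lpN_mul hp hp' hC'] at hY
  have hI : triebelContNormI s p q Ψ ψ f = lpNormENN p (fun x => ‖mOp Ψ f x‖ₑ) + lpNormENN p (fun x => contQ s q (fun t => (‖mOp (dilate ψ t) f x‖₊ : ℝ≥0∞))) := by
    have : eLpNorm (mOp Ψ f) p volume = lpNormENN p (fun x => ‖mOp Ψ f x‖ₑ) := by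
      rw [lpNormENN, if_neg hp', eLpNorm_eq_lintegral_rpow_enorm_toReal hp.ne' hp']
    rw [← this]; rfl
  have mΨ : Measurable fun x => ‖mOp Ψ f x‖ₑ := (mOp_continuous Ψ f).enorm.measurable
  have tri : ∀ g h : Rn n → ℝ≥0∞, Measurable g → lpNormENN p (fun x => g x + h x) ≤ 2 * 2 ^ (1/p.toReal) * (lpNormENN p g + lpNormENN p h) := by
    intro g h hg
    simp only [lpNormENN, if_neg hp']
    calc _ ≤ (∫⁻ x, 2 ^ p.toReal * (g x ^ p.toReal + h x ^ p.toReal)) ^ (1/p.toReal) :=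
          ENNReal.rpow_le_rpow (lintegral_mono fun x => add_rpow_le _ _ hp0.le) (by positivity)
      _ = 2 * (∫⁻ x, g x ^ p.toReal + h x ^ p.toReal) ^ (1/p.toReal) := by
          rw [lintegral_const_mul' _ _ h2p, ENNReal.mul_rpow_of_nonneg _ _ (by positivity), ← ENNReal.rpow_mul, mul_one_div_cancel hp0.ne', ENNReal.rpow_one]
      _ = 2 * ((∫⁻ x, g x ^ p.toReal) + ∫⁻ x, h x ^ p.toReal) ^ (1/p.toReal) := by rw [lintegral_add_left (hg.pow_const _)]
      _ ≤ _ := by rw [mul_assoc]; exact mul_le_mul_right (add_rpow_le _ _ (one_div_pos.mpr hp0).le) _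
  calc triebelNorm s p q φ f ≤ C ^ (1 / p.toReal) * lpNormENN p (fun x => lqSum q (fun m => W m x)) := hX'
    _ ≤ C ^ (1 / p.toReal) * (C' * (2 * 2 ^ (1/p.toReal) * triebelContNormI s p q Ψ ψ f)) := by
        rw [hI]
        exact mul_le_mul_right (hY.trans (mul_le_mul_right (tri _ _ mΨ) _)) _
    _ = _ := by ring

end TL

variable {n : ℕ} {E : Type*} [NormedAddCommGroup E] [NormedSpace ℂ E]

variable {n : ℕ} {E : Type*} [NormedAddCommGroup E] [NormedSpace ℂ E]

/-- continuous versions of the `F^s_{p,q}(E)` characterizations. -/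
theorem statement5 (n : ℕ) (E : Type*) [NormedAddCommGroup E] [NormedSpace ℂ E]
    [CompleteSpace E] (s : ℝ) (p q : ℝ≥0∞) (hp : 0 < p) (hp' : p ≠ ∞) (hq : 0 < q)
    (d : ℝ) (hd : 0 < d)
    (S : ℤ) (hS : -1 ≤ S) (hSs : ⌊s⌋ ≤ S)
    (ε : ℝ) (hε : 0 < ε) (Ψ ψ : Sch n)
    (hΨ : ∀ x : Rn n, ‖x‖ < 2 * ε → 0 < ‖Ψ x‖)
    (hψ : ∀ x : Rn n, ε / 2 < ‖x‖ → ‖x‖ < 2 * ε → 0 < ‖ψ x‖)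
    (hmom : ∀ α : Fin n → ℕ, (mdeg α : ℤ) ≤ S → mderiv α (fun y => ψ y) 0 = 0)
    (φ : ℕ → Sch n) (hφ : SmoothResolution n φ) :
    (∃ c₁ > (0 : ℝ), ∃ c₂ > (0 : ℝ), ∃ c₃ > (0 : ℝ), ∃ c₄ > (0 : ℝ),
      ∀ f : TDist n E, triebelNorm s p q φ f < ∞ →
        ENNReal.ofReal c₁ * triebelNorm s p q φ f ≤ triebelContNormI s p q Ψ ψ f ∧
        triebelContNormI s p q Ψ ψ f ≤ ENNReal.ofReal c₂ * triebelNorm s p q φ f ∧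
        ENNReal.ofReal c₃ * triebelNorm s p q φ f ≤ triebelContNormSup s p q d Ψ ψ f ∧
        triebelContNormSup s p q d Ψ ψ f ≤ ENNReal.ofReal c₄ * triebelNorm s p q φ f) ∧
    (∀ f : TDist n E, triebelNorm s p q φ f < ∞ ↔ triebelContNormI s p q Ψ ψ f < ∞) ∧
    ∀ f : TDist n E, triebelNorm s p q φ f < ∞ ↔ triebelContNormSup s p q d Ψ ψ f < ∞ := by
  obtain ⟨C1, hC1, h1⟩ := TL.phi_le_I (s := s) n hp hp' hq hε hφ Ψ ψ hΨ hψ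
  obtain ⟨C2, hC2, h2⟩ := TL.sup_le_phi n hp hp' hq hd hφ Ψ ψ (S + 1).toNat (s := s) (by
    have e : (((S + 1).toNat : ℤ)) = S + 1 := Int.toNat_of_nonneg (by omega)
    have e' : (((S + 1).toNat : ℕ) : ℝ) = (S : ℝ) + 1 := by exact_mod_cast e
    rw [e']
    have : ((⌊s⌋ : ℤ) : ℝ) ≤ (S : ℝ) := by exact_mod_cast hSs
    linarith [Int.lt_floor_add_one s]) (TL.van_mom hmom)
  have a1 := fun f : TDist n E => h1 E f
  have a2 := fun f : TDist n E => h2 E f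
  have a3 := fun f : TDist n E => TL.I_le_sup (s := s) (q := q) n hp hp' hd Ψ ψ f
  have low : ∀ A B : ℝ≥0∞, A ≤ C1 * B → ENNReal.ofReal ((C1.toReal + 1)⁻¹) * A ≤ B := by
    intro A B h
    have h0 : 0 < C1.toReal + 1 := by positivity
    rw [ENNReal.ofReal_inv_of_pos h0]
    have h3 : C1 ≤ ENNReal.ofReal (C1.toReal + 1) := by
      rw [ENNReal.le_ofReal_iff_toReal_le hC1 h0.le]; linarith
    refine (mul_le_mul_right (h.trans (mul_le_mul_left h3 B)) _).trans ?_
    rw [← mul_assoc, ENNReal.inv_mul_cancel (by simpa using h0) ENNReal.ofReal_ne_top, one_mul]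
  have up : ∀ A B : ℝ≥0∞, A ≤ C2 * B → A ≤ ENNReal.ofReal (C2.toReal + 1) * B := by
    intro A B h
    have h3 : C2 ≤ ENNReal.ofReal (C2.toReal + 1) := by
      rw [ENNReal.le_ofReal_iff_toReal_le hC2 (by positivity)]; linarith
    exact h.trans (mul_le_mul_left h3 B)
  refine ⟨⟨(C1.toReal + 1)⁻¹, by positivity, C2.toReal + 1, by positivity, (C1.toReal + 1)⁻¹, by positivity, C2.toReal + 1, by positivity,
    fun f _ => ⟨low _ _ (a1 f), up _ _ ((a3 f).trans (a2 f)), low _ _ ((a1 f).trans (mul_le_mul_right (a3 f) _)), up _ _ (a2 f)⟩⟩, fun f => ⟨fun h => ?_, fun h => ?_⟩, fun f => ⟨fun h => ?_, fun h => ?_⟩⟩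
  · exact ((a3 f).trans (a2 f)).trans_lt (ENNReal.mul_lt_top hC2.lt_top h)
  · exact (a1 f).trans_lt (ENNReal.mul_lt_top hC1.lt_top h)
  · exact (a2 f).trans_lt (ENNReal.mul_lt_top hC2.lt_top h)
  · exact ((a1 f).trans (mul_le_mul_right (a3 f) _)).trans_lt (ENNReal.mul_lt_top hC1.lt_top h)

end
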